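/- arXiv:2109.03129 — 2 statements merged into one kernel-verified Lean document; each statement's English description precedes it below -/
import Mathlib

section
/- For every n ∈ ℕ and every simple graph G on n vertices, s(G) ≤ 2n/√3. -/
/- The adjacency matrix (over `ℝ`) of a simple graph on `Fin n`. -/
open scoped Classical in
noncomputable def adjMat {n : ℕ} (G : SimpleGraph (Fin n)) : Matrix (Fin n) (Fin n) ℝ :=
  fun i j => if G.Adj i j then 1 else 0

lemma adjMat_isHermitian {n : ℕ} (G : SimpleGraph (Fin n)) :
    (adjMat G).IsHermitian := by
  classical
  unfold Matrix.IsHermitian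
  ext i j
  simp only [Matrix.conjTranspose_apply, adjMat]
  rw [show star (if G.Adj j i then (1:ℝ) else 0) = (if G.Adj j i then (1:ℝ) else 0) from
    star_trivial _]
  exact if_congr (G.adj_comm j i) rfl rfl

/-- The eigenvalues of the adjacency matrix of `G`. -/
noncomputable def graphEigs {n : ℕ} (G : SimpleGraph (Fin n)) : Fin n → ℝ :=
  (adjMat_isHermitian G).eigenvalues

/-- `λ₁(G)`, the largest adjacency eigenvalue. -/
noncomputable def lamMax {n : ℕ} (G : SimpleGraph (Fin n)) : ℝ := ⨆ i, graphEigs G i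

/-- `λₙ(G)`, the smallest adjacency eigenvalue. -/
noncomputable def lamMin {n : ℕ} (G : SimpleGraph (Fin n)) : ℝ := ⨅ i, graphEigs G i

/-- The spread `s(G) = λ₁(G) - λₙ(G)`. -/
noncomputable def spread {n : ℕ} (G : SimpleGraph (Fin n)) : ℝ := lamMax G - lamMin G

section Helpers
open Real
set_option linter.unusedSectionVars false
set_option linter.unusedVariables false

/-- Angle bookkeeping for the first mixed case. -/
lemma caseII_pre (τ σ d : ℝ) (h0 : 0 ≤ τ) (h1 : τ < σ) (h2 : σ < π / 2) (hd : 0 < d)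
    (hv : d ≤ cos (2 * τ)) (hi : d * cos (2 * τ) < 1 / 2)
    (hp : (2 * cos (σ + τ) - 1) * (2 * d * cos (σ - τ) - 1) < 0)
    (hiii : d * sin (σ + τ) ≤ sin (σ - τ))
    (hiv : sin (2 * σ) ≤ sin (σ - τ) + d * sin (σ + τ)) :
    σ + τ < π / 3 ∧ d * cos (σ - τ) < 1 / 2 ∧ π / 6 < σ - τ ∧ τ < π / 12 ∧
      cos ((3 * σ - τ) / 2) ≤ d * cos ((σ + τ) / 2) := by
  have hpi := pi_pos
  have hcD : 0 < cos (σ - τ) := cos_pos_of_mem_Ioo ⟨by linarith, by linarith⟩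
  have hsS : 0 < sin (σ + τ) := sin_pos_of_pos_of_lt_pi (by linarith) (by linarith)
  have hsh : 0 < sin ((σ + τ) / 2) := sin_pos_of_pos_of_lt_pi (by linarith) (by linarith)
  have hchord : cos ((3 * σ - τ) / 2) ≤ d * cos ((σ + τ) / 2) := by
    have e1 : sin (2 * σ) - sin (σ - τ) = 2 * cos ((3 * σ - τ) / 2) * sin ((σ + τ) / 2) := by
      rw [sin_sub_sin]
      rw [show (2 * σ + (σ - τ)) / 2 = (3 * σ - τ) / 2 by ring,
        show (2 * σ - (σ - τ)) / 2 = (σ + τ) / 2 by ring]; ring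
    have e2 : sin (σ + τ) = 2 * sin ((σ + τ) / 2) * cos ((σ + τ) / 2) := by
      rw [← sin_two_mul]; congr 1; ring
    by_contra hc
    push Not at hc
    have := mul_pos hsh (sub_pos.2 hc)
    nlinarith
  rcases mul_neg_iff.1 hp with ⟨ha, hb⟩ | ⟨ha, hb⟩
  · have hS : σ + τ < π / 3 := by
      by_contra hc
      push Not at hc
      have := cos_le_cos_of_nonneg_of_le_pi (by linarith) (by linarith) hc
      rw [cos_pi_div_three] at this
      linarith
    have hneg : cos ((σ + τ) / 2 + 2 * (σ - τ)) < 0 := by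
      have e : 2 * cos (σ - τ) * cos ((3 * σ - τ) / 2)
          = cos ((σ + τ) / 2 + 2 * (σ - τ)) + cos ((σ + τ) / 2) := by
        rw [cos_add_cos]
        rw [show ((σ + τ) / 2 + 2 * (σ - τ) + (σ + τ) / 2) / 2 = (3 * σ - τ) / 2 by ring,
          show ((σ + τ) / 2 + 2 * (σ - τ) - (σ + τ) / 2) / 2 = σ - τ by ring]; ring
      have hch : 0 < cos ((σ + τ) / 2) := cos_pos_of_mem_Ioo ⟨by linarith, by linarith⟩
      nlinarith [mul_le_mul_of_nonneg_left hchord hcD.le, mul_pos hch (show 0 < 1 - 2 * d * cos (σ - τ) by linarith)]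
    have h5 : π / 2 < (σ + τ) / 2 + 2 * (σ - τ) := by
      by_contra hc
      push Not at hc
      have := cos_nonneg_of_mem_Icc (x := (σ + τ) / 2 + 2 * (σ - τ)) ⟨by linarith, hc⟩
      linarith
    exact ⟨hS, by linarith, by linarith, by linarith, hchord⟩
  · exfalso
    have k1 : sin (σ + τ) < sin (2 * (σ - τ)) := by
      rw [sin_two_mul]
      nlinarith [mul_le_mul_of_nonneg_left hiii hcD.le]
    have k2 : σ - τ < 2 * τ := by
      by_contra hc
      push Not at hc
      have := cos_le_cos_of_nonneg_of_le_pi (by linarith) (by linarith) hc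
      nlinarith
    have k3 : π < 2 * τ + 3 * (σ - τ) := by
      by_contra hc
      push Not at hc
      have : sin (2 * (σ - τ)) ≤ sin (σ + τ) := by
        have : 0 ≤ sin (σ + τ) - sin (2 * (σ - τ)) := by
          rw [sin_sub_sin]
          have a1 := sin_nonneg_of_nonneg_of_le_pi
            (x := (σ + τ - 2 * (σ - τ)) / 2) (by linarith) (by linarith)
          have a2 := cos_nonneg_of_mem_Icc
            (x := (σ + τ + 2 * (σ - τ)) / 2) ⟨by linarith, by linarith⟩
          positivity
        linarith
      linarith
    have k4 : cos (σ + τ) < 0 := cos_neg_of_pi_div_two_lt_of_lt (by linarith) (by linarith)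
    have k5 : 2 * cos (2 * τ) * cos (σ - τ) = cos (σ + τ) + cos (3 * τ - σ) := by
      rw [cos_add_cos]
      rw [show (σ + τ + (3 * τ - σ)) / 2 = 2 * τ by ring,
        show (σ + τ - (3 * τ - σ)) / 2 = σ - τ by ring]
    have := cos_le_one (3 * τ - σ)
    nlinarith [mul_le_mul_of_nonneg_right hv hcD.le]

/-- the one-angle subcase is impossible -/
lemma caseII_one (τ σ d : ℝ) (h0 : 0 ≤ τ) (h2 : σ < π / 2)
    (hS : σ + τ < π / 3) (hd : 0 < d) (hb : d * cos (σ - τ) < 1 / 2) (hD : π / 6 < σ - τ)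
    (h : sin (σ - τ) ≤ d * sin (σ + τ)) : False := by
  have hpi := pi_pos
  have hcD : 0 < cos (σ - τ) := cos_pos_of_mem_Ioo ⟨by linarith, by linarith⟩
  have hsS : 0 < sin (σ + τ) := sin_pos_of_pos_of_lt_pi (by linarith) (by linarith)
  have k1 : sin (2 * (σ - τ)) < sin (σ + τ) := by
    rw [sin_two_mul]
    nlinarith [mul_le_mul_of_nonneg_left h hcD.le]
  have : 0 ≤ sin (2 * (σ - τ)) - sin (σ + τ) := by
    rw [sin_sub_sin]
    have a1 := sin_nonneg_of_nonneg_of_le_pi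
      (x := (2 * (σ - τ) - (σ + τ)) / 2) (by linarith) (by linarith)
    have a2 := cos_nonneg_of_mem_Icc
      (x := (2 * (σ - τ) + (σ + τ)) / 2) ⟨by linarith, by linarith⟩
    positivity
  linarith

/-- the subcase `τ = 0` -/
lemma caseII_zero (m d s : ℝ) (hs : 4 / 3 < s ^ 2) (hs0 : 0 < s) (hd : 0 < d) (hd2 : d < 1 / 2)
    (hm1 : 1 < m) (hm2 : m ≤ 1 + d)
    (h : s * (1 + d) / 2 * (m - 1) + 2 * s ^ 2 * (1 - m ^ 2 / 4) * (1 - d) ≤ 1) : False := by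
  have hs1 : 1.154 < s := by nlinarith
  have h3 : 0 < (1 - m ^ 2 / 4) * (1 - d) := mul_pos (by nlinarith) (by linarith)
  have h4 : 0 < (1 + d) * (m - 1) := mul_pos (by linarith) (by linarith)
  have h5 : 0.577 * ((1 + d) * (m - 1)) + 8 / 3 * ((1 - m ^ 2 / 4) * (1 - d)) ≤ 1 := by
    nlinarith [mul_pos h4 (sub_pos.2 hs1), mul_pos h3 (sub_pos.2 hs)]
  -- concavity in m
  obtain ⟨e, rfl⟩ : ∃ e, m = 1 + e := ⟨m - 1, by ring⟩
  nlinarith [mul_nonneg (show 0 ≤ e by linarith) (show 0 ≤ d - e by linarith), mul_nonneg (mul_nonneg (show 0 ≤ e by linarith) (show 0 ≤ d - e by linarith)) (show 0 ≤ 1/2 - d by linarith)]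

lemma Gbig (p : ℝ) (h1 : 1.2516 ≤ p) (h2 : p ≤ 2) :
    0 < 4 * p ^ 2 * (1.598 * p - 2) + (0.866 * p * (3 * (p - 1) ^ 2 - 2.5)
      - 0.866 * (2 + 2.88 * (p - 1) ^ 2) / 4 / p + 4 * p - 8 * (p ^ 2 - 0.69) * (p - 1)) := by
  have hp : 0 < p := by linarith
  have e : 0.866 * (2 + 2.88 * (p - 1) ^ 2) / 4 / p ≤ 0.866 * (2 + 2.88 * (p - 1) ^ 2) / 5 := by
    rw [div_div]
    apply div_le_div_of_nonneg_left (by positivity) (by norm_num) (by linarith)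
  nlinarith [mul_nonneg (sub_nonneg.2 h1) (sub_nonneg.2 h2), mul_nonneg (mul_nonneg (sub_nonneg.2 h1) (sub_nonneg.2 h2)) hp.le, sq_nonneg (p - 1.6)]

lemma Gsmall (p : ℝ) (h1 : 1.14 ≤ p) (h2 : p ≤ 1.2516) :
    0 ≤ 0.866 * p * (3 * (p - 1) ^ 2 - 2.5)
      - 0.866 * (2 + 2.88 * (p - 1) ^ 2) / 4 / p + 4 * p - 8 * (p ^ 2 - 0.69) * (p - 1) ∧
    0 < 0.68 * (1.598 * p - 2) + (1.28 - p) * (0.866 * p * (3 * (p - 1) ^ 2 - 2.5)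
      - 0.866 * (2 + 2.88 * (p - 1) ^ 2) / 4 / p + 4 * p - 8 * (p ^ 2 - 0.69) * (p - 1)) := by
  have hp : 0 < p := by linarith
  have e : 0.866 * (2 + 2.88 * (p - 1) ^ 2) / 4 / p ≤ 0.866 * (2 + 2.88 * (p - 1) ^ 2) / 4 * (0.834 - 0.6944 * (p - 1.2) + 0.6 * (p - 1.2) ^ 2) := by
    rw [div_eq_mul_inv _ p]
    apply mul_le_mul_of_nonneg_left _ (by positivity)
    rw [inv_le_comm₀ hp (by nlinarith), inv_le_comm₀ (by nlinarith) hp, inv_le_iff_one_le_mul₀ hp]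
    nlinarith [mul_nonneg (sub_nonneg.2 h1) (sub_nonneg.2 h2)]
  constructor
  · nlinarith [mul_nonneg (sub_nonneg.2 h1) (sub_nonneg.2 h2)]
  · have := mul_le_mul_of_nonneg_left e (show 0 ≤ 1.28 - p by linarith)
    obtain ⟨q, rfl⟩ : ∃ q, p = 1.2 + q := ⟨p - 1.2, by ring⟩
    nlinarith [mul_nonneg (sub_nonneg.2 h1) (sub_nonneg.2 h2), sq_nonneg (q-0.02), sq_nonneg (q), sq_nonneg (q^2)]

lemma Mfin (p v G : ℝ) (hv0 : 0 ≤ v) (hp1 : 1.14 ≤ p) (hp2 : p ≤ 2)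
    (hpl : 1.28 - 0.68 * v ≤ p) (hvp : 4 * v * p ^ 2 ≤ 1)
    (hG : G = 0.866 * p * (3 * (p - 1) ^ 2 - 2.5)
      - 0.866 * (2 + 2.88 * (p - 1) ^ 2) / 4 / p + 4 * p - 8 * (p ^ 2 - 0.69) * (p - 1)) :
    0 < 1.598 * p - 2 + v * G := by
  rcases le_total p 1.2516 with h | h
  · obtain ⟨g1, g2⟩ := Gsmall p hp1 h
    rw [← hG] at g1 g2
    nlinarith
  · have g := Gbig p h hp2
    rw [← hG] at g
    have h3 : 0 < 1.598 * p - 2 := by linarith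
    rcases hv0.eq_or_lt with h0 | h0
    · rw [← h0]; linarith
    · nlinarith [mul_nonneg (sub_nonneg.2 hvp) h3.le, mul_pos h0 g]

lemma Mpoly (p v r C : ℝ) (hr : 1.732 ≤ r) (hC : 0 < C) (hC2 : C ^ 2 = 1 - v) (hv0 : 0 ≤ v)
    (hv : v ≤ 0.19) (hp : 1.28 * C ≤ p) (hp2 : p ≤ 2) (hvp : 4 * v * p ^ 2 ≤ 1) :
    0 < r / 2 * (3 - 4 * v) * (p / C) * (1 + v * (p - 1) ^ 2) - 2 - p * (1 - 4 * v)
      - 8 * (p ^ 2 / C ^ 2 - 1) * (p - 1) * v := by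
  have hC9 : 0.9 ≤ C := by nlinarith
  have hC1 : C ≤ 1 := by nlinarith
  have hCl : 1 - 0.53 * v ≤ C := by nlinarith
  have hp1 : 1.14 ≤ p := by linarith
  have hpl : 1.28 - 0.68 * v ≤ p := by linarith
  have hp0 : 0 < p := by linarith
  have a1 : p * (1 + v / 2) ≤ p / C := by
    rw [le_div_iff₀ hC]
    have : (1 + v / 2) * C ≤ 1 := by
      have : ((1 + v / 2) * C) ^ 2 ≤ 1 := by
        rw [mul_pow, hC2]; nlinarith [mul_nonneg hv0 hv0, mul_nonneg (mul_nonneg hv0 hv0) hv0]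
      nlinarith [mul_pos (show 0 < 1 + v / 2 by linarith) hC]
    nlinarith
  have a2 : p ^ 2 / C ^ 2 * v ≤ (p ^ 2 + 0.31) * v := by
    apply mul_le_mul_of_nonneg_right _ hv0
    rw [div_le_iff₀ (by positivity), hC2]
    nlinarith
  have a3 : 0 ≤ (3 - 4 * v) * (1 + v * (p - 1) ^ 2) := by
    apply mul_nonneg; linarith; positivity
  have a4 : 0.866 * ((3 - 4 * v) * (1 + v * (p - 1) ^ 2)) * (p * (1 + v / 2)) ≤
      r / 2 * (3 - 4 * v) * (p / C) * (1 + v * (p - 1) ^ 2) := by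
    calc _ ≤ r / 2 * ((3 - 4 * v) * (1 + v * (p - 1) ^ 2)) * (p / C) := by
          apply mul_le_mul _ a1 (by positivity) (by positivity)
          apply mul_le_mul_of_nonneg_right _ a3
          linarith
      _ = _ := by ring
  have a5 := mul_le_mul_of_nonneg_right a2 (show 0 ≤ 8 * (p - 1) by linarith)
  suffices h : 0 < 0.866 * ((3 - 4 * v) * (1 + v * (p - 1) ^ 2)) * (p * (1 + v / 2)) - 2
      - p * (1 - 4 * v) - 8 * (p ^ 2 - 0.69) * (p - 1) * v by nlinarith
  have hvv : v ^ 2 ≤ v / 4 / p ^ 2 := by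
    rw [div_div, le_div_iff₀ (by positivity)]
    nlinarith
  have he : (3 - 4 * v) * (1 + v / 2) * (1 + v * (p - 1) ^ 2) ≥
      3 + (3 * (p - 1) ^ 2 - 2.5) * v - (2 + 2.88 * (p - 1) ^ 2) * v ^ 2 := by
    nlinarith [mul_nonneg (mul_nonneg (mul_nonneg hv0 hv0) (sq_nonneg (p-1))) (sub_nonneg.2 hv)]
  have he2 : 3 * p + p * (3 * (p - 1) ^ 2 - 2.5) * v - (2 + 2.88 * (p - 1) ^ 2) / 4 / p * v ≤
      (3 - 4 * v) * (1 + v / 2) * (1 + v * (p - 1) ^ 2) * p := by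
    have h1 := mul_le_mul_of_nonneg_right hvv (show 0 ≤ (2 + 2.88 * (p - 1) ^ 2) * p by positivity)
    have h2 : v / 4 / p ^ 2 * ((2 + 2.88 * (p - 1) ^ 2) * p) = (2 + 2.88 * (p - 1) ^ 2) / 4 / p * v := by
      field_simp
    rw [h2] at h1
    nlinarith [mul_le_mul_of_nonneg_right he hp0.le]
  have hG2 : 0.866 * ((2 + 2.88 * (p - 1) ^ 2) / 4 / p * v) =
     0.866 * (2 + 2.88 * (p - 1) ^ 2) / 4 / p * v := by ring
  have hG3 := Mfin p v _ hv0 hp1 hp2 hpl hvp rfl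
  have he3 := mul_le_mul_of_nonneg_left he2 (show (0 : ℝ) ≤ 0.866 by norm_num)
  clear he2 he hvv a5 a4 a3 a2 a1 hCl hC9 hC1
  linear_combination he3 + hG3 + hG2
set_option maxHeartbeats 1000000 in
lemma step3a (h ρ z : ℝ) (hh : 0 < h) (hh2 : h ≤ π / 6) (hv : sin h ^ 2 ≤ 0.19)
    (hz1 : 0.64 ≤ z) (hz2 : z ≤ 1)
    (hg : sin (h + ρ) = z * sin (2 * h)) (hg2 : sin (h + ρ) ≤ 1 / 2) :
    0 < √3 * z * sin (3 * h) * (1 + sin ρ ^ 2) - sin (3 * h + ρ)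
      - (4 * z ^ 2 - 1) * sin (2 * h) * (4 * sin h * sin ρ) := by
  have hpi := pi_pos
  have hS : 0 < sin h := sin_pos_of_pos_of_lt_pi hh (by linarith)
  have hC : 0 < cos h := cos_pos_of_mem_Ioo ⟨by linarith, by linarith⟩
  have hr : 1.732 ≤ √3 := by
    apply le_sqrt_of_sq_le; norm_num
  obtain ⟨q, hq⟩ : ∃ q, sin ρ = q * sin h := ⟨sin ρ / sin h, by field_simp⟩
  have hCS := sin_sq_add_cos_sq h
  have hK1 := cos_le_one ρ
  have e3 : sin (3 * h) = sin h * (3 - 4 * sin h ^ 2) := by rw [sin_three_mul]; ring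
  have e3c : cos (3 * h) = cos h * (4 * cos h ^ 2 - 3) := by rw [cos_three_mul]; ring
  have e2 : sin (2 * h) = 2 * sin h * cos h := sin_two_mul h
  have hp : cos ρ + q * cos h = 2 * cos h * z := by
    rw [sin_add, hq, e2] at hg
    have : sin h * (cos ρ + q * cos h) = sin h * (2 * cos h * z) := by linarith
    exact mul_left_cancel₀ hS.ne' this
  have hgs : 2 * sin h * cos h * z ≤ 1 / 2 := by rw [hg, e2] at hg2; linarith
  rw [sin_add, e3, e3c, e2, hq]
  set S := sin h
  set C := cos h
  set K := cos ρ
  have hC1 : C ≤ 1 := cos_le_one h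
  have hvC : C ^ 2 = 1 - S ^ 2 := by linarith
  have hgsq : 16 * (S ^ 2 * C ^ 2 * z ^ 2) ≤ 1 := by
    have h0 : 0 ≤ 2 * S * C * z := by positivity
    nlinarith
  have hM := Mpoly (2 * C * z) (S ^ 2) (√3) C hr hC hvC (sq_nonneg S) hv (by nlinarith)
    (by nlinarith) (by nlinarith)
  have x1 : 2 * C * z / C = 2 * z := by field_simp
  have x2 : (2 * C * z) ^ 2 / C ^ 2 = 4 * z ^ 2 := by field_simp; ring
  rw [x1, x2] at hM
  have hC9 : 0.9 ≤ C := by nlinarith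
  have hp1 : 1.14 ≤ 2 * C * z := by nlinarith
  have hqp : 2 * C * z - 1 ≤ q := by
    have : 2 * C * z - 1 ≤ q * C := by linarith
    have hq0 : 0 < q := pos_of_mul_pos_left (by linarith) hC.le
    have := mul_le_of_le_one_right hq0.le hC1
    linarith
  have hq2 : (2 * C * z - 1) ^ 2 ≤ q ^ 2 := by
    apply pow_le_pow_left₀ (by linarith) hqp
  have hzv : (4 * z ^ 2 - 1) * S ^ 2 ≤ 1 / 4 := by
    rw [hvC] at hgsq
    have : 0 < 1 - S ^ 2 := by linarith
    by_contra hc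
    push Not at hc
    nlinarith [mul_lt_mul_of_pos_right hc this, sq_nonneg S]
  have f1 : √3 / 2 * (3 - 4 * S ^ 2) * (2 * z) * (1 + S ^ 2 * (2 * C * z - 1) ^ 2) ≤
      √3 / 2 * (3 - 4 * S ^ 2) * (2 * z) * (1 + S ^ 2 * q ^ 2) := by
    apply mul_le_mul_of_nonneg_left
    · nlinarith [mul_le_mul_of_nonneg_left hq2 (sq_nonneg S)]
    · have : 0 ≤ 3 - 4 * S ^ 2 := by linarith
      positivity
  have f2 : 0 ≤ (1 - K) * (2 - 8 * ((4 * z ^ 2 - 1) * S ^ 2)) := by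
    apply mul_nonneg <;> linarith
  have f3 : 0 < √3 * z * (3 - 4 * S ^ 2) * (1 + (q * S) ^ 2) - ((3 - 4 * S ^ 2) * K
      + C * (4 * C ^ 2 - 3) * q) - (4 * z ^ 2 - 1) * (2 * C) * (4 * S * (q * S)) := by
    have t1 : C * (4 * C ^ 2 - 3) * q = (2 * C * z - K) * (1 - 4 * S ^ 2) := by
      rw [hvC, ← hp]; ring
    have t2 : (4 * z ^ 2 - 1) * (2 * C) * (4 * S * (q * S)) =
      8 * (4 * z ^ 2 - 1) * (2 * C * z - K) * S ^ 2 := by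
      rw [← hp]; ring
    rw [t1, t2]
    linear_combination hM + f1 + f2
  have := mul_pos hS f3
  linear_combination this

set_option maxHeartbeats 1000000 in
lemma step3b (h η ψ z : ℝ) (hh : 0 < h) (hη : 0 < η) (hηh : η ≤ h) (hψ1 : h ≤ ψ) (hψ2 : ψ < 2 * h)
    (hc2 : 0.62 ≤ cos (2 * h)) (hh2 : h ≤ π / 6)
    (hz1 : 0.64 ≤ z) :
    √3 * z * sin (3 * h) * (1 + sin (h - η) ^ 2) - (4 * z ^ 2 - 1) * sin (2 * h) * (2 * cos η) ≤
    √3 * z * sin (4 * h - ψ) * (1 + sin (ψ - η) ^ 2)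
      + (4 * z ^ 2 - 1) * sin (2 * h) * (sin (2 * ψ - 2 * h - 2 * η) / sin η) := by
  have hpi := pi_pos
  have hr : √3 ≤ 1.7321 := by
    apply sqrt_le_iff.2; norm_num
  have hr0 : 0 < √3 := by positivity
  obtain ⟨κ, rfl⟩ : ∃ κ, ψ = h + 2 * κ := ⟨(ψ - h) / 2, by ring⟩
  have hκ : 0 ≤ κ := by linarith
  have hsη : 0 < sin η := sin_pos_of_pos_of_lt_pi hη (by linarith)
  have hsκ : 0 ≤ sin κ := sin_nonneg_of_nonneg_of_le_pi hκ (by linarith)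
  have hX : sin (h - η) ^ 2 ≤ sin (h + 2 * κ - η) ^ 2 := by
    apply pow_le_pow_left₀ (sin_nonneg_of_nonneg_of_le_pi (by linarith) (by linarith))
    apply sin_le_sin_of_le_of_le_pi_div_two <;> linarith
  have hX2 : sin (h - η) ^ 2 ≤ sin h ^ 2 := by
    apply pow_le_pow_left₀ (sin_nonneg_of_nonneg_of_le_pi (by linarith) (by linarith))
    apply sin_le_sin_of_le_of_le_pi_div_two <;> linarith
  have hs3 : 0 ≤ sin (4 * h - (h + 2 * κ)) :=
    sin_nonneg_of_nonneg_of_le_pi (by linarith) (by linarith)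
  have e1 : sin (4 * h - (h + 2 * κ)) = sin (3 * h) - 2 * sin κ * cos (3 * h - κ) := by
    have := sin_sub_sin (3 * h) (4 * h - (h + 2 * κ))
    rw [show (3 * h - (4 * h - (h + 2 * κ))) / 2 = κ by ring,
      show (3 * h + (4 * h - (h + 2 * κ))) / 2 = 3 * h - κ by ring] at this
    linarith
  have e2 : sin (2 * (h + 2 * κ) - 2 * h - 2 * η) / sin η
      = -(2 * cos η) + 4 * sin κ * cos κ * cos (2 * κ - 2 * η) / sin η := by
    have := sin_sub_sin (2 * (h + 2 * κ) - 2 * h - 2 * η) (-(2 * η))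
    rw [show (2 * (h + 2 * κ) - 2 * h - 2 * η - -(2 * η)) / 2 = 2 * κ by ring,
      show (2 * (h + 2 * κ) - 2 * h - 2 * η + -(2 * η)) / 2 = 2 * κ - 2 * η by ring,
      sin_neg, sin_two_mul η, sin_two_mul κ] at this
    rw [show sin (2 * (h + 2 * κ) - 2 * h - 2 * η) = -(2 * cos η) * sin η
      + 4 * sin κ * cos κ * cos (2 * κ - 2 * η) by linarith, add_div, mul_div_cancel_right₀ _ hsη.ne']
  rw [e2]
  have hbig : √3 * z * (1 + sin (h - η) ^ 2) * (2 * sin κ * cos (3 * h - κ)) ≤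
      (4 * z ^ 2 - 1) * sin (2 * h) * (4 * sin κ * cos κ * cos (2 * κ - 2 * η) / sin η) := by
    have hsin2 : sin h ^ 2 ≤ 0.19 := by
      have := cos_two_mul h
      have := sin_sq_add_cos_sq h
      linarith
    have hC : 0.9 ≤ cos h := by
      have := cos_pos_of_mem_Ioo (x := h) ⟨by linarith, by linarith⟩
      have := sin_sq_add_cos_sq h
      nlinarith
    have hS : 0 < sin h := sin_pos_of_pos_of_lt_pi hh (by linarith)
    have hSη : sin η ≤ sin h := by apply sin_le_sin_of_le_of_le_pi_div_two <;> linarith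
    have hCκ : 0.97 ≤ cos κ := by
      have h1 := cos_two_mul κ
      have h2 : cos h ≤ cos (2 * κ) := cos_le_cos_of_nonneg_of_le_pi (by linarith) (by linarith) (by linarith)
      have := cos_pos_of_mem_Ioo (x := κ) ⟨by linarith, by linarith⟩
      nlinarith
    have hc3 : 0.62 ≤ cos (2 * κ - 2 * η) := by
      rw [← cos_abs]
      refine hc2.trans (cos_le_cos_of_nonneg_of_le_pi (abs_nonneg _) (by linarith) ?_)
      rw [abs_le]; constructor <;> linarith
    have hrat : 1.8 ≤ sin (2 * h) / sin η := by
      rw [le_div_iff₀ hsη, sin_two_mul]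
      nlinarith
    have hz : 0.5755 * (√3 * z) ≤ 4 * z ^ 2 - 1 := by nlinarith
    have hA : 0.97 * 0.62 ≤ cos κ * cos (2 * κ - 2 * η) := by
      apply mul_le_mul hCκ hc3 (by norm_num) (by linarith)
    have hB : 1.8 * (0.97 * 0.62) ≤ sin (2 * h) / sin η * (cos κ * cos (2 * κ - 2 * η)) := by
      apply mul_le_mul hrat hA (by norm_num) (by linarith)
    have hD : 0.5755 * (√3 * z) * (1.8 * (0.97 * 0.62)) ≤ (4 * z ^ 2 - 1) *
        (sin (2 * h) / sin η * (cos κ * cos (2 * κ - 2 * η))) := by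
      apply mul_le_mul hz hB (by norm_num) (by nlinarith)
    have hrz : 0 < √3 * z := by positivity
    have hE : √3 * z * (1 + sin (h - η) ^ 2) * cos (3 * h - κ) ≤ √3 * z * 1.19 := by
      rw [mul_assoc]
      apply mul_le_mul_of_nonneg_left _ hrz.le
      have := mul_le_mul_of_nonneg_left (cos_le_one (3 * h - κ))
        (show 0 ≤ 1 + sin (h - η) ^ 2 by positivity)
      linarith
    have hF : √3 * z * (1 + sin (h - η) ^ 2) * cos (3 * h - κ) ≤ 2 * ((4 * z ^ 2 - 1) *
        (sin (2 * h) / sin η * (cos κ * cos (2 * κ - 2 * η)))) := by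
      linarith
    have hG := mul_le_mul_of_nonneg_left hF (show 0 ≤ 2 * sin κ by linarith)
    have t : (4 * z ^ 2 - 1) * sin (2 * h) * (4 * sin κ * cos κ * cos (2 * κ - 2 * η) / sin η)
      = 2 * sin κ * (2 * ((4 * z ^ 2 - 1) *
        (sin (2 * h) / sin η * (cos κ * cos (2 * κ - 2 * η))))) := by
      field_simp; ring
    rw [t]
    refine le_trans (le_of_eq ?_) hG
    ring
  have hY : √3 * z * sin (4 * h - (h + 2 * κ)) * (1 + sin (h - η) ^ 2) ≤
     √3 * z * sin (4 * h - (h + 2 * κ)) * (1 + sin (h + 2 * κ - η) ^ 2) := by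
    apply mul_le_mul_of_nonneg_left (by linarith)
    positivity
  refine le_trans ?_ (add_le_add_left hY _)
  rw [e1]
  linear_combination hbig
lemma step2_alg (m C S : ℝ) (hm : 25 / 16 < m) (hC : 0.866 ≤ C) (hS : 0 < S)
    (hCS : S ^ 2 + C ^ 2 = 1) (h4 : (m - 1) * (2 * C) ≤ 1) (h5 : 4 * S * C ≤ m) : False := by
  have h6 : C ≤ 8 / 9 := by nlinarith
  have a1 : C ^ 2 ≤ 64 / 81 := by nlinarith
  have a2 : 0.7499 ≤ C ^ 2 := by nlinarith
  have a3 : 2.65 ≤ 16 * (C ^ 2 * (1 - C ^ 2)) := by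
    have := mul_nonneg (sub_nonneg.2 a1) (show 0 ≤ C ^ 2 - 17 / 81 by linarith)
    nlinarith
  have h7 : (4 * S * C) ^ 2 ≤ m ^ 2 := by
    apply pow_le_pow_left₀ (by positivity) (by linarith)
  have a4 : (4 * S * C) ^ 2 = 16 * (C ^ 2 * (1 - C ^ 2)) := by
    rw [mul_pow, mul_pow, show S ^ 2 = 1 - C ^ 2 by linarith]; ring
  have h8 : 1.62 ≤ m := by
    by_contra hc
    nlinarith
  nlinarith

set_option maxHeartbeats 1000000 in
lemma step2 (h η m : ℝ) (hh : 0 < h) (hh2 : h < π / 6) (hη : 0 < η) (hg0 : 0 < 2 * h - η)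
    (hm2 : m ≤ 2) (hm1 : 1 < m) (hR : sin (2 * h) = m * sin (2 * h - η))
    (hg : sin (2 * h - η) ≤ 1 / 2)
    (hc : (m - 1) * (2 * cos h * cos (h - 3 / 2 * η)) ≤ cos (η / 2)) : m ≤ 25 / 16 := by
  have hpi := pi_pos
  by_contra hm
  push Not at hm
  have hC0 : √3 / 2 ≤ cos h := by
    rw [← cos_pi_div_six]
    exact cos_le_cos_of_nonneg_of_le_pi hh.le (by linarith) hh2.le
  have hr : 1.732 ≤ √3 := by
    apply le_sqrt_of_sq_le; norm_num
  have hC : 0.866 ≤ cos h := by linarith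
  have hS : 0 < sin h := sin_pos_of_pos_of_lt_pi hh (by linarith)
  have hCS := sin_sq_add_cos_sq h
  have hgs : 0 < sin (2 * h - η) := sin_pos_of_pos_of_lt_pi hg0 (by linarith)
  have hcη : 0 < cos (η / 2) := cos_pos_of_mem_Ioo ⟨by linarith, by linarith⟩
  rcases le_or_gt m (2 * cos h) with hmc | hmc
  · have h1 : η ≤ h := by
      by_contra hcon
      push Not at hcon
      have : sin (2 * h - η) < sin h := by
        apply sin_lt_sin_of_lt_of_le_pi_div_two <;> linarith
      rw [sin_two_mul] at hR
      nlinarith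
    have h2 : h / 2 ≤ η := by
      by_contra hcon
      push Not at hcon
      have k1 : sin (3 / 2 * h) < sin (2 * h - η) := by
        apply sin_lt_sin_of_lt_of_le_pi_div_two <;> linarith
      have k2 : 3 * sin (2 * h) ≤ 4 * sin (3 / 2 * h) := by
        rw [show 2 * h = 2 * (2 * (h / 2)) by ring, show 3 / 2 * h = 3 * (h / 2) by ring,
          sin_two_mul, sin_two_mul, sin_three_mul, cos_two_mul]
        have t1 : 0 < sin (h / 2) := sin_pos_of_pos_of_lt_pi (by linarith) (by linarith)
        have t2 := cos_le_one (h / 2)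
        have t3 := sin_sq_add_cos_sq (h / 2)
        have t4 : cos h = 2 * cos (h / 2) ^ 2 - 1 := by rw [← cos_two_mul]; congr 1; ring
        have t5 : 0 < cos (h / 2) := cos_pos_of_mem_Ioo ⟨by linarith, by linarith⟩
        have t6 : sin (h / 2) ^ 2 = 1 - cos (h / 2) ^ 2 := by linarith
        have : 3 * (2 * cos (h / 2) * (2 * cos (h / 2) ^ 2 - 1)) * 2 ≤
          4 * (3 - 4 * sin (h / 2) ^ 2) := by
          rw [t6]
          nlinarith [mul_nonneg (sub_nonneg.2 t2) (show 0 ≤ 2 * cos (h / 2) ^ 2 - 1 by linarith)]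
        nlinarith
      nlinarith
    have h3 : cos (η / 2) ≤ cos (h - 3 / 2 * η) := by
      rw [← cos_abs (h - 3 / 2 * η)]
      apply cos_le_cos_of_nonneg_of_le_pi (abs_nonneg _) (by linarith)
      rw [abs_le]; constructor <;> linarith
    have h4 : (m - 1) * (2 * cos h) ≤ 1 := by
      have h5 : (m - 1) * (2 * cos h) * cos (η / 2) ≤ 1 * cos (η / 2) := by
        have := mul_le_mul_of_nonneg_left h3 (show 0 ≤ (m - 1) * (2 * cos h) by nlinarith)
        linarith
      exact le_of_mul_le_mul_right h5 hcη
    have h5 : 2 * (2 * sin h * cos h) ≤ m := by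
      rw [sin_two_mul] at hR; nlinarith
    exact step2_alg m (cos h) (sin h) hm hC hS hCS h4 (by linarith)
  · have hm3 : 1.732 < m := by linarith
    have h1 : η ≤ 4 / 3 * h := by
      by_contra hcon
      push Not at hcon
      have : sin (2 * h - η) < sin (2 / 3 * h) := by
        apply sin_lt_sin_of_lt_of_le_pi_div_two <;> linarith
      have k : 2 * sin (2 / 3 * h) ≤ sin (2 * h) := by
        rw [show 2 * h = 3 * (2 / 3 * h) by ring, sin_three_mul]
        have t1 : 0 < sin (2 / 3 * h) := sin_pos_of_pos_of_lt_pi (by linarith) (by linarith)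
        have t2 : sin (2 / 3 * h) ≤ 1 / 2 := by
          rw [← sin_pi_div_six]; apply sin_le_sin_of_le_of_le_pi_div_two <;> linarith
        nlinarith [mul_pos t1 t1]
      nlinarith
    have h3 : cos h ≤ cos (h - 3 / 2 * η) := by
      rw [← cos_abs (h - 3 / 2 * η)]
      apply cos_le_cos_of_nonneg_of_le_pi (abs_nonneg _) (by linarith)
      rw [abs_le]; constructor <;> linarith
    have h4 : 0.749 ≤ cos h * cos (h - 3 / 2 * η) := by nlinarith
    have := cos_le_one (η / 2)
    nlinarith

lemma fin_alg (h η ψ z d s w X r sa : ℝ) (hs : 4 / 3 < s ^ 2) (hs0 : 0 < s)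
    (hr : r = √3) (hz : 0 < z) (hsη : 0 < sin η) (hsψ : 0 < sin ψ) (hw : 0 < w)
    (hg : sin (2 * h - η) = z * sin (2 * h)) (hν : sin (2 * h - ψ) = d * sin (2 * h))
    (hsν : 0 < sin (2 * h))
    (hW : w * sin ψ * (2 * z) = s * (1 - d ^ 2) * sin η)
    (hsa : 4 * z ^ 2 * sa = 4 * z ^ 2 - 1) (hsa0 : 0 ≤ sa)
    (hQ0 : 0 ≤ 1 - d * cos (ψ - 2 * η))
    (hQ : w * (1 + X ^ 2) + 2 * s ^ 2 * sa * (1 - d * cos (ψ - 2 * η)) ≤ 1)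
    (hL : 0 < r * z * sin (4 * h - ψ) * (1 + X ^ 2) + (4 * z ^ 2 - 1) * sin (2 * h) *
      (sin (2 * ψ - 2 * h - 2 * η) / sin η + 2 * cos (2 * h - η)) - sin (4 * h - η)) : False := by
  have e1 : (1 - d ^ 2) * sin (2 * h) ^ 2 = sin ψ * sin (4 * h - ψ) := by
    have : sin (2 * h) ^ 2 - sin (2 * h - ψ) ^ 2 = sin ψ * sin (4 * h - ψ) := by
      rw [show 4 * h - ψ = 2 * h + (2 * h - ψ) by ring, sin_add, sin_sub, cos_sub]
      linear_combination (-sin (2 * h) ^ 2) * sin_sq_add_cos_sq ψ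
    rw [← this, hν]; ring
  have e2 : w * (2 * z) * sin (2 * h) ^ 2 = s * sin η * sin (4 * h - ψ) := by
    have : sin ψ * (w * (2 * z) * sin (2 * h) ^ 2) = sin ψ * (s * sin η * sin (4 * h - ψ)) := by
      linear_combination sin (2 * h) ^ 2 * hW + s * sin η * e1
    exact mul_left_cancel₀ hsψ.ne' this
  have hr2 : r ^ 2 = 3 := by rw [hr]; exact sq_sqrt (by norm_num)
  have hr0 : 0 < r := by rw [hr]; positivity
  have hrs : 2 ≤ r * s := by
    have : 2 ^ 2 ≤ (r * s) ^ 2 := by rw [mul_pow, hr2]; nlinarith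
    exact le_of_sq_le_sq this (by positivity)
  have e3 : r * z * sin (4 * h - ψ) * sin η ≤ 3 * z ^ 2 * sin (2 * h) ^ 2 * w := by
    have h1 : r * (r * z * sin (4 * h - ψ) * sin η) ≤ r * (3 * z ^ 2 * sin (2 * h) ^ 2 * w) := by
      have h2 : 2 * (z * sin (4 * h - ψ) * sin η) ≤ (r * s) * (z * sin (4 * h - ψ) * sin η) := by
        apply mul_le_mul_of_nonneg_right hrs
        have : 0 ≤ s * sin η * sin (4 * h - ψ) := by rw [← e2]; positivity
        have : 0 ≤ s * (z * sin (4 * h - ψ) * sin η) := by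
          have := mul_nonneg hz.le this
          linarith
        exact nonneg_of_mul_nonneg_right this hs0
      have h3 : r * (3 * z ^ 2 * sin (2 * h) ^ 2 * w) = 3 / 2 * (r * s) * (z * sin (4 * h - ψ) * sin η) := by
        linear_combination 3 / 2 * r * z * e2
      rw [h3]
      have h4 : r * (r * z * sin (4 * h - ψ) * sin η) = 3 * (z * sin (4 * h - ψ) * sin η) := by
        linear_combination (z * sin (4 * h - ψ) * sin η) * hr2
      rw [h4]; linarith
    exact le_of_mul_le_mul_left h1 hr0
  have e4 : (4 * z ^ 2 - 1) * sin (2 * h) *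
      (sin (2 * ψ - 2 * h - 2 * η) + 2 * cos (2 * h - η) * sin η) - sin (4 * h - η) * sin η =
      3 * z ^ 2 * sin (2 * h) ^ 2 * (8 / 3 * sa * (1 - d * cos (ψ - 2 * η)) - 1) := by
    have f1 : 2 * sin (2 * h - ψ) * cos (ψ - 2 * η) = sin (2 * h - 2 * η)
        - sin (2 * ψ - 2 * h - 2 * η) := by
      have := sin_sub_sin (2 * h - 2 * η) (2 * ψ - 2 * h - 2 * η)
      rw [this, show (2 * h - 2 * η - (2 * ψ - 2 * h - 2 * η)) / 2 = 2 * h - ψ by ring,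
        show (2 * h - 2 * η + (2 * ψ - 2 * h - 2 * η)) / 2 = ψ - 2 * η by ring]
    have f2 : sin (2 * h) - sin (2 * h - 2 * η) = 2 * sin η * cos (2 * h - η) := by
      rw [sin_sub_sin, show (2 * h - (2 * h - 2 * η)) / 2 = η by ring,
        show (2 * h + (2 * h - 2 * η)) / 2 = 2 * h - η by ring]
    have f3 : sin (4 * h - η) * sin η = sin (2 * h) ^ 2 - sin (2 * h - η) ^ 2 := by
      rw [show 4 * h - η = 2 * h + (2 * h - η) by ring, sin_add, sin_sub, cos_sub]
      linear_combination (sin (2 * h) ^ 2) * sin_sq_add_cos_sq η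
    rw [hν] at f1
    rw [f3, hg]
    linear_combination (-(2 * sin (2 * h) ^ 2 * (1 - d * cos (ψ - 2 * η)))) * hsa
      - (4 * z ^ 2 - 1) * sin (2 * h) * f2 + (4 * z ^ 2 - 1) * sin (2 * h) * f1
  have hL2 := mul_pos hL hsη
  have e5 : (r * z * sin (4 * h - ψ) * (1 + X ^ 2) + (4 * z ^ 2 - 1) * sin (2 * h) *
      (sin (2 * ψ - 2 * h - 2 * η) / sin η + 2 * cos (2 * h - η)) - sin (4 * h - η)) * sin η =
      r * z * sin (4 * h - ψ) * sin η * (1 + X ^ 2) + ((4 * z ^ 2 - 1) * sin (2 * h) *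
      (sin (2 * ψ - 2 * h - 2 * η) + 2 * cos (2 * h - η) * sin η) - sin (4 * h - η) * sin η) := by
    field_simp
    ring
  rw [e5, e4] at hL2
  have e6 := mul_le_mul_of_nonneg_right e3 (show 0 ≤ 1 + X ^ 2 by positivity)
  have hP : 0 < 3 * z ^ 2 * sin (2 * h) ^ 2 := by positivity
  have e7 : 0 < 3 * z ^ 2 * sin (2 * h) ^ 2 * (w * (1 + X ^ 2) + 8 / 3 * sa * (1 - d * cos (ψ - 2 * η)) - 1) := by
    linarith
  have e8 := pos_of_mul_pos_right e7 hP.le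
  have e9 := mul_nonneg hsa0 hQ0
  nlinarith [mul_nonneg e9 (show 0 ≤ s ^ 2 - 4 / 3 by linarith)]

lemma exists_nu (ψ d : ℝ) (h : 0 < sin ψ) (hd : d ≤ cos ψ) :
    ∃ ν, 0 < ν ∧ ν ≤ π / 2 ∧ sin (ν - ψ) = d * sin ν := by
  refine ⟨π / 2 - arctan ((cos ψ - d) / sin ψ), ?_, ?_, ?_⟩
  · have := arctan_lt_pi_div_two ((cos ψ - d) / sin ψ); linarith
  · have : 0 ≤ arctan ((cos ψ - d) / sin ψ) := arctan_nonneg.2 (div_nonneg (by linarith) h.le)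
    linarith
  · rw [sin_sub, sin_pi_div_two_sub, cos_pi_div_two_sub]
    have hc := cos_arctan_pos ((cos ψ - d) / sin ψ)
    have ht := tan_arctan ((cos ψ - d) / sin ψ)
    rw [tan_eq_sin_div_cos, div_eq_div_iff hc.ne' h.ne'] at ht
    linear_combination -ht

lemma aux_c2h (S C : ℝ) (h1 : S ^ 2 + C ^ 2 = 1) (h0 : 0 < S) (h : S ≤ 25 / 32) (h2 : 0 ≤ C) : 0.62 ≤ C := by
  nlinarith
lemma aux_C9 (S C : ℝ) (h1 : S ^ 2 + C ^ 2 = 1) (h : S ^ 2 ≤ 0.19) (h2 : 0 ≤ C) : 0.9 ≤ C := by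
  nlinarith
lemma aux_z1 (z m : ℝ) (h1 : z * m = 1) (hz : 0 < z) (h : m ≤ 25 / 16) : 0.64 ≤ z := by
  nlinarith
lemma aux_z2 (z m : ℝ) (h1 : z * m = 1) (hz : 0 < z) (h : 1 < m) : z ≤ 1 := by
  nlinarith
lemma aux_sac (S C : ℝ) (h1 : S ^ 2 = 1 - C ^ 2) (hS : 0 < S) (h0 : 1 < 2 * C) (h : 2 * C ≤ 25 / 16) : 0.6 ≤ S := by
  nlinarith
lemma aux_s (s : ℝ) (h0 : 0 < s) (h : 4 / 3 < s ^ 2) : 1.15 < s := by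
  nlinarith
lemma aux_q3 (s S : ℝ) (h0 : 1.15 < s) (h : 0.6 ≤ S) : 2 ≤ 4 * (s * S) := by
  nlinarith
lemma aux_pp (d c : ℝ) (hd : 0 < d) (hd1 : d < 1) (h : c ≤ 1) : 0 ≤ 1 - d * c := by
  nlinarith
set_option maxHeartbeats 2000000 in
lemma caseII_main (τ τ' σ d s w : ℝ) (hτ : 0 < τ) (hττ' : τ < τ') (hτ'2 : τ' < π / 2)
    (hτσ : τ < σ) (hσ : σ < π / 2) (hS : σ + τ < π / 3) (hτ12 : τ < π / 12) (hd : 0 < d)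
    (hv : d ≤ cos (2 * τ)) (hi : d * cos (2 * τ) < 1 / 2) (hs : 4 / 3 < s ^ 2) (hs0 : 0 < s)
    (hw : 0 < w)
    (R1 : w * cos τ = s * (1 + d) / 2 * (cos σ + cos τ' - cos τ))
    (R2 : w * sin τ = s * (1 - d) / 2 * (sin σ - sin τ' + sin τ))
    (ch1 : cos ((3 * σ - τ) / 2) ≤ d * cos ((σ + τ) / 2))
    (ch2 : cos ((3 * τ' + τ) / 2) ≤ d * cos ((τ' - τ) / 2))
    (hQ : ∀ f : ℝ, w * (1 - f ^ 2) + s ^ 2 / 2 * ((1 + d) * (cos σ - cos τ') ^ 2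
      + (1 - d) * (sin σ + sin τ') ^ 2)
      + 2 * f * s * w * ((cos σ - cos τ') * cos τ + (sin σ + sin τ') * sin τ) ≤ 1) : False := by
  have hpi := pi_pos
  obtain ⟨a, b, rfl, rfl⟩ : ∃ a b, σ = a + b ∧ τ' = a - b :=
    ⟨(σ + τ') / 2, (σ - τ') / 2, by ring, by ring⟩
  obtain ⟨η, rfl⟩ : ∃ η, b = η - τ := ⟨b + τ, by ring⟩
  obtain ⟨ψ, rfl⟩ : ∃ ψ, τ = ψ / 2 := ⟨2 * τ, by ring⟩
  rw [show 2 * (ψ / 2) = ψ by ring] at hv hi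
  have ha0 : 0 < a := by linarith
  have ha2 : a < π / 2 := by linarith
  have hca : 0 < cos a := cos_pos_of_mem_Ioo ⟨by linarith, by linarith⟩
  have hsψ : 0 < sin ψ := sin_pos_of_pos_of_lt_pi (by linarith) (by linarith)
  have hst : 0 < sin (ψ / 2) := sin_pos_of_pos_of_lt_pi (by linarith) (by linarith)
  have hct : 0 < cos (ψ / 2) := cos_pos_of_mem_Ioo ⟨by linarith, by linarith⟩
  have e2 : sin ψ = 2 * sin (ψ / 2) * cos (ψ / 2) := by rw [← sin_two_mul]; congr 1; ring
  have hd1 : d < 1 := by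
    have h1 := sin_sq_add_cos_sq ψ
    nlinarith [cos_le_one ψ, mul_pos hsψ hsψ]
  have hcc : cos (a + (η - ψ / 2)) + cos (a - (η - ψ / 2)) = 2 * cos a * cos (η - ψ / 2) := by
    rw [cos_add a (η - ψ / 2), cos_sub a (η - ψ / 2)]; ring
  have hss : sin (a + (η - ψ / 2)) - sin (a - (η - ψ / 2)) = 2 * cos a * sin (η - ψ / 2) := by
    rw [sin_add a (η - ψ / 2), sin_sub a (η - ψ / 2)]; ring
  have hcc' : cos (a + (η - ψ / 2)) - cos (a - (η - ψ / 2)) = -(2 * sin a * sin (η - ψ / 2)) := by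
    rw [cos_add a (η - ψ / 2), cos_sub a (η - ψ / 2)]; ring
  have hss' : sin (a + (η - ψ / 2)) + sin (a - (η - ψ / 2)) = 2 * sin a * cos (η - ψ / 2) := by
    rw [sin_add a (η - ψ / 2), sin_sub a (η - ψ / 2)]; ring
  rw [hcc] at R1
  rw [hss] at R2
  have hη1 : sin η = sin (η - ψ / 2) * cos (ψ / 2) + cos (η - ψ / 2) * sin (ψ / 2) := by
    rw [← sin_add]; congr 1; ring
  have hη2 : sin (ψ - η) = sin (ψ / 2) * cos (η - ψ / 2) - cos (ψ / 2) * sin (η - ψ / 2) := by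
    rw [← sin_sub]; congr 1; ring
  have hW : w * sin ψ = s * (1 - d ^ 2) * cos a * sin η := by
    rw [e2, hη1]
    linear_combination (1 - d) * sin (ψ / 2) * R1 + (1 + d) * cos (ψ / 2) * R2
  have hRR : 2 * cos a * (sin (ψ - η) + d * sin η) = sin ψ := by
    rw [e2, hη1, hη2]
    have : s * (2 * cos a * (sin (ψ / 2) * cos (η - ψ / 2) - cos (ψ / 2) * sin (η - ψ / 2) +
        d * (sin (η - ψ / 2) * cos (ψ / 2) + cos (η - ψ / 2) * sin (ψ / 2)))) =
        s * (2 * sin (ψ / 2) * cos (ψ / 2)) := by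
      linear_combination -2 * sin (ψ / 2) * R1 + 2 * cos (ψ / 2) * R2
    exact mul_left_cancel₀ hs0.ne' this
  have hd2 : 0 < 1 - d ^ 2 := by
    have := mul_pos (sub_pos.2 hd1) (add_pos one_pos hd)
    linarith
  have hsη : 0 < sin η := by
    have h1 : 0 < s * (1 - d ^ 2) * cos a * sin η := by rw [← hW]; positivity
    exact pos_of_mul_pos_right h1 (by positivity)
  have hη : 0 < η := by
    by_contra hc
    push Not at hc
    have := sin_nonpos_of_nonpos_of_neg_pi_le hc (by linarith)
    linarith
  have haη : a + η < π / 3 := by linarith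
  obtain ⟨ν, hν0, hν2, hν⟩ := exists_nu ψ d hsψ hv
  have hsν : 0 < sin ν := sin_pos_of_pos_of_lt_pi hν0 (by linarith)
  have hR : sin ν = 2 * cos a * sin (ν - η) := by
    have id : sin (ψ - η) * sin ν + sin (ν - ψ) * sin η = sin ψ * sin (ν - η) := by
      rw [sin_sub, sin_sub, sin_sub]; ring
    have : sin ψ * sin ν = sin ψ * (2 * cos a * sin (ν - η)) := by
      rw [hν] at id
      linear_combination (-sin ν) * hRR + 2 * cos a * id
    exact mul_left_cancel₀ hsψ.ne' this
  have hψν : ψ < ν := by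
    by_contra hc
    push Not at hc
    have := sin_nonpos_of_nonpos_of_neg_pi_le (x := ν - ψ) (by linarith) (by linarith)
    rw [hν] at this
    linarith [mul_pos hd hsν]
  have hν2ψ : ν < 2 * ψ := by
    by_contra hc
    push Not at hc
    have h1 := sin_nonneg_of_nonneg_of_le_pi (x := ν - 2 * ψ) (by linarith) (by linarith)
    have h2 : 2 * sin (ν - ψ) * cos ψ = sin ν + sin (ν - 2 * ψ) := by
      rw [sin_add_sin, show (ν + (ν - 2 * ψ)) / 2 = ν - ψ by ring,
        show (ν - (ν - 2 * ψ)) / 2 = ψ by ring]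
    rw [hν] at h2
    linarith [mul_lt_mul_of_pos_right hi hsν]
  have hsg : 0 < sin (ν - η) := by
    have : 0 < 2 * cos a * sin (ν - η) := by rw [← hR]; exact hsν
    exact pos_of_mul_pos_right this (by positivity)
  have hg0 : 0 < ν - η := by
    by_contra hc
    push Not at hc
    have := sin_nonpos_of_nonpos_of_neg_pi_le (x := ν - η) (by linarith) (by linarith)
    linarith
  have hg6 : ν - η < π / 6 := by
    by_contra hc
    push Not at hc
    have h1 : cos (π / 3 - η) < cos a :=
      cos_lt_cos_of_nonneg_of_le_pi (by linarith) (by linarith) (by linarith)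
    have h2 : 2 * sin (ν - η) * cos (π / 3 - η) < sin ν := by
      rw [hR]; linarith [mul_lt_mul_of_pos_left h1 hsg]
    have h3 : 2 * sin (ν - η) * cos (π / 3 - η) = cos (ν - π / 6 - 2 * η) - sin (π / 3 - ν) := by
      rw [show cos (ν - π / 6 - 2 * η) = sin (ν + π / 3 - 2 * η) by
        rw [← cos_sub_pi_div_two]; congr 1; ring]
      rw [sin_sub_sin, show (ν + π / 3 - 2 * η - (π / 3 - ν)) / 2 = ν - η by ring,
        show (ν + π / 3 - 2 * η + (π / 3 - ν)) / 2 = π / 3 - η by ring]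
    have h4 : sin ν + sin (π / 3 - ν) = cos (ν - π / 6) := by
      rw [sin_add_sin, show (ν + (π / 3 - ν)) / 2 = π / 6 by ring,
        show (ν - (π / 3 - ν)) / 2 = ν - π / 6 by ring, sin_pi_div_six]; ring
    have h5 : cos (ν - π / 6) ≤ cos (ν - π / 6 - 2 * η) := by
      rw [← cos_abs (ν - π / 6 - 2 * η)]
      apply cos_le_cos_of_nonneg_of_le_pi (abs_nonneg _) (by linarith)
      rw [abs_le]; constructor <;> linarith
    linarith
  have hsg2 : sin (ν - η) ≤ 1 / 2 := by
    rw [← sin_pi_div_six]; apply sin_le_sin_of_le_of_le_pi_div_two <;> linarith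
  have hm1 : 1 < 2 * cos a := by
    have := cos_lt_cos_of_nonneg_of_le_pi ha0.le (by linarith) (show a < π / 3 by linarith)
    rw [cos_pi_div_three] at this; linarith
  have hchord : (2 * cos a - 1) * cos (ψ - 3 / 2 * η) ≤ d * cos (η / 2) := by
    have h1 : cos ((3 * (a + (η - ψ / 2)) - ψ / 2) / 2) + cos ((3 * (a - (η - ψ / 2)) + ψ / 2) / 2)
        = 2 * cos (3 * (a / 2)) * cos (ψ - 3 / 2 * η) := by
      rw [cos_add_cos, ← cos_neg (ψ - 3 / 2 * η)]; congr 2 <;> [skip; skip] <;> ring_nf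
    have h2 : cos ((a + (η - ψ / 2) + ψ / 2) / 2) + cos ((a - (η - ψ / 2) - ψ / 2) / 2)
        = 2 * cos (a / 2) * cos (η / 2) := by
      rw [cos_add_cos]; congr 2 <;> ring_nf
    have h3 : cos (3 * (a / 2)) = cos (a / 2) * (2 * cos a - 1) := by
      rw [cos_three_mul, show cos a = 2 * cos (a / 2) ^ 2 - 1 by rw [← cos_two_mul]; congr 1; ring]
      ring
    have h4 : 0 < cos (a / 2) := cos_pos_of_mem_Ioo ⟨by linarith, by linarith⟩
    have h5 : cos (a / 2) * ((2 * cos a - 1) * cos (ψ - 3 / 2 * η)) ≤ cos (a / 2) * (d * cos (η / 2)) := by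
      rw [h3] at h1
      have h2' : d * (cos ((a + (η - ψ / 2) + ψ / 2) / 2) + cos ((a - (η - ψ / 2) - ψ / 2) / 2))
        = d * (2 * cos (a / 2) * cos (η / 2)) := by rw [h2]
      linarith
    exact le_of_mul_le_mul_left h5 h4
  obtain ⟨h, rfl⟩ : ∃ h, ν = 2 * h := ⟨ν / 2, by ring⟩
  have hcη : 0 < cos (η / 2) := cos_pos_of_mem_Ioo ⟨by linarith, by linarith⟩
  have hch : 0 < cos h := cos_pos_of_mem_Ioo ⟨by linarith, by linarith⟩
  have hsh : 0 < sin h := sin_pos_of_pos_of_lt_pi (by linarith) (by linarith)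
  have hc1 : (2 * cos a - 1) * (2 * cos h * cos (h - 3 / 2 * η)) ≤ cos (η / 2) := by
    have i1 : sin h * cos (ψ - 3 / 2 * η) - sin (2 * h - ψ) * cos (h - 3 / 2 * η)
        = cos (2 * h - 3 / 2 * η) * sin (ψ - h) := by
      rw [show 2 * h - 3 / 2 * η = h + (h - 3 / 2 * η) by ring,
        show ψ - 3 / 2 * η = (ψ - h) + (h - 3 / 2 * η) by ring,
        show 2 * h - ψ = h - (ψ - h) by ring]
      rw [cos_add, cos_add, sin_sub h (ψ - h)]; ring
    have i2 : 0 ≤ cos (2 * h - 3 / 2 * η) * sin (ψ - h) := by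
      apply mul_nonneg
      · apply cos_nonneg_of_mem_Icc; constructor <;> linarith
      · apply sin_nonneg_of_nonneg_of_le_pi <;> linarith
    have i3 : 0 < cos (ψ - 3 / 2 * η) := by
      apply cos_pos_of_mem_Ioo; constructor <;> linarith
    have i4 : 0 ≤ cos (h - 3 / 2 * η) := by
      apply cos_nonneg_of_mem_Icc; constructor <;> linarith
    have i5 : (sin h * cos (ψ - 3 / 2 * η)) * ((2 * cos a - 1) * (2 * cos h * cos (h - 3 / 2 * η)))
        ≤ (sin h * cos (ψ - 3 / 2 * η)) * cos (η / 2) := by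
      have j1 := mul_le_mul_of_nonneg_right hchord (show 0 ≤ sin (2 * h) * cos (h - 3 / 2 * η) by positivity)
      have j2 : d * cos (η / 2) * (sin (2 * h) * cos (h - 3 / 2 * η)) =
        cos (η / 2) * (sin (2 * h - ψ) * cos (h - 3 / 2 * η)) := by rw [hν]; ring
      have j3 : sin (2 * h - ψ) * cos (h - 3 / 2 * η) ≤ sin h * cos (ψ - 3 / 2 * η) := by linarith
      have j4 := mul_le_mul_of_nonneg_left j3 hcη.le
      rw [j2] at j1
      have j5 := j1.trans j4
      rw [sin_two_mul] at j5
      linarith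
    exact le_of_mul_le_mul_left i5 (by positivity)
  have hm := step2 h η (2 * cos a) (by linarith) (by linarith) hη hg0 (by linarith [cos_le_one a])
    hm1 hR hsg2 hc1
  have hs2h : sin (2 * h) ≤ 25 / 32 := by rw [hR]; have := mul_le_mul hm hsg2 hsg.le (by norm_num); linarith
  have hc2h : 0.62 ≤ cos (2 * h) := by
    have h1 := sin_sq_add_cos_sq (2 * h)
    have h2 : 0 ≤ cos (2 * h) := cos_nonneg_of_mem_Icc ⟨by linarith, by linarith⟩
    exact aux_c2h _ _ h1 hsν hs2h h2
  have hsin2 : sin h ^ 2 ≤ 0.19 := by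
    have := cos_two_mul h
    have := sin_sq_add_cos_sq h
    linarith
  have hC9 : 0.9 ≤ cos h := aux_C9 _ _ (sin_sq_add_cos_sq h) hsin2 hch.le
  obtain ⟨z, hz⟩ : ∃ z, z * (2 * cos a) = 1 := ⟨(2 * cos a)⁻¹, by field_simp⟩
  have hz0 : 0 < z := pos_of_mul_pos_left (by rw [hz]; norm_num) (show 0 ≤ 2 * cos a by positivity)
  have hz1 : 0.64 ≤ z := aux_z1 _ _ hz hz0 hm
  have hz2 : z ≤ 1 := aux_z2 _ _ hz hz0 hm1
  have hgz : sin (2 * h - η) = z * sin (2 * h) := by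
    rw [hR]; linear_combination (-sin (2 * h - η)) * hz
  have hηh : η ≤ h := by
    by_contra hc
    push Not at hc
    have h1 : sin (2 * h - η) < sin h := by
      apply sin_lt_sin_of_lt_of_le_pi_div_two <;> linarith
    rw [hgz, sin_two_mul] at h1
    have h2 : 1 < z * (2 * cos h) := by
      have := mul_le_mul hz1 hC9 (by norm_num) hz0.le
      linarith
    have := mul_lt_mul_of_pos_right h2 hsh
    linarith
  have h3a := step3a h (h - η) z (by linarith) (by linarith) hsin2 hz1 hz2
    (by rw [show h + (h - η) = 2 * h - η by ring]; exact hgz)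
    (by rw [show h + (h - η) = 2 * h - η by ring]; exact hsg2)
  have h3b := step3b h η ψ z (by linarith) hη hηh (by linarith) hψν hc2h (by linarith) hz1
  have hprod : 4 * sin h * sin (h - η) = 2 * cos η - 2 * cos (2 * h - η) := by
    have := cos_sub_cos (2 * h - η) η
    rw [show (2 * h - η + η) / 2 = h by ring, show (2 * h - η - η) / 2 = h - η by ring] at this
    linarith
  rw [hprod, show 3 * h + (h - η) = 4 * h - η by ring] at h3a
  have hsa1 : sin a ^ 2 = 1 - cos a ^ 2 := by linarith [sin_sq_add_cos_sq a]
  have hsa0 : 0 < sin a := sin_pos_of_pos_of_lt_pi ha0 (by linarith)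
  have hsac : 0.6 ≤ sin a := aux_sac _ _ hsa1 hsa0 hm1 hm
  have hs1 : 1.15 < s := aux_s s hs0 hs
  refine fin_alg h η ψ z d s w (sin (ψ - η)) (√3) (sin a ^ 2) hs hs0 rfl hz0 hsη hsψ hw hgz hν hsν
    ?_ ?_ (by positivity) ?_ ?_ ?_
  · rw [hW]; linear_combination s * (1 - d ^ 2) * sin η * hz
  · rw [hsa1]; linear_combination (-(1 + z * (2 * cos a))) * hz
  · exact aux_pp _ _ hd hd1 (cos_le_one _)
  · have hq := hQ (sin (ψ - η))
    rw [hcc', hss'] at hq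
    have c2 : cos (ψ - 2 * η) = cos (η - ψ / 2) ^ 2 - sin (η - ψ / 2) ^ 2 := by
      rw [← cos_neg, show -(ψ - 2 * η) = 2 * (η - ψ / 2) by ring, cos_two_mul']
    have q1 : s ^ 2 / 2 * ((1 + d) * (-(2 * sin a * sin (η - ψ / 2))) ^ 2 +
        (1 - d) * (2 * sin a * cos (η - ψ / 2)) ^ 2) =
        2 * s ^ 2 * sin a ^ 2 * (1 - d * cos (ψ - 2 * η)) := by
      rw [c2]
      linear_combination 2 * s ^ 2 * sin a ^ 2 * sin_sq_add_cos_sq (η - ψ / 2)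
    have q2 : -(2 * sin a * sin (η - ψ / 2)) * cos (ψ / 2) + 2 * sin a * cos (η - ψ / 2) * sin (ψ / 2)
        = 2 * sin a * sin (ψ - η) := by rw [hη2]; ring
    rw [q1, q2] at hq
    have q3 : 2 ≤ 4 * (s * sin a) := aux_q3 _ _ hs1 hsac
    have q4 := mul_le_mul_of_nonneg_right q3 (show 0 ≤ w * sin (ψ - η) ^ 2 by positivity)
    linarith
  · linarith

lemma aux3_CE (C E : ℝ) (hE : 0 < E) (j1 : (2 * C + 1) * (2 * E + 1) < 0)
    (j2 : (2 * C - 1) * (2 * E - 1) < 0) : C < - (1 / 2) ∧ 1 / 2 < E := by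
  have k1 : C < - (1 / 2) := by
    by_contra hc
    push Not at hc
    nlinarith
  exact ⟨k1, by nlinarith⟩

lemma aux3_dx (d C r S : ℝ) (hr : 0 < r) (h : d * (r / 2) ≤ S) (hC : 0 < C) (h7 : 2 * S * C ≤ r / 2) :
    d * C ≤ 1 / 2 := by
  have := mul_le_mul_of_nonneg_right h hC.le
  have : r * (d * C) ≤ r * (1 / 2) := by linarith
  exact le_of_mul_le_mul_left this hr

lemma aux3_y (y H : ℝ) (hy : 0 < y) (hH : 0.866 < H) (h : (1 + y) * H ≤ 2 * (1 - y)) : y ≤ 0.396 := by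
  nlinarith

lemma aux3_H (H : ℝ) (h0 : 0 < H) (h : 3 / 4 < H ^ 2) : 0.866 < H := by nlinarith

lemma aux3_k2 (t v k : ℝ) (ht : 0 < t) (hv : 0 < v) (hk : 0 < k) (ht1 : t ^ 2 < 1)
    (hch : 2 * t * (t + v) ≤ k * ((1 - t ^ 2) * (1 - t * v))) : 2 * (t * v) ≤ k := by
  have : (1 - t ^ 2) * (1 - t * v) ≤ 1 := by
    have := mul_nonneg (show 0 ≤ 1 - t ^ 2 by linarith) (show 0 ≤ t * v by positivity)
    nlinarith
  nlinarith

lemma aux3_s7 (y z H : ℝ) (hy : 0 < y) (h4 : (1 + y) * H ≤ 2 * (1 - y)) (s6 : 1 - 2 * z ^ 2 ≤ H) :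
    3 * y - 1 ≤ 2 * z ^ 2 * (1 + y) := by nlinarith

lemma aux3_fin (K k H : ℝ) (hk : 0 < k) (hkK : k < K) (hK : K < 1 / 3) (hf : 1 - (K - k) / 4 ≤ H)
    (hQ : 4 * H ^ 2 < 3 * (1 + k)) : False := by
  nlinarith [sq_nonneg (H - 1)]

lemma aux3_s5 (t v k H : ℝ) (ht : 0 < t) (htv : t < v) (hv : v < 1) (hk : 0 < k) (hk3 : k < 1 / 3)
    (ht1 : t ^ 2 < 1) (hzv : t * v < 1) (hy1 : v ^ 2 < 1)
    (hch : 2 * t * (t + v) ≤ k * ((1 - t ^ 2) * (1 - t * v)))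
    (h1 : v * (1 - t ^ 2) + k * t * (1 - v ^ 2) ≤ v * (1 + t ^ 2) * H) : 3 / 4 < H ^ 2 := by
  have hv0 : 0 < v := ht.trans htv
  have a1 : 4 * t ^ 2 ≤ k * (1 - t ^ 2) ^ 2 := by
    have b1 : 2 * t * (2 * t) * (1 - t * v) ≤ 2 * t * (t + v) * (1 - t ^ 2) := by
      nlinarith [mul_pos ht (sub_pos.2 htv), mul_pos (mul_pos ht (sub_pos.2 htv)) (show 0 < 1 + t ^ 2 by positivity)]
    have b2 := mul_le_mul_of_nonneg_right hch (show 0 ≤ 1 - t ^ 2 by linarith)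
    have b3 : (4 * t ^ 2) * (1 - t * v) ≤ (k * (1 - t ^ 2) ^ 2) * (1 - t * v) := by linarith
    exact le_of_mul_le_mul_right b3 (by linarith)
  have a2 : 12 * t ^ 2 < (1 - t ^ 2) ^ 2 := by
    have : 0 < (1 - t ^ 2) ^ 2 := by
      apply pow_pos; linarith
    nlinarith
  have a3 : (1 - t ^ 2) ≤ (1 + t ^ 2) * H := by
    have : 0 ≤ k * t * (1 - v ^ 2) := mul_nonneg (by positivity) (by linarith)
    have : v * (1 - t ^ 2) ≤ v * ((1 + t ^ 2) * H) := by linarith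
    exact le_of_mul_le_mul_left this hv0
  have a4 : (1 - t ^ 2) ^ 2 ≤ ((1 + t ^ 2) * H) ^ 2 := pow_le_pow_left₀ (by linarith) a3 2
  have a5 : 3 / 4 * (1 + t ^ 2) ^ 2 < H ^ 2 * (1 + t ^ 2) ^ 2 := by nlinarith
  exact lt_of_mul_lt_mul_right a5 (by positivity)

lemma caseIII_pre (p q d s : ℝ) (hq : 0 < q) (hqp : q ≤ p) (hp : p < π / 2) (hd : 0 < d)
    (hs : 4 / 3 < s ^ 2)
    (h1 : s ^ 2 / 2 * ((1 + d) * (cos p + cos q) ^ 2 + (1 - d) * (sin q - sin p) ^ 2) ≤ 1)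
    (h2 : s ^ 2 / 2 * ((1 + d) * (cos q - cos p) ^ 2 + (1 - d) * (sin q + sin p) ^ 2) ≤ 1) :
    2 * π / 3 < p + q ∧ 1 / 2 < d * cos (p - q) := by
  have hD : 0 < cos (p - q) := cos_pos_of_mem_Ioo ⟨by linarith, by linarith⟩
  have i1 := sin_sq_add_cos_sq p
  have i2 := sin_sq_add_cos_sq q
  have e1 : (1 + d) * (cos p + cos q) ^ 2 + (1 - d) * (sin q - sin p) ^ 2 =
      2 * (1 + cos (p + q)) * (1 + d * cos (p - q)) := by
    rw [cos_add, cos_sub]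
    have a1 : sin p ^ 2 = 1 - cos p ^ 2 := by linarith
    have a2 : sin q ^ 2 = 1 - cos q ^ 2 := by linarith
    linear_combination (1 - d + 2 * d * sin q ^ 2) * a1 + (1 + d - 2 * d * cos p ^ 2) * a2
  have e2 : (1 + d) * (cos q - cos p) ^ 2 + (1 - d) * (sin q + sin p) ^ 2 =
      2 * (1 - cos (p + q)) * (1 - d * cos (p - q)) := by
    rw [cos_add, cos_sub]
    have a1 : sin p ^ 2 = 1 - cos p ^ 2 := by linarith
    have a2 : sin q ^ 2 = 1 - cos q ^ 2 := by linarith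
    linear_combination (1 - d + 2 * d * sin q ^ 2) * a1 + (1 + d - 2 * d * cos p ^ 2) * a2
  rw [e1] at h1
  rw [e2] at h2
  set C := cos (p + q) with hC
  set E := d * cos (p - q) with hE
  have hE0 : 0 < E := mul_pos hd hD
  have j1 : (2 * C + 1) * (2 * E + 1) < 0 := by
    by_contra hc
    push Not at hc
    nlinarith [mul_nonneg (sq_nonneg s) hc]
  have j2 : (2 * C - 1) * (2 * E - 1) < 0 := by
    by_contra hc
    push Not at hc
    nlinarith [mul_nonneg (sq_nonneg s) hc]
  obtain ⟨k1, k2⟩ := aux3_CE C E hE0 j1 j2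
  refine ⟨?_, k2⟩
  by_contra hc
  push Not at hc
  have := cos_le_cos_of_nonneg_of_le_pi (x := p + q) (y := 2 * π / 3) (by linarith) (by linarith [pi_pos]) hc
  rw [show 2 * π / 3 = π - π / 3 by ring, cos_pi_sub, cos_pi_div_three] at this
  linarith

lemma caseIII_a1 (p q d : ℝ) (hq : 0 < q) (hqp : q ≤ p) (hp : p < π / 2) (hd : 0 < d)
    (h : (1 - d) * (sin q * cos p) = (1 + d) * (cos q * sin p)) : False := by
  have h1 := sin_nonneg_of_nonneg_of_le_pi (x := p - q) (by linarith) (by linarith)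
  have h2 := sin_pos_of_pos_of_lt_pi (x := p + q) (by linarith) (by linarith)
  have : sin (p - q) = - (d * sin (p + q)) := by
    rw [sin_add, sin_sub]; linarith
  nlinarith

lemma caseIII_one (p q d t : ℝ) (hq : 0 < q) (hqp : q ≤ p) (hp : p < π / 2) (hd : 0 < d) (hd1 : d < 1)
    (ht : 0 ≤ t) (htp : t < p) (hS : 2 * π / 3 < p + q) (hD : 1 / 2 < d * cos (p - q))
    (hb : (1 - d) * (sin p * cos q) = (1 + d) * (cos p * sin q))
    (hc : cos t < cos q + cos p)
    (hch : (1 + d) * (sin t * sin ((p + t) / 2)) ≤ (1 - d) * (cos t * cos ((p + t) / 2))) : False := by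
  have hpi := pi_pos
  obtain ⟨x, hx⟩ : ∃ x, x = (π - (p + q)) / 2 := ⟨_, rfl⟩
  obtain ⟨D, hDD⟩ : ∃ D, D = p - q := ⟨_, rfl⟩
  have hp' : p = π / 2 - x + D / 2 := by rw [hx, hDD]; ring
  have hq' : q = π / 2 - x - D / 2 := by rw [hx, hDD]; ring
  have hx0 : 0 < x := by linarith
  have hx6 : x < π / 6 := by linarith
  have hb' : sin D = d * sin (2 * x) := by
    have : sin (p - q) = d * sin (p + q) := by rw [sin_sub, sin_add]; linarith
    rw [← hDD, show p + q = π - 2 * x by linarith, sin_pi_sub] at this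
    exact this
  rw [← hDD] at hD
  have hs2x : 0 < sin (2 * x) := sin_pos_of_pos_of_lt_pi (by linarith) (by linarith)
  have hDx : x < D := by
    by_contra hcon
    push Not at hcon
    have h1 : sin (2 * D) ≤ sin (2 * x) :=
      sin_le_sin_of_le_of_le_pi_div_two (by linarith) (by linarith) (by linarith)
    rw [sin_two_mul D, hb'] at h1
    nlinarith
  have hct : cos t < cos (π / 6 - x / 2) := by
    have h1 : cos q + cos p = 2 * sin x * cos (D / 2) := by
      rw [cos_add_cos, show (q + p) / 2 = π / 2 - x by linarith, show (q - p) / 2 = - (D / 2) by linarith,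
        cos_neg, cos_pi_div_two_sub]
    have h2 : cos (D / 2) ≤ cos (x / 2) :=
      cos_le_cos_of_nonneg_of_le_pi (by linarith) (by linarith) (by linarith)
    have h3 : 0 < sin x := sin_pos_of_pos_of_lt_pi (by linarith) (by linarith)
    have h4 : 2 * sin x * cos (x / 2) = sin (3 * x / 2) + sin (x / 2) := by
      rw [sin_add_sin]; congr 2 <;> ring_nf
    have h5 : cos (π / 6 - x / 2) = sin (x / 2) + sin (π / 3 - x / 2) := by
      rw [sin_add_sin, show (x / 2 + (π / 3 - x / 2)) / 2 = π / 6 by ring, sin_pi_div_six,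
        ← cos_neg, show - (π / 6 - x / 2) = (x / 2 - (π / 3 - x / 2)) / 2 by ring]; ring
    have h6 : sin (3 * x / 2) ≤ sin (π / 3 - x / 2) :=
      sin_le_sin_of_le_of_le_pi_div_two (by linarith) (by linarith) (by linarith)
    nlinarith
  have ht0 : π / 6 - x / 2 < t := by
    by_contra hcon
    push Not at hcon
    have := cos_le_cos_of_nonneg_of_le_pi ht (by linarith) hcon
    linarith
  set t0 := π / 6 - x / 2 with ht0d
  set h0 := π / 3 - x / 2 with hh0d
  set hh := (p + t) / 2 with hhd
  have hhh : h0 ≤ hh := by linarith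
  have b1 : cos t ≤ cos t0 := hct.le
  have b2 : cos hh ≤ cos h0 := cos_le_cos_of_nonneg_of_le_pi (by linarith) (by linarith) hhh
  have b3 : sin t0 ≤ sin t := sin_le_sin_of_le_of_le_pi_div_two (by linarith) (by linarith) (by linarith)
  have b4 : sin h0 ≤ sin hh := sin_le_sin_of_le_of_le_pi_div_two (by linarith) (by linarith) (by linarith)
  have b5 : 0 ≤ cos hh := cos_nonneg_of_mem_Icc ⟨by linarith, by linarith⟩
  have b6 : 0 ≤ cos t0 := cos_nonneg_of_mem_Icc ⟨by linarith, by linarith⟩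
  have b7 : 0 ≤ sin h0 := sin_nonneg_of_nonneg_of_le_pi (by linarith) (by linarith)
  have b8 : 0 ≤ sin t := sin_nonneg_of_nonneg_of_le_pi (by linarith) (by linarith)
  have c1 : cos t * cos hh ≤ cos t0 * cos h0 := mul_le_mul b1 b2 b5 b6
  have c2 : sin t0 * sin h0 ≤ sin t * sin hh := mul_le_mul b3 b4 b7 b8
  have c3 : (1 + d) * (sin t0 * sin h0) ≤ (1 - d) * (cos t0 * cos h0) :=
    (mul_le_mul_of_nonneg_left c2 (by linarith)).trans
      (hch.trans (mul_le_mul_of_nonneg_left c1 (by linarith)))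
  have c4 : d * cos (π / 6) ≤ sin x := by
    have e1 : cos (π / 6) = cos h0 * cos t0 + sin h0 * sin t0 := by
      rw [← cos_sub]; congr 1; ring
    have e2 : sin x = cos h0 * cos t0 - sin h0 * sin t0 := by
      rw [← cos_add, ← cos_pi_div_two_sub]; congr 1; ring
    rw [e1, e2]; linarith
  rw [cos_pi_div_six] at c4
  have c5 : cos D ≤ cos x := cos_le_cos_of_nonneg_of_le_pi (by linarith) (by linarith) hDx.le
  have c6 : 0 < cos x := cos_pos_of_mem_Ioo ⟨by linarith, by linarith⟩
  have c7 : sin (2 * x) ≤ √3 / 2 := by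
    rw [← sin_pi_div_three]
    exact sin_le_sin_of_le_of_le_pi_div_two (by linarith) (by linarith) (by linarith)
  rw [sin_two_mul] at c7
  have c8 : 0 < √3 := by positivity
  have c9 := aux3_dx d _ _ _ c8 c4 c6 c7
  have c10 : d * cos D ≤ d * cos x := mul_le_mul_of_nonneg_left c5 hd.le
  linarith

lemma caseIII_kmax (y z : ℝ) (hy0 : 0 < y) (hz0 : 0 < z) (hy : y ≤ 0.396) (h3 : z * (1 + z - z ^ 2) ≤ y ^ 2)
    (h4 : 3 * y - 1 ≤ 2 * z ^ 2 * (1 + y)) (hz1 : z ≤ y ^ 2) : 6 * z < 1 - y := by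
  by_contra hc
  push Not at hc
  have a1 : z ≤ 0.157 := by nlinarith
  have a2 : 0.1 ≤ z := by linarith
  have a3 : 1.09 ≤ 1 + z - z ^ 2 := by nlinarith
  have a4 : 1.09 * z ≤ y ^ 2 := by nlinarith
  have a5 : 0.3445 ≤ y := by nlinarith
  have a6 : z ^ 2 ≤ 0.842 * y ^ 4 := by
    have := mul_le_mul a4 a4 (by positivity) (by positivity)
    nlinarith
  have a7 : 3 * y - 1 ≤ 1.684 * y ^ 4 * (1 + y) := by nlinarith
  have a8 : y ^ 2 ≤ 0.7405 * y - 0.136422 := by nlinarith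
  have a9 : y ^ 4 * (1 + y) ≤ y ^ 2 * (1.396 * (0.7405 * y - 0.136422)) := by
    have : y ^ 2 * (1 + y) ≤ 1.396 * (0.7405 * y - 0.136422) := by nlinarith
    nlinarith [mul_le_mul_of_nonneg_left this (sq_nonneg y)]
  have a10 : 0 ≤ 1.396 * (0.7405 * y - 0.136422) := by nlinarith
  have a11 := mul_le_mul_of_nonneg_right a8 a10
  nlinarith

lemma caseIII_two_alg (t v k H : ℝ) (ht : 0 < t) (htv : t < v) (hv : v < 1) (hk : 0 < k) (hk3 : k < 1 / 3)
    (hch : 2 * t * (t + v) ≤ k * ((1 - t ^ 2) * (1 - t * v)))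
    (h1 : v * (1 - t ^ 2) + k * t * (1 - v ^ 2) ≤ v * (1 + t ^ 2) * H)
    (h4 : (1 + v ^ 2) * H ≤ 2 * (1 - v ^ 2))
    (hQ : 4 * H ^ 2 < 3 * (1 + k)) : False := by
  have hv0 : 0 < v := ht.trans htv
  have hH1 : H < 1 := by nlinarith
  obtain ⟨y, hy⟩ : ∃ y, y = v ^ 2 := ⟨_, rfl⟩
  obtain ⟨z, hz⟩ : ∃ z, z = t * v := ⟨_, rfl⟩
  have hy0 : 0 < y := by rw [hy]; positivity
  have hz0 : 0 < z := by rw [hz]; positivity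
  have hy1 : y < 1 := by nlinarith
  have hzy : z < y := by nlinarith
  have ht1 : t ^ 2 < 1 := by nlinarith
  have s2 : k * (1 - v ^ 2) < 2 * (t * v) := by
    have : t * (k * (1 - v ^ 2)) < t * (2 * (t * v)) := by nlinarith [mul_pos hv0 (show 0 < 1 + t ^ 2 by positivity)]
    exact lt_of_mul_lt_mul_left this ht.le
  have s3 : t + v * t ^ 2 ≤ v ^ 3 + t ^ 3 * v ^ 2 := by
    have hA : 0 ≤ (1 - t ^ 2) * (1 - t * v) := mul_nonneg (by linarith) (by linarith)
    have a1 := mul_le_mul_of_nonneg_left hch (show 0 ≤ 1 - v ^ 2 by linarith)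
    have a2 := mul_le_mul_of_nonneg_right s2.le hA
    have a3 : t * (2 * ((t + v) * (1 - v ^ 2))) ≤ t * (2 * (v * ((1 - t ^ 2) * (1 - t * v)))) := by linarith
    have := le_of_mul_le_mul_left a3 ht
    linarith
  have s3' : z * (1 + z - z ^ 2) ≤ y ^ 2 := by
    have := mul_le_mul_of_nonneg_right s3 hv0.le
    rw [hy, hz]; linarith
  have hzy2 : z ≤ y ^ 2 := by
    have : 0 ≤ z * (z * (1 - z)) := by
      apply mul_nonneg hz0.le (mul_nonneg hz0.le (by linarith))
    linarith
  have hH0 : 0 < H := by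
    have : 0 < v * (1 + t ^ 2) * H := by
      have : 0 ≤ k * t * (1 - v ^ 2) := mul_nonneg (by positivity) (by linarith)
      have : 0 < v * (1 - t ^ 2) := mul_pos hv0 (by linarith)
      linarith
    exact pos_of_mul_pos_right this (by positivity)
  have s5 : 3 / 4 < H ^ 2 := aux3_s5 t v k H ht htv hv hk hk3 ht1 (by linarith) (by linarith) hch h1
  have s5' : 0.866 < H := aux3_H H hH0 s5
  have hy3 : y ≤ 0.396 := by
    rw [← hy] at h4
    exact aux3_y y H hy0 s5' h4
  have hk2 := aux3_k2 t v k ht hv0 hk ht1 hch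
  have s6 : 1 - 2 * z ^ 2 ≤ H := by
    have a1 : 1 - t ^ 2 + 2 * t ^ 2 * (1 - v ^ 2) ≤ (1 + t ^ 2) * H := by
      have := mul_le_mul_of_nonneg_right hk2 (show 0 ≤ t * (1 - v ^ 2) from mul_nonneg ht.le (by linarith))
      have : v * (1 - t ^ 2 + 2 * t ^ 2 * (1 - v ^ 2)) ≤ v * ((1 + t ^ 2) * H) := by linarith
      exact le_of_mul_le_mul_left this hv0
    have a2 : (1 + t ^ 2) * (1 - 2 * z ^ 2) ≤ (1 + t ^ 2) * H := by
      rw [hz]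
      nlinarith [show 0 ≤ t ^ 4 * v ^ 2 by positivity]
    exact le_of_mul_le_mul_left a2 (by positivity)
  have s7 : 3 * y - 1 ≤ 2 * z ^ 2 * (1 + y) := by
    rw [← hy] at h4
    exact aux3_s7 y z H hy0 h4 s6
  have hkm := caseIII_kmax y z hy0 hz0 hy3 s3' s7 hzy2
  obtain ⟨K, hK⟩ : ∃ K, K = 2 * z / (1 - y) := ⟨_, rfl⟩
  have hK1 : K * (1 - y) = 2 * z := by rw [hK]; field_simp [show (1 - y) ≠ 0 by linarith]
  have hK3 : K < 1 / 3 := by rw [hK, div_lt_iff₀ (by linarith)]; linarith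
  have hkK : k < K := by
    rw [← hy, ← hz, ← hK1] at s2
    exact lt_of_mul_lt_mul_right s2 (by linarith)
  have htvy : t ≤ v * y := by
    have : t * v ≤ v * y * v := by rw [← hz, show v * y * v = y * v ^ 2 by ring, ← hy]; linarith
    exact le_of_mul_le_mul_right this hv0
  have hc4 : t * (1 - y) ≤ 1 / 4 * v := by
    have := mul_le_mul_of_nonneg_right htvy (show 0 ≤ 1 - y by linarith)
    nlinarith [sq_nonneg (y - 1 / 2)]
  have hf : 1 - (K - k) / 4 ≤ H := by
    have a1 : v * (1 + t ^ 2) - t * (1 - y) * (K - k) ≤ v * (1 + t ^ 2) * H := by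
      have : t * (1 - y) * K = 2 * t ^ 2 * v := by
        rw [mul_assoc, mul_comm (1 - y), hK1, hz]; ring
      rw [← hy] at h1
      linarith
    have a2 := mul_le_mul_of_nonneg_right hc4 (show 0 ≤ K - k by linarith)
    have a3 : v * (1 + t ^ 2) * (1 - (K - k) / 4) ≤ v * (1 + t ^ 2) * H := by
      have : 0 ≤ v * t ^ 2 * (K - k) := mul_nonneg (by positivity) (by linarith)
      linarith
    exact le_of_mul_le_mul_left a3 (by positivity)
  exact aux3_fin K k H hk hkK hK3 hf hQ

lemma caseIII_two (p q r d : ℝ) (hr : 0 < r) (hrq : r < q) (hqp : q ≤ p) (hp : p < π / 2)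
    (hd1 : d < 1) (hD : 1 / 2 < d * cos (p - q))
    (hQ : 2 / 3 * ((1 + d) * (cos p + cos q) ^ 2) < 1)
    (hb : (1 - d) * (cos q * (sin r + (sin p - sin q))) = (1 + d) * (sin q * (cos p + cos q - cos r)))
    (hch : (1 + d) * (sin r * sin ((q + r) / 2)) ≤ (1 - d) * (cos r * cos ((q + r) / 2))) : False := by
  have hd2 : 1 / 2 < d := by
    have h1 := cos_le_one (p - q)
    have h2 : 0 < cos (p - q) := cos_pos_of_mem_Ioo ⟨by linarith, by linarith⟩
    by_contra hc
    push Not at hc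
    nlinarith
  obtain ⟨k, hk⟩ : ∃ k, k * (1 + d) = 1 - d := ⟨(1 - d) / (1 + d), by field_simp⟩
  have hk0 : 0 < k := pos_of_mul_pos_left (by rw [hk]; linarith) (show 0 ≤ 1 + d by linarith)
  have hk3 : k < 1 / 3 := by nlinarith
  have hd0 : 0 < 1 + d := by linarith
  have cr : 0 < cos (r / 2) := cos_pos_of_mem_Ioo ⟨by linarith, by linarith⟩
  have cq : 0 < cos (q / 2) := cos_pos_of_mem_Ioo ⟨by linarith, by linarith⟩
  have sr : 0 < sin (r / 2) := sin_pos_of_pos_of_lt_pi (by linarith) (by linarith)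
  obtain ⟨t, ht⟩ : ∃ t, t = tan (r / 2) := ⟨_, rfl⟩
  obtain ⟨v, hv⟩ : ∃ v, v = tan (q / 2) := ⟨_, rfl⟩
  have ht' : sin (r / 2) = t * cos (r / 2) := by rw [ht, tan_mul_cos cr.ne']
  have hv' : sin (q / 2) = v * cos (q / 2) := by rw [hv, tan_mul_cos cq.ne']
  have ht0 : 0 < t := by rw [ht]; exact tan_pos_of_pos_of_lt_pi_div_two (by linarith) (by linarith)
  have htv : t < v := by
    rw [ht, hv]; exact tan_lt_tan_of_nonneg_of_lt_pi_div_two (by linarith) (by linarith) (by linarith)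
  have hv1 : v < 1 := by
    rw [hv, ← tan_pi_div_four]
    exact tan_lt_tan_of_nonneg_of_lt_pi_div_two (by linarith) (by linarith) (by linarith)
  have er : cos (r / 2) ^ 2 * (1 + t ^ 2) = 1 := by
    have := sin_sq_add_cos_sq (r / 2); rw [ht'] at this; linarith
  have eq : cos (q / 2) ^ 2 * (1 + v ^ 2) = 1 := by
    have := sin_sq_add_cos_sq (q / 2); rw [hv'] at this; linarith
  have sinr : sin r = 2 * t * cos (r / 2) ^ 2 := by
    rw [show sin r = sin (2 * (r / 2)) by congr 1; ring, sin_two_mul, ht']; ring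
  have cosr : cos r = (1 - t ^ 2) * cos (r / 2) ^ 2 := by
    rw [show cos r = cos (2 * (r / 2)) by congr 1; ring, cos_two_mul', ht']; ring
  have sinq : sin q = 2 * v * cos (q / 2) ^ 2 := by
    rw [show sin q = sin (2 * (q / 2)) by congr 1; ring, sin_two_mul, hv']; ring
  have cosq : cos q = (1 - v ^ 2) * cos (q / 2) ^ 2 := by
    rw [show cos q = cos (2 * (q / 2)) by congr 1; ring, cos_two_mul', hv']; ring
  have sqr : sin ((q + r) / 2) = (t + v) * (cos (q / 2) * cos (r / 2)) := by
    rw [show (q + r) / 2 = q / 2 + r / 2 by ring, sin_add, ht', hv']; ring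
  have cqr : cos ((q + r) / 2) = (1 - t * v) * (cos (q / 2) * cos (r / 2)) := by
    rw [show (q + r) / 2 = q / 2 + r / 2 by ring, cos_add, ht', hv']; ring
  have hpq : sin q ≤ sin p := sin_le_sin_of_le_of_le_pi_div_two (by linarith) (by linarith) (by linarith)
  have hpqc : cos p ≤ cos q := cos_le_cos_of_nonneg_of_le_pi (by linarith) (by linarith) hqp
  obtain ⟨H, hH⟩ : ∃ H, H = cos p + cos q := ⟨_, rfl⟩
  obtain ⟨g, hg⟩ : ∃ g, g = sin p - sin q := ⟨_, rfl⟩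
  have hg0 : 0 ≤ g := by linarith
  rw [← hH] at hQ hb
  rw [← hg] at hb
  have hcq0 : 0 < cos q := cos_pos_of_mem_Ioo ⟨by linarith, by linarith⟩
  refine caseIII_two_alg t v k H ht0 htv hv1 hk0 hk3 ?_ ?_ ?_ ?_
  · rw [← hk, sinr, cosr, sqr, cqr] at hch
    have hX : 0 < (1 + d) * (cos (r / 2) ^ 2 * (cos (q / 2) * cos (r / 2))) := by positivity
    have : (1 + d) * (cos (r / 2) ^ 2 * (cos (q / 2) * cos (r / 2))) * (2 * t * (t + v)) ≤
      (1 + d) * (cos (r / 2) ^ 2 * (cos (q / 2) * cos (r / 2))) * (k * ((1 - t ^ 2) * (1 - t * v))) := by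
      linarith
    exact le_of_mul_le_mul_left this hX
  · rw [← hk] at hb
    have h1 : k * (cos q * (sin r + g)) = sin q * (H - cos r) := by
      have : (1 + d) * (k * (cos q * (sin r + g))) = (1 + d) * (sin q * (H - cos r)) := by linarith
      exact mul_left_cancel₀ hd0.ne' this
    have h2 : k * (cos q * sin r) ≤ sin q * (H - cos r) := by
      have : 0 ≤ k * (cos q * g) := by positivity
      linarith
    rw [cosq, sinq, sinr, cosr] at h2
    have h3 : cos (q / 2) ^ 2 * (k * ((1 - v ^ 2) * (t * cos (r / 2) ^ 2))) ≤
      cos (q / 2) ^ 2 * (v * (H - (1 - t ^ 2) * cos (r / 2) ^ 2)) := by linarith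
    have h4 := le_of_mul_le_mul_left h3 (by positivity)
    have h5 := mul_le_mul_of_nonneg_right h4 (show 0 ≤ 1 + t ^ 2 by positivity)
    have e1 : k * ((1 - v ^ 2) * (t * cos (r / 2) ^ 2)) * (1 + t ^ 2) = k * t * (1 - v ^ 2) := by
      linear_combination (k * t * (1 - v ^ 2)) * er
    have e2 : v * (H - (1 - t ^ 2) * cos (r / 2) ^ 2) * (1 + t ^ 2) = v * (1 + t ^ 2) * H - v * (1 - t ^ 2) := by
      linear_combination (-(v * (1 - t ^ 2))) * er
    rw [e1, e2] at h5
    linarith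
  · have : H ≤ 2 * cos q := by linarith
    have h5 := mul_le_mul_of_nonneg_left this (show 0 ≤ 1 + v ^ 2 by positivity)
    rw [cosq] at h5
    have e2 : (1 + v ^ 2) * (2 * ((1 - v ^ 2) * cos (q / 2) ^ 2)) = 2 * (1 - v ^ 2) := by
      linear_combination (2 * (1 - v ^ 2)) * eq
    linarith
  · have h1 : (1 + k) * (1 + d) = 2 := by linarith
    have h2 : (1 + d) * (4 * H ^ 2) < (1 + d) * (3 * (1 + k)) := by linarith
    exact lt_of_mul_lt_mul_left h2 hd0.le

/-- Combinatorial lemma: nested neighbourhoods. -/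
lemma nested_comb (S : Finset ℝ) (hS : S.Nonempty) (R : ℝ → ℝ → Prop)
    (hsym : ∀ r ∈ S, ∀ x ∈ S, R r x → R x r)
    (hanti : ∀ r ∈ S, ∀ r' ∈ S, ∀ x ∈ S, r ≤ r' → R r' x → R r x)
    (hinj : ∀ r ∈ S, ∀ r' ∈ S, (∀ x ∈ S, R r x ↔ R r' x) → r = r') :
    ((∀ x ∈ S, R (S.min' hS) x) ∧ (∀ x ∈ S, R (S.max' hS) x ↔ x = S.min' hS)) ∨
    ((∀ x ∈ S, ¬ R (S.max' hS) x) ∧ (∀ x ∈ S, R (S.min' hS) x ↔ x ≠ S.max' hS)) := by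
  classical
  set m := S.min' hS with hm
  set M := S.max' hS with hM
  have hmS : m ∈ S := S.min'_mem hS
  have hMS : M ∈ S := S.max'_mem hS
  have hmle : ∀ x ∈ S, m ≤ x := fun x hx => S.min'_le x hx
  have hMle : ∀ x ∈ S, x ≤ M := fun x hx => S.le_max' x hx
  let N : ℝ → Finset ℝ := fun r => S.filter (R r)
  have hNsub : ∀ r ∈ S, ∀ r' ∈ S, r ≤ r' → N r' ⊆ N r := by
    intro r hr r' hr' hle x hx
    simp only [N, Finset.mem_filter] at hx ⊢
    exact ⟨hx.1, hanti r hr r' hr' x hx.1 hle hx.2⟩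
  have hNinj : ∀ r ∈ S, ∀ r' ∈ S, N r = N r' → r = r' := by
    intro r hr r' hr' h
    apply hinj r hr r' hr'
    intro x hx
    have := Finset.ext_iff.1 h x
    simp only [N, Finset.mem_filter, hx, true_and] at this
    exact this
  have hcardinj : Set.InjOn (fun r => (N r).card) (S : Set ℝ) := by
    intro r hr r' hr' h
    simp only at h
    rcases le_total r r' with hle | hle
    · exact hNinj r hr r' hr' (Finset.eq_of_subset_of_card_le (hNsub r hr r' hr' hle) h.le).symm
    · exact hNinj r hr r' hr' (Finset.eq_of_subset_of_card_le (hNsub r' hr' r hr hle) h.symm.le)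
  have himg : S.image (fun r => (N r).card) ⊆ Finset.Icc (N M).card (N m).card := by
    intro k hk
    rw [Finset.mem_image] at hk
    obtain ⟨r, hr, rfl⟩ := hk
    rw [Finset.mem_Icc]
    exact ⟨Finset.card_le_card (hNsub r hr M hMS (hMle r hr)),
      Finset.card_le_card (hNsub m hmS r hr (hmle r hr))⟩
  have hc := Finset.card_le_card himg
  rw [Finset.card_image_of_injOn hcardinj, Nat.card_Icc] at hc
  have hNmS : N m ⊆ S := Finset.filter_subset _ _
  have hle1 := Finset.card_le_card hNmS
  have hSpos : 0 < S.card := Finset.card_pos.2 hS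
  by_cases hfull : ∀ x ∈ S, R m x
  · left
    refine ⟨hfull, ?_⟩
    have hMm : m ∈ N M := by
      simp only [N, Finset.mem_filter]
      exact ⟨hmS, hsym m hmS M hMS (hfull M hMS)⟩
    have hcM : (N M).card ≤ 1 := by omega
    intro x hx
    constructor
    · intro h
      have : x ∈ N M := by simp only [N, Finset.mem_filter]; exact ⟨hx, h⟩
      exact Finset.card_le_one.1 hcM x this m hMm
    · rintro rfl
      exact (Finset.mem_filter.1 hMm).2
  · right
    have hlt : (N m).card < S.card := by
      apply Finset.card_lt_card
      refine ⟨hNmS, fun h => hfull fun x hx => (Finset.mem_filter.1 (h hx)).2⟩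
    have hM0 : (N M).card = 0 := by omega
    have hm1 : (N m).card + 1 = S.card := by omega
    have hMno : ∀ x ∈ S, ¬ R M x := by
      intro x hx h
      have : x ∈ N M := by simp only [N, Finset.mem_filter]; exact ⟨hx, h⟩
      rw [Finset.card_eq_zero] at hM0
      rw [hM0] at this
      simp at this
    refine ⟨hMno, ?_⟩
    have hsub : N m ⊆ S.erase M := by
      intro x hx
      simp only [N, Finset.mem_filter] at hx
      rw [Finset.mem_erase]
      refine ⟨?_, hx.1⟩
      rintro rfl
      exact hMno m hmS (hsym m hmS M hMS hx.2)
    have heq : N m = S.erase M := by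
      apply Finset.eq_of_subset_of_card_le hsub
      rw [Finset.card_erase_of_mem hMS]; omega
    intro x hx
    have := Finset.ext_iff.1 heq x
    simp only [N, Finset.mem_filter, Finset.mem_erase, hx, true_and, and_true] at this
    exact this

/-- Extremal configuration of angles and weights. -/
structure Cfg (ι : Type) [Fintype ι] where
  w : ι → ℝ
  t : ι → ℝ
  s : ℝ
  d : ℝ
  hw : ∀ i, 0 < w i
  htl : ∀ i, -(π / 2) < t i
  htr : ∀ i, t i < π / 2
  hs : 4 / 3 < s ^ 2
  hs0 : 0 < s
  hd : 0 < d
  hd1 : d < 1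
  sumw : ∑ i, w i = 1
  sumc : ∑ i, w i * cos (t i) ^ 2 = (1 + d) / 2
  sums : ∑ i, w i * sin (t i) ^ 2 = (1 - d) / 2
  sumsc : ∑ i, w i * (sin (t i) * cos (t i)) = 0
  N : ι → Finset ι
  hN : ∀ i j, j ∈ N i ↔ (1 + d) * (sin (t i) * sin (t j)) ≤ (1 - d) * (cos (t i) * cos (t j))
  eqc : ∀ i, ∑ j ∈ N i, w j * cos (t j) = s * (1 + d) / 2 * cos (t i)
  eqs : ∀ i, ∑ j ∈ N i, w j * sin (t j) = - (s * (1 - d) / 2 * sin (t i))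

namespace Cfg
variable {ι : Type} [Fintype ι] [DecidableEq ι] (c : Cfg ι)

/-- cosine sum -/
noncomputable def C (P : Finset ι) : ℝ := ∑ j ∈ P, c.w j * cos (c.t j)
/-- sine sum -/
noncomputable def S (P : Finset ι) : ℝ := ∑ j ∈ P, c.w j * sin (c.t j)

/-- the sum over `P` sits at circle angle `θ` -/
def IsE (P : Finset ι) (θ : ℝ) : Prop :=
  c.C P = c.s * (1 + c.d) / 2 * cos θ ∧ c.S P = c.s * (1 - c.d) / 2 * sin θ

/-- reflection -/
def neg : Cfg ι where
  w := c.w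
  t := fun i => - c.t i
  s := c.s
  d := c.d
  hw := c.hw
  htl := fun i => by have := c.htr i; linarith
  htr := fun i => by have := c.htl i; linarith
  hs := c.hs
  hs0 := c.hs0
  hd := c.hd
  hd1 := c.hd1
  sumw := c.sumw
  sumc := by simp only [cos_neg]; exact c.sumc
  sums := by simp only [sin_neg, neg_sq]; exact c.sums
  sumsc := by simp only [sin_neg, cos_neg, neg_mul, mul_neg, Finset.sum_neg_distrib]; rw [c.sumsc]; simp
  N := c.N
  hN := fun i j => by rw [c.hN]; simp only [sin_neg, cos_neg, neg_mul_neg]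
  eqc := fun i => by simp only [cos_neg]; exact c.eqc i
  eqs := fun i => by
    simp only [sin_neg, mul_neg, Finset.sum_neg_distrib]; rw [c.eqs i]

lemma neg_C (P : Finset ι) : c.neg.C P = c.C P := by
  simp [C, neg]
lemma neg_S (P : Finset ι) : c.neg.S P = - c.S P := by
  simp [S, neg]
lemma neg_IsE (P : Finset ι) (θ : ℝ) : c.neg.IsE P θ ↔ c.IsE P (-θ) := by
  unfold IsE
  rw [neg_C, neg_S, cos_neg, sin_neg]
  show _ = c.s * (1 + c.d) / 2 * cos θ ∧ _ = c.s * (1 - c.d) / 2 * sin θ ↔ _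
  constructor
  · rintro ⟨h1, h2⟩; exact ⟨h1, by linarith⟩
  · rintro ⟨h1, h2⟩; exact ⟨h1, by linarith⟩

lemma cpos (i : ι) : 0 < cos (c.t i) := cos_pos_of_mem_Ioo ⟨c.htl i, c.htr i⟩

lemma lam_pos : 0 < c.s * (1 + c.d) / 2 := by
  have := c.hs0; have := c.hd; positivity
lemma mu_pos : 0 < c.s * (1 - c.d) / 2 := by
  have := c.hs0; have := sub_pos.2 c.hd1; positivity

lemma C_pos (P : Finset ι) (hP : P.Nonempty) : 0 < c.C P :=
  Finset.sum_pos (fun i _ => mul_pos (c.hw i) (c.cpos i)) hP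

lemma isE_N (i : ι) : c.IsE (c.N i) (- c.t i) := by
  refine ⟨?_, ?_⟩
  · rw [cos_neg]; exact c.eqc i
  · rw [sin_neg]; have := c.eqs i; unfold S; linarith

lemma C_union (P Q : Finset ι) (h : Disjoint P Q) : c.C (P ∪ Q) = c.C P + c.C Q :=
  Finset.sum_union h
lemma S_union (P Q : Finset ι) (h : Disjoint P Q) : c.S (P ∪ Q) = c.S P + c.S Q :=
  Finset.sum_union h
lemma C_sdiff (P Q : Finset ι) (h : P ⊆ Q) : c.C (Q \ P) = c.C Q - c.C P := by
  have := Finset.sum_sdiff (f := fun j => c.w j * cos (c.t j)) h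
  unfold C; linarith
lemma S_sdiff (P Q : Finset ι) (h : P ⊆ Q) : c.S (Q \ P) = c.S Q - c.S P := by
  have := Finset.sum_sdiff (f := fun j => c.w j * sin (c.t j)) h
  unfold S; linarith
lemma C_compl (P : Finset ι) : c.C Pᶜ = c.C Finset.univ - c.C P := by
  rw [Finset.compl_eq_univ_sdiff, C_sdiff _ _ _ (Finset.subset_univ _)]
lemma S_compl (P : Finset ι) : c.S Pᶜ = c.S Finset.univ - c.S P := by
  rw [Finset.compl_eq_univ_sdiff, S_sdiff _ _ _ (Finset.subset_univ _)]

lemma chord_ge (P : Finset ι) (θ : ℝ) (h1 : -(π / 2) < θ) (h : ∀ i ∈ P, θ ≤ c.t i) :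
    sin θ * c.C P ≤ cos θ * c.S P := by
  unfold C S
  rw [Finset.mul_sum, Finset.mul_sum]
  apply Finset.sum_le_sum
  intro i hi
  have h2 : 0 ≤ sin (c.t i - θ) :=
    sin_nonneg_of_nonneg_of_le_pi (by linarith [h i hi]) (by linarith [c.htr i])
  rw [sin_sub] at h2
  have := mul_nonneg (c.hw i).le h2
  linarith

lemma chord_le (P : Finset ι) (θ : ℝ) (h1 : θ < π / 2) (h : ∀ i ∈ P, c.t i ≤ θ) :
    cos θ * c.S P ≤ sin θ * c.C P := by
  unfold C S
  rw [Finset.mul_sum, Finset.mul_sum]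
  apply Finset.sum_le_sum
  intro i hi
  have h2 : 0 ≤ sin (θ - c.t i) :=
    sin_nonneg_of_nonneg_of_le_pi (by linarith [h i hi]) (by linarith [c.htl i])
  rw [sin_sub] at h2
  have := mul_nonneg (c.hw i).le h2
  linarith

lemma Qb (f : ι → ℝ) (X Y : ℝ) (h1 : ∑ i, c.w i * f i * cos (c.t i) = c.s * (1 + c.d) / 2 * X)
    (h2 : ∑ i, c.w i * f i * sin (c.t i) = c.s * (1 - c.d) / 2 * Y) :
    c.s ^ 2 / 2 * ((1 + c.d) * X ^ 2 + (1 - c.d) * Y ^ 2) ≤ ∑ i, c.w i * f i ^ 2 := by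
  have h0 : 0 ≤ ∑ i, c.w i * (f i - c.s * X * cos (c.t i) - c.s * Y * sin (c.t i)) ^ 2 :=
    Finset.sum_nonneg fun i _ => mul_nonneg (c.hw i).le (sq_nonneg _)
  have e : ∑ i, c.w i * (f i - c.s * X * cos (c.t i) - c.s * Y * sin (c.t i)) ^ 2 =
      ∑ i, c.w i * f i ^ 2 + (c.s * X) ^ 2 * ∑ i, c.w i * cos (c.t i) ^ 2 +
      (c.s * Y) ^ 2 * ∑ i, c.w i * sin (c.t i) ^ 2 - 2 * c.s * X * ∑ i, c.w i * f i * cos (c.t i)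
      - 2 * c.s * Y * ∑ i, c.w i * f i * sin (c.t i) +
      2 * c.s ^ 2 * X * Y * ∑ i, c.w i * (sin (c.t i) * cos (c.t i)) := by
    simp only [Finset.mul_sum, ← Finset.sum_add_distrib, ← Finset.sum_sub_distrib]
    apply Finset.sum_congr rfl
    intro i _
    ring
  rw [e, h1, h2, c.sumc, c.sums, c.sumsc] at h0
  linarith

/-- dichotomy -/
lemma dich (V : Finset ι) (hV : V.Nonempty) (h1 : ∀ i ∈ V, 0 ≤ c.t i) (h2 : ∀ i ∉ V, c.t i ≤ 0) :
    ∃ m ∈ V, ∃ M ∈ V, (∀ i ∈ V, c.t m ≤ c.t i ∧ c.t i ≤ c.t M) ∧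
      ((m ∈ c.N m ∧ c.IsE Finset.univ (- c.t m) ∧
          c.IsE (Vᶜ ∪ V.filter (fun i => c.t i = c.t m)) (- c.t M)) ∨
       (0 < c.t M ∧ c.IsE Vᶜ (- c.t M) ∧
          c.IsE (Finset.univ \ V.filter (fun i => c.t i = c.t M)) (- c.t m))) := by
  have hSn : (V.image c.t).Nonempty := hV.image _
  have hmem : ∀ r ∈ V.image c.t, ∃ i ∈ V, c.t i = r := fun r hr => Finset.mem_image.1 hr
  have hcross : ∀ i ∈ V, ∀ j ∉ V, j ∈ c.N i := by
    intro i hi j hj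
    rw [c.hN]
    have a1 : 0 ≤ sin (c.t i) := sin_nonneg_of_nonneg_of_le_pi (h1 i hi) (by linarith [c.htr i, pi_pos])
    have a2 : sin (c.t j) ≤ 0 := sin_nonpos_of_nonpos_of_neg_pi_le (h2 j hj) (by linarith [c.htl j, pi_pos])
    have a3 := mul_nonneg (sub_pos.2 c.hd1).le (mul_pos (c.cpos i) (c.cpos j)).le
    have a4 := mul_nonneg (show 0 ≤ 1 + c.d by linarith [c.hd]) (mul_nonneg a1 (neg_nonneg.2 a2))
    linarith
  have key := nested_comb (V.image c.t) hSn
    (fun r x => (1 + c.d) * (sin r * sin x) ≤ (1 - c.d) * (cos r * cos x)) ?_ ?_ ?_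
  · obtain ⟨m, hm, hmt⟩ := hmem _ ((V.image c.t).min'_mem hSn)
    obtain ⟨M, hM, hMt⟩ := hmem _ ((V.image c.t).max'_mem hSn)
    rw [← hmt, ← hMt] at key
    have hmin : ∀ i ∈ V, c.t m ≤ c.t i := fun i hi => by
      rw [hmt]; exact Finset.min'_le _ _ (Finset.mem_image_of_mem _ hi)
    have hmax : ∀ i ∈ V, c.t i ≤ c.t M := fun i hi => by
      rw [hMt]; exact Finset.le_max' _ _ (Finset.mem_image_of_mem _ hi)
    refine ⟨m, hm, M, hM, fun i hi => ⟨hmin i hi, hmax i hi⟩, ?_⟩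
    rcases key with ⟨k1, k2⟩ | ⟨k1, k2⟩
    · left
      have hNm : c.N m = Finset.univ := by
        apply Finset.eq_univ_of_forall
        intro j
        by_cases hj : j ∈ V
        · rw [c.hN]; exact k1 _ (Finset.mem_image_of_mem _ hj)
        · exact hcross m hm j hj
      have hNM : c.N M = Vᶜ ∪ V.filter (fun i => c.t i = c.t m) := by
        ext j
        rw [Finset.mem_union, Finset.mem_compl, Finset.mem_filter]
        by_cases hj : j ∈ V
        · rw [c.hN, k2 _ (Finset.mem_image_of_mem _ hj)]
          simp [hj]
        · simp [hj, hcross M hM j hj]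
      refine ⟨by rw [hNm]; simp, ?_, ?_⟩
      · rw [← hNm]; exact c.isE_N m
      · rw [← hNM]; exact c.isE_N M
    · right
      have hNM : c.N M = Vᶜ := by
        ext j
        rw [Finset.mem_compl]
        by_cases hj : j ∈ V
        · rw [c.hN]; simp only [hj, not_true_eq_false, iff_false]
          exact k1 _ (Finset.mem_image_of_mem _ hj)
        · simp [hj, hcross M hM j hj]
      have hNm : c.N m = Finset.univ \ V.filter (fun i => c.t i = c.t M) := by
        ext j
        rw [Finset.mem_sdiff, Finset.mem_filter]
        by_cases hj : j ∈ V
        · rw [c.hN, k2 _ (Finset.mem_image_of_mem _ hj)]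
          simp [hj]
        · simp [hj, hcross m hm j hj]
      refine ⟨?_, ?_, ?_⟩
      · have := k1 _ (Finset.mem_image_of_mem _ hM)
        rcases (h1 M hM).lt_or_eq with h | h
        · exact h
        · exfalso; apply this
          rw [← h]
          simp only [sin_zero, cos_zero]
          linarith [c.hd1]
      · rw [← hNM]; exact c.isE_N M
      · rw [← hNm]; exact c.isE_N m
  · intro r _ x _ h
    rw [mul_comm (sin x), mul_comm (cos x)]; exact h
  · intro r hr r' hr' x hx hle h
    obtain ⟨i, hi, rfl⟩ := hmem r hr
    obtain ⟨i', hi', rfl⟩ := hmem r' hr'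
    obtain ⟨j, hj, rfl⟩ := hmem x hx
    have a1 : sin (c.t i) ≤ sin (c.t i') :=
      sin_le_sin_of_le_of_le_pi_div_two (c.htl i).le (c.htr i').le hle
    have a2 : cos (c.t i') ≤ cos (c.t i) :=
      cos_le_cos_of_nonneg_of_le_pi (h1 i hi) (by linarith [c.htr i', pi_pos]) hle
    have a3 : 0 ≤ sin (c.t j) := sin_nonneg_of_nonneg_of_le_pi (h1 j hj) (by linarith [c.htr j, pi_pos])
    have b1 := mul_le_mul_of_nonneg_left (mul_le_mul_of_nonneg_right a1 a3) (show 0 ≤ 1 + c.d by linarith [c.hd])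
    have b2 := mul_le_mul_of_nonneg_left (mul_le_mul_of_nonneg_right a2 (c.cpos j).le) (sub_pos.2 c.hd1).le
    exact b1.trans (h.trans b2)
  · intro r hr r' hr' h
    obtain ⟨i, hi, rfl⟩ := hmem r hr
    obtain ⟨i', hi', rfl⟩ := hmem r' hr'
    have hNN : c.N i = c.N i' := by
      ext j
      by_cases hj : j ∈ V
      · rw [c.hN, c.hN]; exact h _ (Finset.mem_image_of_mem _ hj)
      · simp [hcross i hi j hj, hcross i' hi' j hj]
    have e1 := (c.isE_N i).1
    have e2 := (c.isE_N i').1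
    rw [hNN, e2, cos_neg, cos_neg] at e1
    have e3 := mul_left_cancel₀ c.lam_pos.ne' e1
    exact (injOn_cos ⟨h1 i hi, by linarith [c.htr i, pi_pos]⟩ ⟨h1 i' hi', by linarith [c.htr i', pi_pos]⟩ e3.symm)

/-- sign argument -/
lemma exists_neg : ∃ i, c.t i < 0 := by
  by_contra hc
  push Not at hc
  have hz : ∀ i, sin (c.t i) = 0 := by
    intro i
    have a : ∀ j, 0 ≤ sin (c.t j) := fun j =>
      sin_nonneg_of_nonneg_of_le_pi (hc j) (by linarith [c.htr j, pi_pos])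
    have h := c.eqs i
    have h2 : 0 ≤ ∑ j ∈ c.N i, c.w j * sin (c.t j) :=
      Finset.sum_nonneg fun j _ => mul_nonneg (c.hw j).le (a j)
    have h3 := mul_nonneg c.mu_pos.le (a i)
    have h4 : c.s * (1 - c.d) / 2 * sin (c.t i) = 0 := by linarith
    rcases mul_eq_zero.1 h4 with h5 | h5
    · exact absurd h5 c.mu_pos.ne'
    · exact h5
  have := c.sums
  simp only [hz] at this
  simp at this
  linarith [c.hd1]

lemma exists_pos : ∃ i, 0 < c.t i := by
  obtain ⟨i, hi⟩ := c.neg.exists_neg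
  exact ⟨i, by simpa [neg] using hi⟩

/-- signed sums -/
lemma sum_f (V P : Finset ι) (hP : P ⊆ V) (f : ℝ) (g : ι → ℝ) :
    ∑ i, c.w i * (if i ∈ P then f else if i ∈ V then 1 else -1) * g i =
      f * (∑ i ∈ P, c.w i * g i) + (∑ i ∈ V, c.w i * g i - ∑ i ∈ P, c.w i * g i) -
        ∑ i ∈ Vᶜ, c.w i * g i := by
  have e1 : ∑ i ∈ V, c.w i * g i - ∑ i ∈ P, c.w i * g i = ∑ i ∈ V \ P, c.w i * g i := by
    have := Finset.sum_sdiff (f := fun j => c.w j * g j) hP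
    linarith
  rw [e1, ← Finset.sum_add_sum_compl V, ← Finset.sum_sdiff hP]
  have a1 : ∑ i ∈ V \ P, c.w i * (if i ∈ P then f else if i ∈ V then 1 else -1) * g i =
      ∑ i ∈ V \ P, c.w i * g i := by
    apply Finset.sum_congr rfl
    intro i hi
    rw [Finset.mem_sdiff] at hi
    simp [hi.1, hi.2]
  have a2 : ∑ i ∈ P, c.w i * (if i ∈ P then f else if i ∈ V then 1 else -1) * g i =
      f * ∑ i ∈ P, c.w i * g i := by
    rw [Finset.mul_sum]
    apply Finset.sum_congr rfl
    intro i hi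
    simp [hi]; ring
  have a3 : ∑ i ∈ Vᶜ, c.w i * (if i ∈ P then f else if i ∈ V then 1 else -1) * g i =
      - ∑ i ∈ Vᶜ, c.w i * g i := by
    rw [← Finset.sum_neg_distrib]
    apply Finset.sum_congr rfl
    intro i hi
    rw [Finset.mem_compl] at hi
    have : i ∉ P := fun h => hi (hP h)
    simp [hi, this]
  rw [a1, a2, a3]; ring

/-- Q-bound for signed vectors. -/
lemma Qf (V P : Finset ι) (hP : P ⊆ V) (f X Y : ℝ)
    (hX : f * c.C P + (c.C V - c.C P) - c.C Vᶜ = c.s * (1 + c.d) / 2 * X)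
    (hY : f * c.S P + (c.S V - c.S P) - c.S Vᶜ = c.s * (1 - c.d) / 2 * Y) :
    c.s ^ 2 / 2 * ((1 + c.d) * X ^ 2 + (1 - c.d) * Y ^ 2) ≤ 1 - (∑ i ∈ P, c.w i) * (1 - f ^ 2) := by
  have h := c.Qb (fun i => if i ∈ P then f else if i ∈ V then 1 else -1) X Y
    (by rw [c.sum_f V P hP f]; exact hX) (by rw [c.sum_f V P hP f]; exact hY)
  refine h.trans (le_of_eq ?_)
  have e : ∀ i, c.w i * (if i ∈ P then f else if i ∈ V then 1 else -1) ^ 2 =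
      c.w i - (if i ∈ P then c.w i * (1 - f ^ 2) else 0) := by
    intro i
    by_cases h1 : i ∈ P
    · simp [h1]; ring
    · by_cases h2 : i ∈ V <;> simp [h1, h2]
  simp only [e]
  rw [Finset.sum_sub_distrib, c.sumw, Finset.sum_ite_mem, Finset.univ_inter, Finset.sum_mul]

lemma QT (X Y : ℝ) (hX : c.C Finset.univ = c.s * (1 + c.d) / 2 * X)
    (hY : c.S Finset.univ = c.s * (1 - c.d) / 2 * Y) :
    c.s ^ 2 / 2 * ((1 + c.d) * X ^ 2 + (1 - c.d) * Y ^ 2) ≤ 1 := by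
  have h := c.Qb (fun _ => 1) X Y (by simpa [C] using hX) (by simpa [S] using hY)
  simpa [c.sumw] using h

end Cfg

namespace Cfg
variable {ι : Type} [Fintype ι] [DecidableEq ι] (c : Cfg ι)

lemma C_const (P : Finset ι) (θ : ℝ) (h : ∀ i ∈ P, c.t i = θ) : c.C P = (∑ i ∈ P, c.w i) * cos θ := by
  unfold C
  rw [Finset.sum_mul]
  exact Finset.sum_congr rfl fun i hi => by rw [h i hi]
lemma S_const (P : Finset ι) (θ : ℝ) (h : ∀ i ∈ P, c.t i = θ) : c.S P = (∑ i ∈ P, c.w i) * sin θ := by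
  unfold S
  rw [Finset.sum_mul]
  exact Finset.sum_congr rfl fun i hi => by rw [h i hi]

lemma chord_div_aux (d p t : ℝ) (h0 : 0 ≤ t) (htp : t < p) (hp : p < π / 2)
    (h : (1 + d) * (sin t * (cos t - cos p)) ≤ (1 - d) * (cos t * (sin p - sin t))) :
    (1 + d) * (sin t * sin ((p + t) / 2)) ≤ (1 - d) * (cos t * cos ((p + t) / 2)) := by
  have h1 : cos t - cos p = 2 * sin ((p + t) / 2) * sin ((p - t) / 2) := by
    rw [cos_sub_cos, show (t - p) / 2 = - ((p - t) / 2) by ring, sin_neg, add_comm t p]; ring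
  have h2 : sin p - sin t = 2 * sin ((p - t) / 2) * cos ((p + t) / 2) := sin_sub_sin p t
  have h3 : 0 < sin ((p - t) / 2) := sin_pos_of_pos_of_lt_pi (by linarith) (by linarith)
  rw [h1, h2] at h
  have h4 : 2 * sin ((p - t) / 2) * ((1 + d) * (sin t * sin ((p + t) / 2))) ≤
    2 * sin ((p - t) / 2) * ((1 - d) * (cos t * cos ((p + t) / 2))) := by linarith
  exact le_of_mul_le_mul_left h4 (by positivity)

lemma ch2_aux (d p t : ℝ) (h0 : 0 ≤ t) (htp : t < p) (hp : p < π / 2)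
    (h : sin (2 * p) ≤ sin (p + t) + d * sin (p - t)) :
    cos ((3 * p + t) / 2) ≤ d * cos ((p - t) / 2) := by
  have h1 : sin (2 * p) - sin (p + t) = 2 * sin ((p - t) / 2) * cos ((3 * p + t) / 2) := by
    rw [sin_sub_sin]; congr 2 <;> ring_nf
  have h2 : sin (p - t) = 2 * sin ((p - t) / 2) * cos ((p - t) / 2) := by
    rw [← sin_two_mul]; congr 1; ring
  have h3 : 0 < sin ((p - t) / 2) := sin_pos_of_pos_of_lt_pi (by linarith) (by linarith)
  have h4 : 2 * sin ((p - t) / 2) * cos ((3 * p + t) / 2) ≤ 2 * sin ((p - t) / 2) * (d * cos ((p - t) / 2)) := by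
    rw [h2] at h; linarith
  exact le_of_mul_le_mul_left h4 (by positivity)

lemma prod_neg_aux (s d τ σ : ℝ) (hs : 4 / 3 < s ^ 2)
    (q1 : s ^ 2 / 2 * ((1 + d) * cos τ ^ 2 + (1 - d) * (-sin τ) ^ 2) ≤ 1)
    (q2 : s ^ 2 / 2 * ((1 + d) * (2 * cos σ - cos τ) ^ 2 + (1 - d) * (2 * sin σ + sin τ) ^ 2) ≤ 1) :
    (2 * cos (σ + τ) - 1) * (2 * d * cos (σ - τ) - 1) < 0 := by
  have i1 : sin τ ^ 2 = 1 - cos τ ^ 2 := by linarith [sin_sq_add_cos_sq τ]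
  have i2 : sin σ ^ 2 = 1 - cos σ ^ 2 := by linarith [sin_sq_add_cos_sq σ]
  have e : 3 * ((1 + d) * cos τ ^ 2 + (1 - d) * (-sin τ) ^ 2) +
      ((1 + d) * (2 * cos σ - cos τ) ^ 2 + (1 - d) * (2 * sin σ + sin τ) ^ 2) =
      2 * (3 + (2 * cos (σ + τ) - 1) * (2 * d * cos (σ - τ) - 1)) := by
    rw [cos_add, cos_sub]
    linear_combination (4 * (1 - d) + 8 * d * sin σ ^ 2) * i1 + (4 * (1 + d) - 8 * d * cos τ ^ 2) * i2
  by_contra hc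
  push Not at hc
  have h1 : s ^ 2 / 2 * (2 * (3 + (2 * cos (σ + τ) - 1) * (2 * d * cos (σ - τ) - 1))) ≤ 4 := by
    rw [← e]; linarith
  have := mul_nonneg (sq_nonneg s) hc
  linarith

lemma Q1_aux (s d τ : ℝ) (hs : 4 / 3 < s ^ 2)
    (q1 : s ^ 2 / 2 * ((1 + d) * cos τ ^ 2 + (1 - d) * (-sin τ) ^ 2) ≤ 1) : d * cos (2 * τ) < 1 / 2 := by
  have e : (1 + d) * cos τ ^ 2 + (1 - d) * (-sin τ) ^ 2 = 1 + d * cos (2 * τ) := by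
    rw [cos_two_mul]
    linear_combination (1 - d) * sin_sq_add_cos_sq τ
  rw [e] at q1
  by_contra hc
  push Not at hc
  nlinarith

lemma hQ_aux (s d w f X Y cτ sτ q : ℝ) (hs : 0 < s) (hd : 0 < 1 + d) (hd1 : 0 < 1 - d)
    (h : s ^ 2 / 2 * ((1 + d) * (X + f * w * cτ / (s * (1 + d) / 2)) ^ 2 +
      (1 - d) * (Y + f * w * sτ / (s * (1 - d) / 2)) ^ 2) ≤ 1 - q) :
    q + s ^ 2 / 2 * ((1 + d) * X ^ 2 + (1 - d) * Y ^ 2) + 2 * f * s * w * (X * cτ + Y * sτ) ≤ 1 := by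
  obtain ⟨a, ha⟩ : ∃ a, a = f * w * cτ / (s * (1 + d) / 2) := ⟨_, rfl⟩
  obtain ⟨b, hb⟩ : ∃ b, b = f * w * sτ / (s * (1 - d) / 2) := ⟨_, rfl⟩
  rw [← ha, ← hb] at h
  have ha' : a * (s * (1 + d) / 2) = f * w * cτ := by rw [ha]; field_simp
  have hb' : b * (s * (1 - d) / 2) = f * w * sτ := by rw [hb]; field_simp
  have e : s ^ 2 / 2 * ((1 + d) * (X + a) ^ 2 + (1 - d) * (Y + b) ^ 2) =
      s ^ 2 / 2 * ((1 + d) * X ^ 2 + (1 - d) * Y ^ 2) + 2 * f * s * w * (X * cτ + Y * sτ) +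
      s ^ 2 / 2 * ((1 + d) * a ^ 2 + (1 - d) * b ^ 2) := by
    linear_combination (2 * s * X) * ha' + (2 * s * Y) * hb'
  have : 0 ≤ s ^ 2 / 2 * ((1 + d) * a ^ 2 + (1 - d) * b ^ 2) := by positivity
  linarith

lemma caseII (V P : Finset ι) (τ τ' σ : ℝ) (h0 : 0 ≤ τ) (hτ' : τ' < π / 2) (hσ0 : 0 ≤ σ) (hσ : σ < π / 2)
    (hV : ∀ i ∈ V, τ ≤ c.t i ∧ c.t i ≤ τ') (hV' : ∀ i ∉ V, -σ ≤ c.t i ∧ c.t i ≤ 0)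
    (hne : Vᶜ.Nonempty) (hP : P ⊆ V) (hPn : P.Nonempty) (hPt : ∀ i ∈ P, c.t i = τ)
    (hadj : (1 + c.d) * (sin τ * sin τ) ≤ (1 - c.d) * (cos τ * cos τ))
    (hT : c.IsE Finset.univ (-τ)) (hLP : c.IsE (Vᶜ ∪ P) (-τ')) (hHi : c.IsE V σ) : False := by
  have hs0 := c.hs0
  have hd := c.hd
  have hd1 := c.hd1
  have hs := c.hs
  have hττ' : τ ≤ τ' := by
    obtain ⟨i, hi⟩ := hPn
    exact (hV i (hP hi)).1.trans (hV i (hP hi)).2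
  have hCL := c.C_compl V
  have hSL := c.S_compl V
  rw [hT.1, hHi.1, cos_neg] at hCL
  rw [hT.2, hHi.2, sin_neg] at hSL
  have hlam := c.lam_pos
  have hmu := c.mu_pos
  have hτσ : τ < σ := by
    have h1 := c.C_pos _ hne
    rw [hCL] at h1
    have h2 : c.s * (1 + c.d) / 2 * cos σ < c.s * (1 + c.d) / 2 * cos τ := by linarith
    have h3 := lt_of_mul_lt_mul_left h2 hlam.le
    by_contra hc
    push Not at hc
    have := cos_le_cos_of_nonneg_of_le_pi hσ0 (by linarith) hc
    linarith
  have q1 := c.QT (cos τ) (-sin τ) (by rw [hT.1, cos_neg]) (by rw [hT.2, sin_neg])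
  have q2 := c.Qf V ∅ (Finset.empty_subset _) 0 (2 * cos σ - cos τ) (2 * sin σ + sin τ)
    (by rw [hCL, hHi.1]; simp [C]; ring) (by rw [hSL, hHi.2]; simp [S]; ring)
  simp only [Finset.sum_empty, zero_mul, sub_zero] at q2
  have i1 := Q1_aux c.s c.d τ hs q1
  have i2 := prod_neg_aux c.s c.d τ σ hs q1 q2
  have canc : ∀ x y : ℝ, c.s / 2 * x ≤ c.s / 2 * y → x ≤ y := fun x y h =>
    le_of_mul_le_mul_left h (by positivity)
  have i3 : c.d * sin (σ + τ) ≤ sin (σ - τ) := by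
    have h := c.chord_ge V τ (by linarith) (fun i hi => (hV i hi).1)
    rw [hHi.1, hHi.2] at h
    have := canc (sin τ * ((1 + c.d) * cos σ)) (cos τ * ((1 - c.d) * sin σ)) (by linarith)
    rw [sin_add, sin_sub]; linarith
  have i4 : sin (2 * σ) ≤ sin (σ - τ) + c.d * sin (σ + τ) := by
    have h := c.chord_ge Vᶜ (-σ) (by linarith) (fun i hi => (hV' i (Finset.mem_compl.1 hi)).1)
    rw [hCL, hSL, sin_neg, cos_neg] at h
    have := canc ((1 - c.d) * (cos σ * (sin τ + sin σ))) ((1 + c.d) * (sin σ * (cos τ - cos σ))) (by linarith)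
    rw [sin_add, sin_sub, sin_two_mul]; linarith
  have i5 : c.d ≤ cos (2 * τ) := by
    have := sin_sq_add_cos_sq τ
    rw [cos_two_mul']
    nlinarith
  obtain ⟨j1, j2, j3, j4, j5⟩ := caseII_pre τ σ c.d h0 hτσ hσ hd i5 i1 i2 i3 i4
  rcases hττ'.eq_or_lt with heq | hlt
  · have h := c.chord_le V τ (by linarith) (fun i hi => by rw [heq]; exact (hV i hi).2)
    rw [hHi.1, hHi.2] at h
    have := canc (cos τ * ((1 - c.d) * sin σ)) (sin τ * ((1 + c.d) * cos σ)) (by linarith)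
    exact caseII_one τ σ c.d h0 hσ j1 hd j2 j3 (by rw [sin_add, sin_sub]; linarith)
  have hdis : Disjoint Vᶜ P := by
    rw [Finset.disjoint_left]
    intro i hi hi'
    exact (Finset.mem_compl.1 hi) (hP hi')
  have hCP := c.C_const P τ hPt
  have hSP := c.S_const P τ hPt
  obtain ⟨w, hw⟩ : ∃ w, w = ∑ i ∈ P, c.w i := ⟨_, rfl⟩
  have hw0 : 0 < w := by rw [hw]; exact Finset.sum_pos (fun i _ => c.hw i) hPn
  rw [← hw] at hCP hSP
  have hLP1 := hLP.1
  have hLP2 := hLP.2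
  rw [c.C_union _ _ hdis, hCL, hCP, cos_neg] at hLP1
  rw [c.S_union _ _ hdis, hSL, hSP, sin_neg] at hLP2
  have R1 : w * cos τ = c.s * (1 + c.d) / 2 * (cos σ + cos τ' - cos τ) := by linarith
  have R2 : w * sin τ = c.s * (1 - c.d) / 2 * (sin σ - sin τ' + sin τ) := by linarith
  have ch2 : cos ((3 * τ' + τ) / 2) ≤ c.d * cos ((τ' - τ) / 2) := by
    apply ch2_aux c.d τ' τ h0 hlt hτ'
    have h := c.chord_le (V \ P) τ' (by linarith) (fun i hi => (hV i (Finset.mem_sdiff.1 hi).1).2)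
    rw [c.C_sdiff _ _ hP, c.S_sdiff _ _ hP, hHi.1, hHi.2, hCP, hSP, R1, R2] at h
    have := canc ((1 - c.d) * (cos τ' * (sin τ' - sin τ))) ((1 + c.d) * (sin τ' * (cos τ - cos τ'))) (by linarith)
    rw [sin_add, sin_sub, sin_two_mul]; linarith
  have hQ : ∀ f, w * (1 - f ^ 2) + c.s ^ 2 / 2 * ((1 + c.d) * (cos σ - cos τ') ^ 2 +
      (1 - c.d) * (sin σ + sin τ') ^ 2) + 2 * f * c.s * w * ((cos σ - cos τ') * cos τ +
      (sin σ + sin τ') * sin τ) ≤ 1 := by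
    intro f
    apply hQ_aux c.s c.d w f _ _ _ _ _ hs0 (by linarith) (by linarith)
    rw [hw]
    apply c.Qf V P hP f
    · rw [← hw, hCP, hHi.1, hCL, mul_add (c.s * (1 + c.d) / 2), mul_div_cancel₀ _ hlam.ne']
      linear_combination (-1) * R1
    · rw [← hw, hSP, hHi.2, hSL, mul_add (c.s * (1 - c.d) / 2), mul_div_cancel₀ _ hmu.ne']
      linear_combination (-1) * R2
  rcases h0.eq_or_lt with hz | hpos
  · rw [← hz, sin_zero, mul_zero] at R2
    rw [← hz, cos_zero, mul_one] at R1
    have hss : sin σ = sin τ' := by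
      rcases mul_eq_zero.1 R2.symm with h | h
      · exact absurd h hmu.ne'
      · linarith
    have hστ : σ = τ' := injOn_sin ⟨by linarith, by linarith⟩ ⟨by linarith, by linarith⟩ hss
    have hq := hQ 0
    rw [← hστ] at R1 hq ch2
    have hm1 : 1 < 2 * cos σ := by
      have : 0 < c.s * (1 + c.d) / 2 * (cos σ + cos σ - 1) := by rw [← R1]; exact hw0
      have := pos_of_mul_pos_right this hlam.le
      linarith
    have hm2 : 2 * cos σ ≤ 1 + c.d := by
      rw [← hz] at ch2
      have h3 : cos ((3 * σ + 0) / 2) = cos (σ / 2) * (2 * cos σ - 1) := by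
        rw [show (3 * σ + 0) / 2 = 3 * (σ / 2) by ring, cos_three_mul,
          show cos σ = 2 * cos (σ / 2) ^ 2 - 1 by rw [← cos_two_mul]; congr 1; ring]
        ring
      rw [h3, sub_zero, mul_comm c.d] at ch2
      have := le_of_mul_le_mul_left ch2 (cos_pos_of_mem_Ioo ⟨by linarith, by linarith⟩)
      linarith
    refine caseII_zero (2 * cos σ) c.d c.s hs hs0 hd ?_ hm1 hm2 ?_
    · rw [← hz] at i1; simpa using i1
    · have : sin σ ^ 2 = 1 - cos σ ^ 2 := by linarith [sin_sq_add_cos_sq σ]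
      rw [R1] at hq
      have e : (sin σ + sin σ) ^ 2 = 4 * (1 - cos σ ^ 2) := by rw [← this]; ring
      rw [e] at hq
      linarith
  · exact caseII_main τ τ' σ c.d c.s w hpos hlt hτ' hτσ hσ j1 j4 hd i5 i1 hs hs0 hw0 R1 R2 j5 ch2 hQ

lemma caseIII_two' (p q r d : ℝ) (hr : 0 ≤ r) (hrq : r < q) (hqp : q ≤ p) (hp : p < π / 2)
    (hd1 : d < 1) (hD : 1 / 2 < d * cos (p - q))
    (hQ : 2 / 3 * ((1 + d) * (cos p + cos q) ^ 2) < 1)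
    (hb : (1 - d) * (cos q * (sin r + (sin p - sin q))) = (1 + d) * (sin q * (cos p + cos q - cos r)))
    (hch : (1 + d) * (sin r * sin ((q + r) / 2)) ≤ (1 - d) * (cos r * cos ((q + r) / 2))) : False := by
  rcases hr.eq_or_lt with h | h
  · have hd2 : 1 / 2 < d := by
      have h1 := cos_le_one (p - q)
      have h2 : 0 < cos (p - q) := cos_pos_of_mem_Ioo ⟨by linarith, by linarith⟩
      by_contra hc
      push Not at hc
      nlinarith
    rw [← h, sin_zero, cos_zero, zero_add] at hb
    have hpq : sin q ≤ sin p := sin_le_sin_of_le_of_le_pi_div_two (by linarith) (by linarith) (by linarith)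
    have hcq0 : 0 < cos q := cos_pos_of_mem_Ioo ⟨by linarith, by linarith⟩
    have hsq0 : 0 < sin q := sin_pos_of_pos_of_lt_pi (by linarith) (by linarith)
    have h1 : 0 ≤ (1 + d) * sin q * (cos p + cos q - 1) := by
      rw [mul_assoc, ← hb]
      exact mul_nonneg (by linarith) (mul_nonneg hcq0.le (by linarith))
    have h2 := nonneg_of_mul_nonneg_right h1 (by positivity)
    nlinarith
  · exact caseIII_two p q r d h hrq hqp hp hd1 hD hQ hb hch

lemma caseIII (V P P' : Finset ι) (p q τ r : ℝ) (hq0 : 0 < q) (hqp : q ≤ p) (hp : p < π / 2)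
    (hτ0 : 0 ≤ τ) (hr0 : 0 ≤ r)
    (hV : ∀ i ∈ V, τ ≤ c.t i ∧ c.t i ≤ p) (hV' : ∀ i ∈ Vᶜ, -q ≤ c.t i ∧ c.t i ≤ -r)
    (hP : P ⊆ V) (hPn : P.Nonempty) (hPt : ∀ i ∈ P, c.t i = p)
    (hP' : P' ⊆ Vᶜ) (hPn' : P'.Nonempty) (hPt' : ∀ i ∈ P', c.t i = -q)
    (hLo : c.IsE Vᶜ (-p)) (hHi : c.IsE V q)
    (hTP : c.IsE (Finset.univ \ P) (-τ)) (hTP' : c.IsE (Finset.univ \ P') r) : False := by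
  have hs0 := c.hs0
  have hd := c.hd
  have hd1 := c.hd1
  have hs := c.hs
  have hlam := c.lam_pos
  have hmu := c.mu_pos
  have hτp : τ ≤ p := by
    obtain ⟨i, hi⟩ := hPn
    exact (hV i (hP hi)).1.trans (hV i (hP hi)).2
  have hrq : r ≤ q := by
    obtain ⟨i, hi⟩ := hPn'
    have := (hV' i (hP' hi)).1.trans (hV' i (hP' hi)).2
    linarith
  have hCL := c.C_compl V
  have hSL := c.S_compl V
  have hLo1 := hLo.1
  have hLo2 := hLo.2
  have hHi1 := hHi.1
  have hHi2 := hHi.2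
  rw [cos_neg] at hLo1
  rw [sin_neg] at hLo2
  have hCT : c.C Finset.univ = c.s * (1 + c.d) / 2 * (cos p + cos q) := by linarith
  have hST : c.S Finset.univ = c.s * (1 - c.d) / 2 * (sin q - sin p) := by linarith
  have q1 := c.QT _ _ hCT hST
  have q2 := c.Qf V ∅ (Finset.empty_subset _) 0 (cos q - cos p) (sin q + sin p)
    (by rw [hLo1, hHi1]; simp [C]; ring) (by rw [hLo2, hHi2]; simp [S]; ring)
  simp only [Finset.sum_empty, zero_mul, sub_zero] at q2
  obtain ⟨j1, j2⟩ := caseIII_pre p q c.d c.s hq0 hqp hp hd hs q1 q2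
  have canc : ∀ x y : ℝ, c.s / 2 * x ≤ c.s / 2 * y → x ≤ y := fun x y h =>
    le_of_mul_le_mul_left h (by positivity)
  have hCP := c.C_const P p hPt
  have hSP := c.S_const P p hPt
  obtain ⟨w, hw⟩ : ∃ w, w = ∑ i ∈ P, c.w i := ⟨_, rfl⟩
  have hw0 : 0 < w := by rw [hw]; exact Finset.sum_pos (fun i _ => c.hw i) hPn
  rw [← hw] at hCP hSP
  have hCP' := c.C_const P' (-q) hPt'
  have hSP' := c.S_const P' (-q) hPt'
  obtain ⟨w', hw'⟩ : ∃ w', w' = ∑ i ∈ P', c.w i := ⟨_, rfl⟩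
  have hw0' : 0 < w' := by rw [hw']; exact Finset.sum_pos (fun i _ => c.hw i) hPn'
  rw [← hw', cos_neg] at hCP'
  rw [← hw', sin_neg] at hSP'
  have a1 := hTP.1
  have a2 := hTP.2
  have b1 := hTP'.1
  have b2 := hTP'.2
  rw [c.C_sdiff _ _ (Finset.subset_univ _), hCT, hCP, cos_neg] at a1
  rw [c.S_sdiff _ _ (Finset.subset_univ _), hST, hSP, sin_neg] at a2
  rw [c.C_sdiff _ _ (Finset.subset_univ _), hCT, hCP'] at b1
  rw [c.S_sdiff _ _ (Finset.subset_univ _), hST, hSP'] at b2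
  have hcp : 0 < cos p := cos_pos_of_mem_Ioo ⟨by linarith, by linarith⟩
  have hcq : 0 < cos q := cos_pos_of_mem_Ioo ⟨by linarith, by linarith⟩
  rcases hτp.eq_or_lt with heq | hlt
  · have h1 := c.chord_ge V p (by linarith) (fun i hi => by rw [← heq]; exact (hV i hi).1)
    have h2 := c.chord_le V p (by linarith) (fun i hi => (hV i hi).2)
    rw [hHi1, hHi2] at h1 h2
    have k1 := canc ((1 - c.d) * (sin q * cos p)) ((1 + c.d) * (cos q * sin p)) (by linarith)
    have k2 := canc ((1 + c.d) * (cos q * sin p)) ((1 - c.d) * (sin q * cos p)) (by linarith)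
    exact caseIII_a1 p q c.d hq0 hqp hp hd (le_antisymm k1 k2)
  rcases hrq.eq_or_lt with heq | hlt'
  · have h1 := c.chord_ge Vᶜ (-q) (by linarith) (fun i hi => (hV' i hi).1)
    have h2 := c.chord_le Vᶜ (-q) (by linarith) (fun i hi => by rw [← heq]; exact (hV' i hi).2)
    rw [hLo1, hLo2, cos_neg, sin_neg] at h1 h2
    have k1 := canc ((1 - c.d) * (sin p * cos q)) ((1 + c.d) * (cos p * sin q)) (by linarith)
    have k2 := canc ((1 + c.d) * (cos p * sin q)) ((1 - c.d) * (sin p * cos q)) (by linarith)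
    refine caseIII_one p q c.d τ hq0 hqp hp hd hd1 hτ0 hlt j1 j2 (le_antisymm k1 k2) ?_ ?_
    · have h3 : c.s * (1 + c.d) / 2 * cos τ < c.s * (1 + c.d) / 2 * (cos q + cos p) := by
        have := mul_pos hw0 hcp
        linarith
      exact lt_of_mul_lt_mul_left h3 hlam.le
    · apply chord_div_aux c.d p τ hτ0 hlt hp
      have h := c.chord_ge (V \ P) τ (by linarith) (fun i hi => (hV i (Finset.mem_sdiff.1 hi).1).1)
      rw [c.C_sdiff _ _ hP, c.S_sdiff _ _ hP, hHi1, hHi2, hCP, hSP] at h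
      have e1 : c.s * (1 + c.d) / 2 * cos q - w * cos p = c.s * (1 + c.d) / 2 * (cos τ - cos p) := by linarith
      have e2 : c.s * (1 - c.d) / 2 * sin q - w * sin p = c.s * (1 - c.d) / 2 * (sin p - sin τ) := by linarith
      rw [e1, e2] at h
      exact canc _ _ (by linarith)
  · refine caseIII_two' p q r c.d hr0 hlt' hqp hp hd1 j2 ?_ ?_ ?_
    · have h1 : 0 < (1 + c.d) * (cos p + cos q) ^ 2 := by positivity
      have h2 : 0 ≤ (1 - c.d) * (sin q - sin p) ^ 2 := mul_nonneg (by linarith) (sq_nonneg _)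
      have h3 := mul_lt_mul_of_pos_right hs h1
      have h4 := mul_nonneg (sq_nonneg c.s) h2
      linarith
    · have e1 : w' * cos q = c.s / 2 * ((1 + c.d) * (cos p + cos q - cos r)) := by linarith
      have e2 : w' * sin q = c.s / 2 * ((1 - c.d) * (sin r + (sin p - sin q))) := by linarith
      have : c.s / 2 * ((1 - c.d) * (cos q * (sin r + (sin p - sin q)))) =
          c.s / 2 * ((1 + c.d) * (sin q * (cos p + cos q - cos r))) := by
        linear_combination sin q * e1 - cos q * e2
      exact mul_left_cancel₀ (by positivity) this
    · apply chord_div_aux c.d q r hr0 hlt' (by linarith)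
      have h := c.chord_le (Vᶜ \ P') (-r) (by linarith) (fun i hi => (hV' i (Finset.mem_sdiff.1 hi).1).2)
      rw [c.C_sdiff _ _ hP', c.S_sdiff _ _ hP', hLo1, hLo2, hCP', hSP', cos_neg, sin_neg] at h
      have e1 : c.s * (1 + c.d) / 2 * cos p - w' * cos q = c.s * (1 + c.d) / 2 * (cos r - cos q) := by linarith
      have e2 : c.s * (1 - c.d) / 2 * -sin p - w' * -sin q = c.s * (1 - c.d) / 2 * (sin r - sin q) := by linarith
      rw [e1, e2] at h
      exact canc _ _ (by linarith)

theorem contra {ι : Type} [Fintype ι] [DecidableEq ι] (c : Cfg ι) : False := by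
  obtain ⟨V, hV⟩ : ∃ V : Finset ι, V = Finset.univ.filter (fun i => 0 ≤ c.t i) := ⟨_, rfl⟩
  have hV1 : ∀ i ∈ V, 0 ≤ c.t i := fun i hi => by rw [hV] at hi; simpa using hi
  have hV2 : ∀ i ∉ V, c.t i < 0 := fun i hi => by rw [hV] at hi; simpa using hi
  obtain ⟨ip, hip⟩ := c.exists_pos
  obtain ⟨im, him⟩ := c.exists_neg
  have hVn : V.Nonempty := ⟨ip, by rw [hV]; simp [hip.le]⟩
  have hVcn : Vᶜ.Nonempty := ⟨im, by rw [hV]; simp [him]⟩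
  obtain ⟨m, hm, M, hM, hmM, hab⟩ := c.dich V hVn hV1 (fun i hi => (hV2 i hi).le)
  obtain ⟨m', hm', M', hM', hmM', hab'⟩ := c.neg.dich Vᶜ hVcn
    (fun i hi => by
      show 0 ≤ - c.t i
      have := hV2 i (Finset.mem_compl.1 hi); linarith)
    (fun i hi => by
      show - c.t i ≤ 0
      have := hV1 i (by simpa using hi); linarith)
  have hnt : ∀ i, c.neg.t i = - c.t i := fun i => rfl
  simp only [hnt, neg_neg, neg_inj, compl_compl] at hmM' hab'
  have tm0 := hV1 m hm
  have tm0' := hV2 m' (Finset.mem_compl.1 hm')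
  have tM0 := hV1 M hM
  have tM0' := hV2 M' (Finset.mem_compl.1 hM')
  have fm : ∀ (U : Finset ι) (k : ι), k ∈ U → (U.filter (fun i => c.t i = c.t k)).Nonempty :=
    fun U k hk => ⟨k, by simp [hk]⟩
  rcases hab with ⟨x1, x2, x3⟩ | ⟨x1, x2, x3⟩
  · rcases hab' with ⟨y1, y2, y3⟩ | ⟨y1, y2, y3⟩
    · rw [c.neg_IsE] at y2
      have e2 := x2.2
      rw [y2.2] at e2
      have e3 := mul_left_cancel₀ c.mu_pos.ne' e2
      have := injOn_sin (x₁ := - c.t m') ⟨by linarith [pi_pos], by linarith [c.htl m']⟩ ⟨by linarith [c.htr m], by linarith [c.htl m]⟩ e3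
      linarith
    · rw [c.neg_IsE] at y2
      refine c.caseII V _ (c.t m) (c.t M) (- c.t M') tm0 (c.htr M) y1.le (by linarith [c.htl M']) hmM ?_ hVcn
        (Finset.filter_subset _ _) (fm V m hm) (fun i hi => (Finset.mem_filter.1 hi).2) ((c.hN m m).1 x1) x2 x3 y2
      intro i hi
      have := hmM' i (Finset.mem_compl.2 hi)
      exact ⟨by linarith, (hV2 i hi).le⟩
  · rcases hab' with ⟨y1, y2, y3⟩ | ⟨y1, y2, y3⟩
    · refine c.neg.caseII Vᶜ _ (- c.t m') (- c.t M') (c.t M) (by linarith) (by linarith [c.htl M']) x1.le (c.htr M)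
        hmM' ?_ (by rw [compl_compl]; exact hVn)
        (Finset.filter_subset _ _) (fm Vᶜ m' hm') (fun i hi => ?_) ((c.neg.hN m' m').1 y1) ?_ ?_ ?_
      · intro i hi
        have h1 : i ∈ V := by simpa using hi
        have := hmM i h1
        rw [hnt]
        exact ⟨by linarith, by linarith [hV1 i h1]⟩
      · rw [hnt, (Finset.mem_filter.1 hi).2]
      · rw [neg_neg]; exact y2
      · rw [neg_neg, compl_compl]; exact y3
      · rw [c.neg_IsE]; exact x2
    · have y2' := (c.neg_IsE _ _).1 y2
      have y3' := (c.neg_IsE _ _).1 y3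
      rcases le_total (- c.t M') (c.t M) with hle | hle
      · refine c.caseIII V _ _ (c.t M) (- c.t M') (c.t m) (- c.t m') y1 hle (c.htr M) tm0 (by linarith) hmM ?_
          (Finset.filter_subset _ _) (fm V M hM) (fun i hi => (Finset.mem_filter.1 hi).2)
          (Finset.filter_subset _ _) (fm Vᶜ M' hM') (fun i hi => ?_) x2 y2' x3 y3'
        · intro i hi
          have := hmM' i hi
          exact ⟨by linarith, by linarith⟩
        · rw [neg_neg]; exact (Finset.mem_filter.1 hi).2
      · refine c.neg.caseIII Vᶜ _ _ (- c.t M') (c.t M) (- c.t m') (c.t m) x1 hle (by linarith [c.htl M'])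
          (by linarith) tm0 hmM' ?_
          (Finset.filter_subset _ _) (fm Vᶜ M' hM') (fun i hi => ?_)
          (by rw [compl_compl]; exact Finset.filter_subset _ _) (fm V M hM) (fun i hi => ?_) ?_ ?_ ?_ ?_
        · intro i hi
          rw [compl_compl] at hi
          have := hmM i hi
          rw [hnt]
          exact ⟨by linarith, by linarith⟩
        · rw [hnt, (Finset.mem_filter.1 hi).2]
        · rw [hnt, (Finset.mem_filter.1 hi).2]
        · rw [neg_neg, compl_compl]; exact y2
        · rw [c.neg_IsE]; exact x2
        · rw [neg_neg]; exact y3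
        · rw [c.neg_IsE]; exact x3

end Cfg

lemma eig_of_max {ι : Type} [Fintype ι] (M : ι → ι → ℝ) (hM : ∀ i j, M i j = M j i) (k : ℝ)
    (v : ι → ℝ) (hv : ∑ i, v i ^ 2 = 1) (heq : ∑ i, ∑ j, M i j * (v i * v j) = k)
    (hle : ∀ u : ι → ℝ, ∑ i, u i ^ 2 = 1 → ∑ i, ∑ j, M i j * (u i * u j) ≤ k) :
    ∀ i, ∑ j, M i j * v j = k * v i := by
  have hom : ∀ u : ι → ℝ, ∑ i, ∑ j, M i j * (u i * u j) ≤ k * ∑ i, u i ^ 2 := by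
    intro u
    obtain ⟨q, hq⟩ : ∃ q, q = ∑ i, u i ^ 2 := ⟨_, rfl⟩
    have hq0 : 0 ≤ q := by rw [hq]; exact Finset.sum_nonneg fun i _ => sq_nonneg _
    rcases hq0.eq_or_lt with h | h
    · have hz : ∀ i, u i = 0 := by
        intro i
        rw [hq] at h
        have := (Finset.sum_eq_zero_iff_of_nonneg (fun i _ => sq_nonneg (u i))).1 h.symm i (Finset.mem_univ i)
        exact pow_eq_zero_iff (two_ne_zero) |>.1 this
      simp [hz]
    · have hs : √q ^ 2 = q := sq_sqrt hq0
      have hs0 : 0 < √q := sqrt_pos.2 h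
      have := hle (fun i => u i / √q) (by
        simp only [div_pow, hs]
        rw [← Finset.sum_div, ← hq, div_self h.ne'])
      have e : ∑ i, ∑ j, M i j * (u i / √q * (u j / √q)) = (∑ i, ∑ j, M i j * (u i * u j)) / q := by
        rw [Finset.sum_div]
        refine Finset.sum_congr rfl fun i _ => ?_
        rw [Finset.sum_div]
        refine Finset.sum_congr rfl fun j _ => ?_
        rw [div_mul_div_comm, ← sq, hs]; ring
      rw [e, div_le_iff₀ h, hq] at this
      exact this
  obtain ⟨r, hr⟩ : ∃ r : ι → ℝ, r = fun i => ∑ j, M i j * v j - k * v i := ⟨_, rfl⟩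
  have expand : ∀ ε : ℝ, ∑ i, ∑ j, M i j * ((v i + ε * r i) * (v j + ε * r j)) =
      k + 2 * ε * ∑ i, r i * ∑ j, M i j * v j + ε ^ 2 * ∑ i, ∑ j, M i j * (r i * r j) := by
    intro ε
    have e1 : ∑ i, ∑ j, M i j * ((v i + ε * r i) * (v j + ε * r j)) =
        ∑ i, ∑ j, M i j * (v i * v j) + ε * (∑ i, ∑ j, M i j * (r i * v j)) +
        ε * (∑ i, ∑ j, M i j * (v i * r j)) + ε ^ 2 * ∑ i, ∑ j, M i j * (r i * r j) := by
      simp only [Finset.mul_sum, ← Finset.sum_add_distrib]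
      refine Finset.sum_congr rfl fun i _ => Finset.sum_congr rfl fun j _ => ?_
      ring
    have e2 : ∑ i, ∑ j, M i j * (v i * r j) = ∑ i, ∑ j, M i j * (r i * v j) := by
      rw [Finset.sum_comm]
      refine Finset.sum_congr rfl fun i _ => Finset.sum_congr rfl fun j _ => ?_
      rw [hM j i]; ring
    have e3 : ∑ i, ∑ j, M i j * (r i * v j) = ∑ i, r i * ∑ j, M i j * v j := by
      refine Finset.sum_congr rfl fun i _ => ?_
      rw [Finset.mul_sum]
      exact Finset.sum_congr rfl fun j _ => by ring
    rw [e1, e2, e3, heq]; ring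
  have expand2 : ∀ ε : ℝ, ∑ i, (v i + ε * r i) ^ 2 = 1 + 2 * ε * ∑ i, r i * v i + ε ^ 2 * ∑ i, r i ^ 2 := by
    intro ε
    rw [← hv]
    simp only [Finset.mul_sum, ← Finset.sum_add_distrib]
    refine Finset.sum_congr rfl fun i _ => ?_
    ring
  have hR : ∑ i, r i * ∑ j, M i j * v j - k * ∑ i, r i * v i = ∑ i, r i ^ 2 := by
    rw [Finset.mul_sum, ← Finset.sum_sub_distrib]
    refine Finset.sum_congr rfl fun i _ => ?_
    have : r i = ∑ j, M i j * v j - k * v i := by rw [hr]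
    rw [sq, this]; ring
  obtain ⟨R, hRd⟩ : ∃ R, R = ∑ i, r i ^ 2 := ⟨_, rfl⟩
  obtain ⟨L, hL⟩ : ∃ L, L = ∑ i, ∑ j, M i j * (r i * r j) - k * ∑ i, r i ^ 2 := ⟨_, rfl⟩
  have hmain : ∀ ε : ℝ, 2 * ε * R + ε ^ 2 * L ≤ 0 := by
    intro ε
    have h := hom (fun i => v i + ε * r i)
    rw [expand, expand2] at h
    rw [hRd, ← hR, hL]
    linarith
  have hR0 : 0 ≤ R := by rw [hRd]; exact Finset.sum_nonneg fun i _ => sq_nonneg _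
  have hRz : R = 0 := by
    by_contra hne
    have hRp : 0 < R := lt_of_le_of_ne hR0 (Ne.symm hne)
    have h := hmain (R / (|L| + 1))
    have hL1 : 0 < |L| + 1 := by positivity
    obtain ⟨ε, hε⟩ : ∃ ε, ε = R / (|L| + 1) := ⟨_, rfl⟩
    have hε0 : 0 < ε := by rw [hε]; positivity
    have hε1 : ε * (|L| + 1) = R := by rw [hε]; field_simp
    rw [← hε] at h
    have h2 : ε * (2 * R + ε * L) ≤ 0 := by linarith
    have h3 : 2 * R + ε * L ≤ 0 := by
      by_contra hc
      push Not at hc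
      have := mul_pos hε0 hc
      linarith
    have h4 := mul_le_mul_of_nonneg_left (neg_abs_le L) hε0.le
    linarith
  intro i
  rw [hRd] at hRz
  have := (Finset.sum_eq_zero_iff_of_nonneg (fun i _ => sq_nonneg (r i))).1 hRz i (Finset.mem_univ i)
  have h2 : r i = 0 := pow_eq_zero_iff (two_ne_zero) |>.1 this
  rw [hr] at h2
  simp only at h2
  linarith

/-- the relaxed functional -/
noncomputable def Psi {ι : Type} [Fintype ι] (p : (ι → ℝ) × (ι → ℝ) × (ι → ℝ)) : ℝ :=
  ∑ i, ∑ j, p.1 i * p.1 j * max (p.2.1 i * p.2.1 j - p.2.2 i * p.2.2 j) 0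

/-- product of spheres -/
def Ksph (ι : Type) [Fintype ι] : Set ((ι → ℝ) × (ι → ℝ) × (ι → ℝ)) :=
  {p | ∑ i, p.1 i ^ 2 = 1 ∧ ∑ i, p.2.1 i ^ 2 = 1 ∧ ∑ i, p.2.2 i ^ 2 = 1}

lemma Ksph_compact (ι : Type) [Fintype ι] : IsCompact (Ksph ι) := by
  have hc : IsClosed (Ksph ι) := by
    apply IsClosed.inter
    · exact isClosed_eq (by fun_prop) (by fun_prop)
    apply IsClosed.inter
    · exact isClosed_eq (by fun_prop) (by fun_prop)
    · exact isClosed_eq (by fun_prop) (by fun_prop)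
  refine IsCompact.of_isClosed_subset (isCompact_Icc (a := ((fun _ => -1, fun _ => -1, fun _ => -1) :
    (ι → ℝ) × (ι → ℝ) × (ι → ℝ))) (b := (fun _ => 1, fun _ => 1, fun _ => 1))) hc ?_
  have key : ∀ v : ι → ℝ, ∑ i, v i ^ 2 = 1 → ∀ i, -1 ≤ v i ∧ v i ≤ 1 := by
    intro v hv i
    have h := Finset.single_le_sum (fun j _ => sq_nonneg (v j)) (Finset.mem_univ i)
    rw [hv] at h
    constructor <;> nlinarith
  rintro ⟨a, b, c⟩ ⟨h1, h2, h3⟩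
  exact ⟨⟨fun i => (key a h1 i).1, fun i => (key b h2 i).1, fun i => (key c h3 i).1⟩,
    ⟨fun i => (key a h1 i).2, fun i => (key b h2 i).2, fun i => (key c h3 i).2⟩⟩

lemma Psi_cont (ι : Type) [Fintype ι] : Continuous (Psi (ι := ι)) := by
  unfold Psi
  fun_prop

lemma cs_aux {ι : Type} [Fintype ι] (ω x : ι → ℝ) (A : ι → ι → ℝ) (hA : ∀ i j, |A i j| ≤ 1)
    (hω : ∑ i, ω i ^ 2 = 1) (hx : ∑ i, x i ^ 2 = 1) :
    |∑ i, ∑ j, A i j * (ω i * ω j) * (x i * x j)| ≤ 1 := by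
  have h1 : |∑ i, ∑ j, A i j * (ω i * ω j) * (x i * x j)| ≤ ∑ i, ∑ j, |ω i * x i| * |ω j * x j| := by
    refine (Finset.abs_sum_le_sum_abs _ _).trans (Finset.sum_le_sum fun i _ => ?_)
    refine (Finset.abs_sum_le_sum_abs _ _).trans (Finset.sum_le_sum fun j _ => ?_)
    rw [show A i j * (ω i * ω j) * (x i * x j) = A i j * ((ω i * x i) * (ω j * x j)) by ring,
      abs_mul, ← abs_mul (ω i * x i)]
    exact mul_le_of_le_one_left (abs_nonneg _) (hA i j)
  refine h1.trans ?_
  rw [← Finset.sum_mul_sum, ← sq]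
  have h2 := Finset.sum_mul_sq_le_sq_mul_sq Finset.univ (fun i => |ω i|) (fun i => |x i|)
  simp only [sq_abs, hω, hx, ← abs_mul] at h2
  simpa using h2

lemma sum_sub {ι : Type} [Fintype ι] (p : ι → Prop) [DecidablePred p] (g : ι → ℝ) (h : ∀ i, ¬ p i → g i = 0) :
    ∑ i : {i // p i}, g i = ∑ i, g i := by
  rw [← Fintype.sum_subtype_add_sum_subtype p g]
  have : ∑ i : {i // ¬ p i}, g i = 0 := Finset.sum_eq_zero fun i _ => h i i.2
  rw [this, add_zero]

set_option maxHeartbeats 2000000 in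
/-- stationarity data gives a configuration, hence a contradiction -/
lemma stat_contra {ι : Type} [Fintype ι] (ω x y : ι → ℝ) (lam mu s : ℝ)
    (hω0 : ∀ i, 0 ≤ ω i) (hx0 : ∀ i, 0 ≤ x i)
    (hω : ∑ i, ω i ^ 2 = 1) (hx : ∑ i, x i ^ 2 = 1) (hy : ∑ i, y i ^ 2 = 1)
    (A : ι → ι → ℝ) (hA : ∀ i j, A i j = if 0 ≤ x i * x j - y i * y j then 1 else 0)
    (hs : 4 / 3 < s ^ 2) (hs0 : 0 < s) (hsum : lam + mu = s) (hlam1 : lam ≤ 1) (hmu1 : mu ≤ 1)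
    (ex : ∀ i, ∑ j, A i j * (ω i * ω j) * x j = lam * x i)
    (ey : ∀ i, ∑ j, A i j * (ω i * ω j) * y j = - mu * y i)
    (eω : ∀ i, lam * x i ^ 2 + mu * y i ^ 2 = s * ω i ^ 2)
    (hww : ∑ i, ∑ j, A i j * (ω i * ω j) * (ω i * ω j) ≤ lam) : False := by
  classical
  have hAs : ∀ i j, A i j = A j i := by
    intro i j
    rw [hA, hA, mul_comm (x i), mul_comm (y i)]
  have hs1 : 1 < s := by nlinarith
  have hlam : 0 < lam := by linarith
  have hmu : 0 < mu := by linarith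
  have hxy : ∑ i, x i * y i = 0 := by
    have e1 : ∑ i, y i * ∑ j, A i j * (ω i * ω j) * x j = lam * ∑ i, x i * y i := by
      rw [Finset.mul_sum]
      refine Finset.sum_congr rfl fun i _ => ?_
      rw [ex]; ring
    have e2 : ∑ i, x i * ∑ j, A i j * (ω i * ω j) * y j = - mu * ∑ i, x i * y i := by
      rw [Finset.mul_sum]
      refine Finset.sum_congr rfl fun i _ => ?_
      rw [ey]; ring
    have e3 : ∑ i, y i * ∑ j, A i j * (ω i * ω j) * x j = ∑ i, x i * ∑ j, A i j * (ω i * ω j) * y j := by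
      simp only [Finset.mul_sum]
      rw [Finset.sum_comm]
      refine Finset.sum_congr rfl fun i _ => Finset.sum_congr rfl fun j _ => ?_
      rw [hAs j i]; ring
    have : s * ∑ i, x i * y i = 0 := by rw [← hsum]; linarith
    rcases mul_eq_zero.1 this with h | h
    · exact absurd h hs0.ne'
    · exact h
  have xBx : ∑ i, ∑ j, A i j * (ω i * ω j) * (x i * x j) = lam := by
    rw [← mul_one lam, ← hx, Finset.mul_sum]
    refine Finset.sum_congr rfl fun i _ => ?_
    rw [sq, ← mul_assoc, ← ex i, Finset.sum_mul]
    exact Finset.sum_congr rfl fun j _ => by ring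
  have yBy : ∑ i, ∑ j, A i j * (ω i * ω j) * (y i * y j) = - mu := by
    rw [← mul_one (-mu), ← hy, Finset.mul_sum]
    refine Finset.sum_congr rfl fun i _ => ?_
    rw [sq, ← mul_assoc, ← ey i, Finset.sum_mul]
    exact Finset.sum_congr rfl fun j _ => by ring
  have hfro : lam ^ 2 + mu ^ 2 ≤ lam := by
    have h0 : 0 ≤ ∑ i, ∑ j, (A i j * (ω i * ω j) - lam * (x i * x j) + mu * (y i * y j)) ^ 2 :=
      Finset.sum_nonneg fun i _ => Finset.sum_nonneg fun j _ => sq_nonneg _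
    have e : ∑ i, ∑ j, (A i j * (ω i * ω j) - lam * (x i * x j) + mu * (y i * y j)) ^ 2 =
        ∑ i, ∑ j, A i j * (ω i * ω j) * (ω i * ω j)
        - 2 * lam * ∑ i, ∑ j, A i j * (ω i * ω j) * (x i * x j)
        + 2 * mu * ∑ i, ∑ j, A i j * (ω i * ω j) * (y i * y j)
        + lam ^ 2 * ((∑ i, x i ^ 2) * (∑ j, x j ^ 2))
        + mu ^ 2 * ((∑ i, y i ^ 2) * (∑ j, y j ^ 2))
        - 2 * lam * mu * ((∑ i, x i * y i) * (∑ j, x j * y j)) := by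
      rw [Finset.sum_mul_sum, Finset.sum_mul_sum, Finset.sum_mul_sum]
      simp only [Finset.mul_sum, ← Finset.sum_add_distrib, ← Finset.sum_sub_distrib]
      refine Finset.sum_congr rfl fun i _ => Finset.sum_congr rfl fun j _ => ?_
      have : A i j ^ 2 = A i j := by rw [hA]; split_ifs <;> norm_num
      linear_combination (ω i * ω j) ^ 2 * this
    rw [e, xBx, yBy, hx, hy, hxy] at h0
    linarith
  have hlm : mu < lam := by
    by_contra hc
    push Not at hc
    have : lam ≤ 1 / 2 := by nlinarith
    nlinarith [sq_nonneg (lam - mu)]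
  have hzero : ∀ i, ¬ 0 < ω i → ω i = 0 ∧ x i = 0 ∧ y i = 0 := by
    intro i hi
    have h1 : ω i = 0 := le_antisymm (not_lt.1 hi) (hω0 i)
    have h2 := eω i
    rw [h1] at h2
    have h3 := mul_nonneg hlam.le (sq_nonneg (x i))
    have h4 := mul_nonneg hmu.le (sq_nonneg (y i))
    have h5 : lam * x i ^ 2 = 0 := by linarith
    have h6 : mu * y i ^ 2 = 0 := by linarith
    refine ⟨h1, ?_, ?_⟩
    · rcases mul_eq_zero.1 h5 with h | h
      · exact absurd h hlam.ne'
      · exact pow_eq_zero_iff (two_ne_zero) |>.1 h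
    · rcases mul_eq_zero.1 h6 with h | h
      · exact absurd h hmu.ne'
      · exact pow_eq_zero_iff (two_ne_zero) |>.1 h
  have hxpos : ∀ i, 0 < ω i → 0 < x i := by
    intro j hj
    by_contra hc
    have hxj : x j = 0 := le_antisymm (not_lt.1 hc) (hx0 j)
    have h1 := ex j
    rw [hxj, mul_zero] at h1
    have hA0 : ∀ i j, 0 ≤ A i j := by
      intro i j; rw [hA]; split_ifs <;> norm_num
    have h2 := (Finset.sum_eq_zero_iff_of_nonneg (fun l _ => mul_nonneg (mul_nonneg (hA0 j l)
      (mul_nonneg (hω0 j) (hω0 l))) (hx0 l))).1 h1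
    have h3 : ∀ l, 0 < x l → 0 < y j * y l := by
      intro l hl
      have hωl : 0 < ω l := by
        by_contra hcl
        have := (hzero l hcl).2.1
        linarith
      have h4 := h2 l (Finset.mem_univ l)
      have h5 : A j l = 0 := by
        have : 0 < ω j * ω l * x l := by positivity
        rw [mul_assoc] at h4
        rcases mul_eq_zero.1 h4 with h | h
        · exact h
        · exact absurd h this.ne'
      rw [hA, hxj] at h5
      by_contra hcl
      rw [if_pos (by linarith)] at h5
      norm_num at h5
    have hex : ∃ l, 0 < x l := by
      by_contra hcl
      push Not at hcl
      have : ∀ l, x l = 0 := fun l => le_antisymm (hcl l) (hx0 l)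
      simp [this] at hx
    obtain ⟨l0, hl0⟩ := hex
    have h6 : 0 < ∑ l, x l * (y j * y l) := by
      apply Finset.sum_pos' (fun l _ => ?_) ⟨l0, Finset.mem_univ _, mul_pos hl0 (h3 l0 hl0)⟩
      rcases (hx0 l).eq_or_lt with h | h
      · rw [← h, zero_mul]
      · exact (mul_pos h (h3 l h)).le
    have h7 : ∑ l, x l * (y j * y l) = y j * ∑ l, x l * y l := by
      rw [Finset.mul_sum]; exact Finset.sum_congr rfl fun l _ => by ring
    rw [h7, hxy, mul_zero] at h6
    exact lt_irrefl _ h6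
  -- angles
  obtain ⟨d, hd⟩ : ∃ d, d = (lam - mu) / s := ⟨_, rfl⟩
  have hds : d * s = lam - mu := by rw [hd]; field_simp
  have hlam' : s * (1 + d) / 2 = lam := by linarith
  have hmu' : s * (1 - d) / 2 = mu := by linarith
  have hd0 : 0 < d := by rw [hd]; exact div_pos (by linarith) hs0
  have hd1 : d < 1 := by rw [hd, div_lt_one hs0]; linarith
  obtain ⟨α, hα⟩ : ∃ α, α = √((1 + d) / 2) := ⟨_, rfl⟩
  obtain ⟨β, hβ⟩ : ∃ β, β = √((1 - d) / 2) := ⟨_, rfl⟩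
  have hα2 : α ^ 2 = (1 + d) / 2 := by rw [hα]; exact sq_sqrt (by linarith)
  have hβ2 : β ^ 2 = (1 - d) / 2 := by rw [hβ]; exact sq_sqrt (by linarith)
  have hα0 : 0 < α := by rw [hα]; exact sqrt_pos.2 (by linarith)
  have hβ0 : 0 < β := by rw [hβ]; exact sqrt_pos.2 (by linarith)
  have hnorm : ∀ i, 0 < ω i → (α * x i / ω i) ^ 2 + (β * y i / ω i) ^ 2 = 1 := by
    intro i hi
    have h := eω i
    rw [← hlam', ← hmu'] at h
    have h' : s * (α ^ 2 * x i ^ 2 + β ^ 2 * y i ^ 2) = s * ω i ^ 2 := by rw [hα2, hβ2]; linarith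
    have h'' := mul_left_cancel₀ hs0.ne' h'
    rw [div_pow, div_pow, ← add_div, mul_pow, mul_pow, h'', div_self (by positivity)]
  have hcospos : ∀ i, 0 < ω i → 0 < α * x i / ω i := fun i hi =>
    div_pos (mul_pos hα0 (hxpos i hi)) hi
  have hlt : ∀ i, 0 < ω i → -1 < β * y i / ω i ∧ β * y i / ω i < 1 := by
    intro i hi
    have h1 := hnorm i hi
    have h2 := pow_pos (hcospos i hi) 2
    constructor <;> nlinarith
  have hsin : ∀ i, 0 < ω i → sin (arcsin (β * y i / ω i)) = β * y i / ω i := fun i hi =>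
    sin_arcsin (hlt i hi).1.le (hlt i hi).2.le
  have hcos : ∀ i, 0 < ω i → cos (arcsin (β * y i / ω i)) = α * x i / ω i := by
    intro i hi
    rw [cos_arcsin, ← sqrt_sq (hcospos i hi).le]
    congr 1
    linarith [hnorm i hi]
  refine Cfg.contra (ι := {i // 0 < ω i})
    { w := fun i => ω i ^ 2
      t := fun i => arcsin (β * y i / ω i)
      s := s
      d := d
      hw := fun i => pow_pos i.2 2
      htl := fun i => neg_pi_div_two_lt_arcsin.2 (hlt i i.2).1
      htr := fun i => arcsin_lt_pi_div_two.2 (hlt i i.2).2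
      hs := hs
      hs0 := hs0
      hd := hd0
      hd1 := hd1
      sumw := ?_
      sumc := ?_
      sums := ?_
      sumsc := ?_
      N := fun i => Finset.univ.filter (fun j => 0 ≤ x i * x j - y i * y j)
      hN := ?_
      eqc := ?_
      eqs := ?_ }
  · rw [sum_sub (fun i => 0 < ω i) (fun i => ω i ^ 2) (fun i hi => by simp [(hzero i hi).1])]
    exact hω
  · have : ∀ i : {i // 0 < ω i}, ω i ^ 2 * cos (arcsin (β * y i / ω i)) ^ 2 = α ^ 2 * x i ^ 2 := by
      intro i
      have := i.2.ne'
      rw [hcos i i.2]; field_simp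
    simp only [this]
    rw [sum_sub (fun i => 0 < ω i) (fun i => α ^ 2 * x i ^ 2) (fun i hi => by simp [(hzero i hi).2.1]),
      ← Finset.mul_sum, hx, hα2, mul_one]
  · have : ∀ i : {i // 0 < ω i}, ω i ^ 2 * sin (arcsin (β * y i / ω i)) ^ 2 = β ^ 2 * y i ^ 2 := by
      intro i
      have := i.2.ne'
      rw [hsin i i.2]; field_simp
    simp only [this]
    rw [sum_sub (fun i => 0 < ω i) (fun i => β ^ 2 * y i ^ 2) (fun i hi => by simp [(hzero i hi).2.2]),
      ← Finset.mul_sum, hy, hβ2, mul_one]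
  · have : ∀ i : {i // 0 < ω i}, ω i ^ 2 * (sin (arcsin (β * y i / ω i)) * cos (arcsin (β * y i / ω i)))
        = (α * β) * (x i * y i) := by
      intro i
      have := i.2.ne'
      rw [hsin i i.2, hcos i i.2]; field_simp
    simp only [this]
    rw [sum_sub (fun i => 0 < ω i) (fun i => (α * β) * (x i * y i)) (fun i hi => by simp [(hzero i hi).2.2]),
      ← Finset.mul_sum, hxy, mul_zero]
  · intro i j
    rw [Finset.mem_filter, hsin i i.2, hsin j j.2, hcos i i.2, hcos j j.2]
    simp only [Finset.mem_univ, true_and]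
    have e1 : (1 + d) * (β * y i / ω i * (β * y j / ω j)) =
        2 * α ^ 2 * β ^ 2 / (ω i * ω j) * (y i * y j) := by
      rw [hα2]; field_simp
    have e2 : (1 - d) * (α * x i / ω i * (α * x j / ω j)) =
        2 * α ^ 2 * β ^ 2 / (ω i * ω j) * (x i * x j) := by
      rw [hβ2]; field_simp
    rw [e1, e2, sub_nonneg]
    have hi := i.2
    have hj := j.2
    have : 0 < 2 * α ^ 2 * β ^ 2 / (ω i * ω j) := by positivity
    exact (mul_le_mul_iff_right₀ this).symm
  · intro i
    have hi := i.2.ne'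
    have e : ∀ j : {i // 0 < ω i}, ω j ^ 2 * cos (arcsin (β * y j / ω j)) = α * (ω j * x j) := by
      intro j
      have := j.2.ne'
      rw [hcos j j.2]; field_simp
    simp only [e]
    rw [Finset.sum_filter, sum_sub (fun i => 0 < ω i)
      (fun j => if 0 ≤ x i * x j - y i * y j then α * (ω j * x j) else 0)
      (fun j hj => by simp [(hzero j hj).1]), hcos i i.2, hlam']
    have e2 : lam * (α * x i / ω i) = α / ω i * (lam * x i) := by ring
    rw [e2, ← ex i, Finset.mul_sum]
    refine Finset.sum_congr rfl fun j _ => ?_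
    rw [hA]
    split_ifs
    · field_simp
    · simp
  · intro i
    have hi := i.2.ne'
    have e : ∀ j : {i // 0 < ω i}, ω j ^ 2 * sin (arcsin (β * y j / ω j)) = β * (ω j * y j) := by
      intro j
      have := j.2.ne'
      rw [hsin j j.2]; field_simp
    simp only [e]
    rw [Finset.sum_filter, sum_sub (fun i => 0 < ω i)
      (fun j => if 0 ≤ x i * x j - y i * y j then β * (ω j * y j) else 0)
      (fun j hj => by simp [(hzero j hj).1]), hsin i i.2, hmu']
    have e2 : -(mu * (β * y i / ω i)) = β / ω i * (- mu * y i) := by ring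
    rw [e2, ← ey i, Finset.mul_sum]
    refine Finset.sum_congr rfl fun j _ => ?_
    rw [hA]
    split_ifs
    · field_simp
    · simp

lemma Psi_le {ι : Type} [Fintype ι] (p : (ι → ℝ) × (ι → ℝ) × (ι → ℝ)) (hp : p ∈ Ksph ι) :
    Psi p ≤ 2 / √3 := by
  classical
  obtain ⟨⟨ω', x', y⟩, hq, hmax⟩ := (Ksph_compact ι).exists_isMaxOn ⟨p, hp⟩ (Psi_cont ι).continuousOn
  refine (hmax hp).trans ?_
  by_contra hcon
  rw [not_le] at hcon
  obtain ⟨h1, h2, h3⟩ := hq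
  change ∑ i, ω' i ^ 2 = 1 at h1
  change ∑ i, x' i ^ 2 = 1 at h2
  change ∑ i, y i ^ 2 = 1 at h3
  obtain ⟨s, hs⟩ : ∃ s, s = Psi (ω', x', y) := ⟨_, rfl⟩
  have hmax' : ∀ q ∈ Ksph ι, Psi q ≤ s := fun q hq => by rw [hs]; exact hmax hq
  replace hcon : 2 / √3 < s := by rw [hs]; exact hcon
  obtain ⟨ω, hωd⟩ : ∃ ω : ι → ℝ, ω = fun i => |ω' i| := ⟨_, rfl⟩
  obtain ⟨x, hxd⟩ : ∃ x : ι → ℝ, x = fun i => |x' i| := ⟨_, rfl⟩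
  have hω0 : ∀ i, 0 ≤ ω i := fun i => by rw [hωd]; exact abs_nonneg _
  have hx0 : ∀ i, 0 ≤ x i := fun i => by rw [hxd]; exact abs_nonneg _
  have hω : ∑ i, ω i ^ 2 = 1 := by rw [hωd]; simpa using h1
  have hx : ∑ i, x i ^ 2 = 1 := by rw [hxd]; simpa using h2
  have hpsi : Psi (ω, x, y) = s := by
    apply le_antisymm (hmax' _ ⟨hω, hx, h3⟩)
    rw [hs]
    unfold Psi
    refine Finset.sum_le_sum fun i _ => Finset.sum_le_sum fun j _ => ?_
    simp only
    refine mul_le_mul ?_ ?_ (le_max_right _ _) (mul_nonneg (hω0 i) (hω0 j))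
    · rw [hωd]; simp only; rw [← abs_mul]; exact le_abs_self _
    · apply max_le_max _ le_rfl
      have : x' i * x' j ≤ x i * x j := by rw [hxd]; simp only; rw [← abs_mul]; exact le_abs_self _
      linarith
  obtain ⟨A, hA⟩ : ∃ A : ι → ι → ℝ, ∀ i j, A i j = if 0 ≤ x i * x j - y i * y j then 1 else 0 :=
    ⟨_, fun _ _ => rfl⟩
  have hAs : ∀ i j, A i j = A j i := by
    intro i j
    rw [hA, hA, mul_comm (x i), mul_comm (y i)]
  have hAabs : ∀ i j, |A i j| ≤ 1 := by
    intro i j; rw [hA]; split_ifs <;> norm_num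
  have hA0 : ∀ i j, 0 ≤ A i j := by
    intro i j; rw [hA]; split_ifs <;> norm_num
  have hA1 : ∀ i j, A i j ≤ 1 := by
    intro i j; rw [hA]; split_ifs <;> norm_num
  have hApos : ∀ i j, max (x i * x j - y i * y j) 0 = A i j * (x i * x j - y i * y j) := by
    intro i j
    rw [hA]
    split_ifs with h
    · rw [max_eq_left h, one_mul]
    · rw [max_eq_right (le_of_lt (not_le.1 h)), zero_mul]
  have hAle : ∀ i j (z : ℝ), A i j * z ≤ max z 0 := by
    intro i j z
    rcases le_total 0 z with h | h
    · rw [max_eq_left h]; exact mul_le_of_le_one_left h (hA1 i j)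
    · rw [max_eq_right h]; exact mul_nonpos_of_nonneg_of_nonpos (hA0 i j) h
  have hsplit : ∀ u v : ι → ℝ, ∑ i, ∑ j, A i j * (ω i * ω j) * (u i * u j) -
      ∑ i, ∑ j, A i j * (ω i * ω j) * (v i * v j) =
      ∑ i, ∑ j, ω i * ω j * (A i j * (u i * u j - v i * v j)) := by
    intro u v
    simp only [← Finset.sum_sub_distrib]
    exact Finset.sum_congr rfl fun i _ => Finset.sum_congr rfl fun j _ => by ring
  have hbound : ∀ u v : ι → ℝ, ∑ i, u i ^ 2 = 1 → ∑ i, v i ^ 2 = 1 →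
      ∑ i, ∑ j, A i j * (ω i * ω j) * (u i * u j) -
      ∑ i, ∑ j, A i j * (ω i * ω j) * (v i * v j) ≤ s := by
    intro u v hu hv
    rw [hsplit]
    refine le_trans ?_ (hmax' (ω, u, v) ⟨hω, hu, hv⟩)
    unfold Psi
    exact Finset.sum_le_sum fun i _ => Finset.sum_le_sum fun j _ =>
      mul_le_mul_of_nonneg_left (hAle i j _) (mul_nonneg (hω0 i) (hω0 j))
  obtain ⟨lam, hlam⟩ : ∃ lam, lam = ∑ i, ∑ j, A i j * (ω i * ω j) * (x i * x j) := ⟨_, rfl⟩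
  obtain ⟨mu, hmu⟩ : ∃ mu, mu = - ∑ i, ∑ j, A i j * (ω i * ω j) * (y i * y j) := ⟨_, rfl⟩
  have hsum : lam + mu = s := by
    rw [hlam, hmu, ← sub_eq_add_neg, hsplit, ← hpsi]
    unfold Psi
    exact Finset.sum_congr rfl fun i _ => Finset.sum_congr rfl fun j _ => by
      simp only; rw [hApos]
  have hBs : ∀ i j, A i j * (ω i * ω j) = A j i * (ω j * ω i) := fun i j => by
    rw [hAs i j, mul_comm (ω i)]
  have hxle : ∀ u : ι → ℝ, ∑ i, u i ^ 2 = 1 → ∑ i, ∑ j, A i j * (ω i * ω j) * (u i * u j) ≤ lam := by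
    intro u hu
    have := hbound u y hu h3
    linarith
  have hyle : ∀ u : ι → ℝ, ∑ i, u i ^ 2 = 1 → ∑ i, ∑ j, -(A i j * (ω i * ω j)) * (u i * u j) ≤ mu := by
    intro u hu
    have := hbound x u hx hu
    simp only [neg_mul, Finset.sum_neg_distrib]
    linarith
  have ex := eig_of_max (fun i j => A i j * (ω i * ω j)) hBs lam x hx hlam.symm hxle
  have ey := eig_of_max (fun i j => -(A i j * (ω i * ω j))) (fun i j => by rw [hBs]) mu y h3
    (by simp only [neg_mul, Finset.sum_neg_distrib]; exact hmu.symm) hyle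
  have eω := eig_of_max (fun i j => A i j * (x i * x j - y i * y j))
    (fun i j => by rw [hAs i j, mul_comm (x i), mul_comm (y i)]) s ω hω
    (by
      rw [← hpsi]; unfold Psi
      exact Finset.sum_congr rfl fun i _ => Finset.sum_congr rfl fun j _ => by
        simp only; rw [hApos]; ring)
    (by
      intro u hu
      refine le_trans (le_of_eq ?_) (hmax' (u, x, y) ⟨hu, hx, h3⟩)
      unfold Psi
      exact Finset.sum_congr rfl fun i _ => Finset.sum_congr rfl fun j _ => by
        simp only; rw [hApos]; ring)
  simp only [neg_mul, Finset.sum_neg_distrib] at ey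
  have hs0 : 0 < s := lt_trans (by positivity) hcon
  have hs2 : 4 / 3 < s ^ 2 := by
    have h := pow_lt_pow_left₀ hcon (by positivity) (two_ne_zero)
    rw [div_pow, sq_sqrt (by norm_num)] at h
    linarith
  refine stat_contra ω x y lam mu s hω0 hx0 hω hx h3 A hA hs2 hs0 hsum ?_ ?_ ex
    (fun i => by have := ey i; linarith) ?_ (hxle ω hω)
  · rw [hlam]; exact (le_abs_self _).trans (cs_aux ω x A hAabs hω hx)
  · rw [hmu]; exact (neg_le_abs _).trans (cs_aux ω y A hAabs hω h3)
  · intro i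
    have a1 := congrArg (fun z => x i * z) (ex i)
    have a2 := congrArg (fun z => y i * z) (ey i)
    have a3 := congrArg (fun z => ω i * z) (eω i)
    try simp only at a1 a2 a3
    have e : ω i * ∑ j, A i j * (x i * x j - y i * y j) * ω j =
        x i * ∑ j, A i j * (ω i * ω j) * x j - y i * ∑ j, A i j * (ω i * ω j) * y j := by
      simp only [Finset.mul_sum, ← Finset.sum_sub_distrib]
      exact Finset.sum_congr rfl fun j _ => by ring
    rw [e] at a3
    linarith

end Helpers

lemma eig_form {n : ℕ} (G : SimpleGraph (Fin n)) (k : Fin n) : ∃ v : Fin n → ℝ,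
    ∑ i, v i ^ 2 = 1 ∧ graphEigs G k = ∑ i, ∑ j, adjMat G i j * (v i * v j) := by
  obtain ⟨b, hb⟩ : ∃ b, b = (adjMat_isHermitian G).eigenvectorBasis := ⟨_, rfl⟩
  have h1 := (adjMat_isHermitian G).mulVec_eigenvectorBasis k
  rw [← hb] at h1
  have hn : ∑ i, (b k i) ^ 2 = 1 := by
    have h2 := b.orthonormal.1 k
    have h3 := EuclideanSpace.real_norm_sq_eq (b k)
    rw [h2] at h3
    linarith
  refine ⟨fun i => b k i, hn, ?_⟩
  have h4 : ∀ i, ∑ j, adjMat G i j * b k j = graphEigs G k * b k i := fun i => congrFun h1 i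
  calc graphEigs G k = graphEigs G k * ∑ i, (b k i) ^ 2 := by rw [hn, mul_one]
    _ = _ := by
      rw [Finset.mul_sum]
      refine Finset.sum_congr rfl fun i _ => ?_
      rw [sq, ← mul_assoc, ← h4 i, Finset.sum_mul]
      exact Finset.sum_congr rfl fun j _ => by ring

/-- For every simple graph `G` on `n` vertices, `s(G) ≤ 2n/√3`. -/
theorem spread_le (n : ℕ) (G : SimpleGraph (Fin n)) :
    spread G ≤ 2 * n / Real.sqrt 3 := by
  rcases Nat.eq_zero_or_pos n with hn | hn
  · subst hn
    simp [spread, lamMax, lamMin, Real.iSup_of_isEmpty, Real.iInf_of_isEmpty]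
  have : Nonempty (Fin n) := ⟨⟨0, hn⟩⟩
  obtain ⟨a, ha⟩ := exists_eq_ciSup_of_finite (f := graphEigs G)
  obtain ⟨b, hb⟩ := exists_eq_ciInf_of_finite (f := graphEigs G)
  obtain ⟨v, hv, hva⟩ := eig_form G a
  obtain ⟨u, hu, hub⟩ := eig_form G b
  have hnR : (0 : ℝ) < n := by exact_mod_cast hn
  have hsq : Real.sqrt n ^ 2 = n := Real.sq_sqrt hnR.le
  have hpsi := Psi_le (ι := Fin n) (fun _ => 1 / Real.sqrt n, v, u) ⟨by
    change ∑ _i : Fin n, (1 / Real.sqrt n) ^ 2 = 1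
    rw [div_pow, hsq]; simp; field_simp, hv, hu⟩
  have hle : spread G ≤ n * Psi (ι := Fin n) (fun _ => 1 / Real.sqrt n, v, u) := by
    unfold spread lamMax lamMin Psi
    rw [← ha, ← hb, hva, hub, ← Finset.sum_sub_distrib, Finset.mul_sum]
    refine Finset.sum_le_sum fun i _ => ?_
    rw [← Finset.sum_sub_distrib, Finset.mul_sum]
    refine Finset.sum_le_sum fun j _ => ?_
    change _ ≤ (n : ℝ) * (1 / Real.sqrt n * (1 / Real.sqrt n) * max (v i * v j - u i * u j) 0)
    have e : ∀ m : ℝ, (n : ℝ) * (1 / Real.sqrt n * (1 / Real.sqrt n) * m) = m := by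
      intro m
      rw [div_mul_div_comm, ← sq, ← sq, hsq, one_pow]
      field_simp
    rw [e]
    unfold adjMat
    split_ifs
    · rw [one_mul, one_mul]; exact le_max_left _ _
    · rw [zero_mul, zero_mul, sub_zero]; exact le_max_right _ _
  calc spread G ≤ n * Psi (ι := Fin n) (fun _ => 1 / Real.sqrt n, v, u) := hle
    _ ≤ n * (2 / Real.sqrt 3) := mul_le_mul_of_nonneg_left hpsi hnR.le
    _ = 2 * n / Real.sqrt 3 := by ring
end

section
/- There exist a constant C > 0 and N ∈ ℕ such that for all n ≥ N the following holds: if G is a simple graph on n vertices with s(G) = s(n), x is a unit eigenvector of the adjacency matrix of G for λ₁ := λ₁(G), and z is a unit eigenvector for λₙ := λₙ(G), then for every pair of vertices u, v: |(λ₁·x_u² − λₙ·z_u²) − (λ₁·x_v² − λₙ·z_v²)| < C/n. -/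
open Finset in
lemma quad_expand {n : ℕ} (G : SimpleGraph (Fin n)) (y : Fin n → ℝ) :
    ∃ c : Fin n → ℝ, (∑ i, ∑ j, adjMat G i j * y i * y j = ∑ i, graphEigs G i * c i ^ 2) ∧
      ∑ i, y i ^ 2 = ∑ i, c i ^ 2 := by
  classical
  set b := (adjMat_isHermitian G).eigenvectorBasis with hb
  set Y : EuclideanSpace ℝ (Fin n) := WithLp.toLp 2 y with hY
  refine ⟨fun i => inner ℝ (b i) Y, ?_, ?_⟩
  · have h1 : ∑ i, ∑ j, adjMat G i j * y i * y j
        = inner ℝ Y (WithLp.toLp 2 ((adjMat G).mulVec y)) := by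
      simp only [hY, EuclideanSpace.inner_eq_star_dotProduct, dotProduct, Matrix.mulVec,
        star_trivial, Finset.sum_mul]
      refine Finset.sum_congr rfl fun i _ => Finset.sum_congr rfl fun j _ => ?_
      ring
    rw [h1, ← b.sum_inner_mul_inner]
    refine Finset.sum_congr rfl fun i _ => ?_
    have h2 : inner ℝ (b i) (WithLp.toLp 2 ((adjMat G).mulVec y))
        = graphEigs G i * inner ℝ (b i) Y := by
      have h3 := (adjMat_isHermitian G).mulVec_eigenvectorBasis i
      have hs : (adjMat G).transpose = adjMat G := by
        have := adjMat_isHermitian G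
        rwa [Matrix.IsHermitian, Matrix.conjTranspose_eq_transpose_of_trivial] at this
      simp only [hY, EuclideanSpace.inner_eq_star_dotProduct, star_trivial]
      rw [dotProduct_comm, Matrix.dotProduct_mulVec, ← Matrix.mulVec_transpose, hs, h3,
        smul_dotProduct, dotProduct_comm]
      rfl
    rw [h2, real_inner_comm]; ring
  · have := b.sum_sq_norm_inner_right Y
    simp only [Real.norm_eq_abs, sq_abs] at this
    rw [this, EuclideanSpace.norm_sq_eq]
    simp [hY]

lemma quad_le_lamMax {n : ℕ} (G : SimpleGraph (Fin n)) (y : Fin n → ℝ) :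
    ∑ i, ∑ j, adjMat G i j * y i * y j ≤ lamMax G * ∑ i, y i ^ 2 := by
  obtain ⟨c, h1, h2⟩ := quad_expand G y
  rw [h1, h2, Finset.mul_sum]
  refine Finset.sum_le_sum fun i _ => mul_le_mul_of_nonneg_right ?_ (sq_nonneg _)
  exact le_ciSup (Set.finite_range (graphEigs G)).bddAbove i

lemma lamMin_le_quad {n : ℕ} (G : SimpleGraph (Fin n)) (y : Fin n → ℝ) :
    lamMin G * ∑ i, y i ^ 2 ≤ ∑ i, ∑ j, adjMat G i j * y i * y j := by
  obtain ⟨c, h1, h2⟩ := quad_expand G y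
  rw [h1, h2, Finset.mul_sum]
  refine Finset.sum_le_sum fun i _ => mul_le_mul_of_nonneg_right ?_ (sq_nonneg _)
  exact ciInf_le (Set.finite_range (graphEigs G)).bddBelow i

lemma adjMat_nonneg {n : ℕ} (G : SimpleGraph (Fin n)) (i j : Fin n) : 0 ≤ adjMat G i j := by
  unfold adjMat; split_ifs <;> norm_num

lemma adjMat_le_one {n : ℕ} (G : SimpleGraph (Fin n)) (i j : Fin n) : adjMat G i j ≤ 1 := by
  unfold adjMat; split_ifs <;> norm_num

lemma adjMat_self {n : ℕ} (G : SimpleGraph (Fin n)) (i : Fin n) : adjMat G i i = 0 := by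
  simp [adjMat]

lemma adjMat_symm {n : ℕ} (G : SimpleGraph (Fin n)) (i j : Fin n) :
    adjMat G i j = adjMat G j i := by
  unfold adjMat
  classical
  exact if_congr (G.adj_comm i j) rfl rfl

/-- row sums of the quadratic form at an eigenvector -/
lemma eig_row {n : ℕ} (G : SimpleGraph (Fin n)) (x : Fin n → ℝ) (l : ℝ)
    (h : (adjMat G).mulVec x = l • x) (i : Fin n) :
    ∑ j, adjMat G i j * x j = l * x i := by
  have := congrFun h i
  simpa [Matrix.mulVec, dotProduct] using this

lemma eig_row' {n : ℕ} (G : SimpleGraph (Fin n)) (x : Fin n → ℝ) (l : ℝ)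
    (h : (adjMat G).mulVec x = l • x) (i : Fin n) :
    ∑ j, adjMat G i j * x i * x j = l * x i ^ 2 := by
  have := eig_row G x l h i
  calc _ = x i * ∑ j, adjMat G i j * x j := by
        rw [Finset.mul_sum]; exact Finset.sum_congr rfl fun j _ => by ring
    _ = _ := by rw [this]; ring

lemma eig_quad {n : ℕ} (G : SimpleGraph (Fin n)) (x : Fin n → ℝ) (l : ℝ)
    (hx : ∑ u, x u ^ 2 = 1) (h : (adjMat G).mulVec x = l • x) :
    ∑ i, ∑ j, adjMat G i j * x i * x j = l := by
  simp_rw [eig_row' G x l h, ← Finset.mul_sum, hx, mul_one]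

lemma abs_eig_le {n : ℕ} (G : SimpleGraph (Fin n)) (x : Fin n → ℝ) (l : ℝ)
    (hx : ∑ u, x u ^ 2 = 1) (h : (adjMat G).mulVec x = l • x) :
    |l| ≤ ∑ i, ∑ j, adjMat G i j * |x i| * |x j| := by
  rw [← eig_quad G x l hx h]
  refine (Finset.abs_sum_le_sum_abs _ _).trans (Finset.sum_le_sum fun i _ => ?_)
  refine (Finset.abs_sum_le_sum_abs _ _).trans (Finset.sum_le_sum fun j _ => ?_)
  rw [abs_mul, abs_mul, abs_of_nonneg (adjMat_nonneg G i j)]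

lemma abs_eig_le_n {n : ℕ} (G : SimpleGraph (Fin n)) (x : Fin n → ℝ) (l : ℝ)
    (hx : ∑ u, x u ^ 2 = 1) (h : (adjMat G).mulVec x = l • x) :
    |l| ≤ n := by
  refine (abs_eig_le G x l hx h).trans ?_
  have h1 : ∑ i, ∑ j, adjMat G i j * |x i| * |x j| ≤ (∑ i, |x i|) ^ 2 := by
    rw [sq, Finset.sum_mul_sum]
    refine Finset.sum_le_sum fun i _ => Finset.sum_le_sum fun j _ => ?_
    rw [mul_assoc]
    exact mul_le_of_le_one_left (by positivity) (adjMat_le_one G i j)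
  refine h1.trans ?_
  have := sq_sum_le_card_mul_sum_sq (s := (Finset.univ : Finset (Fin n))) (f := fun i => |x i|)
  simpa [hx] using this

lemma eig_abs_le_lamMax {n : ℕ} (G : SimpleGraph (Fin n)) (x : Fin n → ℝ) (l : ℝ)
    (hx : ∑ u, x u ^ 2 = 1) (h : (adjMat G).mulVec x = l • x) :
    |l| ≤ lamMax G := by
  refine (abs_eig_le G x l hx h).trans ?_
  have := quad_le_lamMax G (fun i => |x i|)
  simpa [hx] using this

lemma entry_bound {n : ℕ} (G : SimpleGraph (Fin n)) (x : Fin n → ℝ) (l : ℝ)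
    (hx : ∑ u, x u ^ 2 = 1) (h : (adjMat G).mulVec x = l • x) (i : Fin n) :
    l ^ 2 * x i ^ 2 ≤ n := by
  rw [← mul_pow, ← eig_row G x l h i]
  refine (Finset.sum_mul_sq_le_sq_mul_sq _ _ _).trans ?_
  rw [hx, mul_one]
  calc ∑ j, adjMat G i j ^ 2 ≤ ∑ j : Fin n, (1 : ℝ) :=
        Finset.sum_le_sum fun j _ => pow_le_one₀ (adjMat_nonneg G i j) (adjMat_le_one G i j)
    _ = n := by simp

/-- the clone map -/
def cl {n : ℕ} (u v : Fin n) : Fin n → Fin n := fun i => if i = v then u else i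

lemma sum_cl {n : ℕ} (u v : Fin n) (h : Fin n → ℝ) :
    ∑ i, h (cl u v i) = ∑ i, h i - h v + h u := by
  have : ∀ i, h (cl u v i) = h i + if i = v then h u - h v else 0 := by
    intro i; unfold cl; split_ifs with hi
    · subst hi; ring
    · ring
  simp_rw [this, Finset.sum_add_distrib]
  simp; ring

lemma clone_quad {n : ℕ} (G : SimpleGraph (Fin n)) (x : Fin n → ℝ) (l : ℝ) (u v : Fin n)
    (hx : ∑ u, x u ^ 2 = 1) (h : (adjMat G).mulVec x = l • x) :
    ∑ i, ∑ j, adjMat (G.comap (cl u v)) i j * x (cl u v i) * x (cl u v j)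
      = l * (1 + 2 * (x u ^ 2 - x v ^ 2)) - 2 * (adjMat G u v * x u * x v) := by
  have h0 : ∀ i j, adjMat (G.comap (cl u v)) i j = adjMat G (cl u v i) (cl u v j) := by
    intro i j; classical exact if_congr Iff.rfl rfl rfl
  simp_rw [h0]
  have h1 : ∀ i, ∑ j, adjMat G (cl u v i) (cl u v j) * x (cl u v i) * x (cl u v j)
      = l * x (cl u v i) ^ 2 - adjMat G (cl u v i) v * x (cl u v i) * x v
        + adjMat G (cl u v i) u * x (cl u v i) * x u := by
    intro i
    rw [sum_cl u v (fun j => adjMat G (cl u v i) j * x (cl u v i) * x j),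
      eig_row' G x l h]
  simp_rw [h1]
  rw [sum_cl u v (fun i => l * x i ^ 2 - adjMat G i v * x i * x v + adjMat G i u * x i * x u)]
  have h2 : ∀ w, ∑ i, adjMat G i w * x i * x w = l * x w ^ 2 := by
    intro w
    rw [← eig_row' G x l h w]
    exact Finset.sum_congr rfl fun i _ => by rw [adjMat_symm G i w]; ring
  rw [Finset.sum_add_distrib, Finset.sum_sub_distrib, h2, h2, ← Finset.mul_sum, hx,
    adjMat_self, adjMat_self, adjMat_symm G v u]
  ring

lemma clone_norm {n : ℕ} (x : Fin n → ℝ) (u v : Fin n) (hx : ∑ u, x u ^ 2 = 1) :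
    ∑ i, x (cl u v i) ^ 2 = 1 + (x u ^ 2 - x v ^ 2) := by
  rw [sum_cl u v (fun i => x i ^ 2), hx]; ring

lemma exists_big {n : ℕ} (hn : 2 ≤ n) :
    ∃ H : SimpleGraph (Fin n), (11 / 10 : ℝ) * n - 17 / 10 ≤ spread H := by
  classical
  set k := n / 2 with hk
  obtain ⟨P, -, hP⟩ := Finset.exists_subset_card_eq (s := (Finset.univ : Finset (Fin n)))
    (n := k) (by simp; omega)
  obtain ⟨Q, hQs, hQ⟩ := Finset.exists_subset_card_eq (s := Pᶜ)
    (n := k) (by rw [Finset.card_compl, hP]; simp; omega)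
  have hdisj : ∀ i, i ∈ P → i ∉ Q := fun i hi hq => by
    have := hQs hq; simp at this; exact this hi
  let H : SimpleGraph (Fin n) :=
    { Adj := fun i j => i ≠ j ∧ ((i ∈ P ∧ j ∈ P) ∨ (i ∈ P ∧ j ∈ Q) ∨ (i ∈ Q ∧ j ∈ P))
      symm := ⟨fun i j h => by tauto⟩
      loopless := ⟨fun i h => h.1 rfl⟩ }
  let p : Fin n → ℝ := fun i => if i ∈ P then 1 else 0
  let q : Fin n → ℝ := fun i => if i ∈ Q then 1 else 0
  have hA : ∀ i j, adjMat H i j = p i * p j + p i * q j + q i * p j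
      - if i = j then p i else 0 := by
    intro i j
    have h1 := hdisj i
    have h2 := hdisj j
    by_cases hij : i = j
    · subst hij
      by_cases a : i ∈ P <;> by_cases c : i ∈ Q <;> simp_all [adjMat, H, p, q]
    · by_cases a : i ∈ P <;> by_cases c : i ∈ Q <;> by_cases a' : j ∈ P <;>
        by_cases c' : j ∈ Q <;> simp_all [adjMat, H, p, q]
  have hquad : ∀ a b : ℝ, (∑ i, ∑ j, adjMat H i j * (a * p i + b * q i) * (a * p j + b * q j)
      = a ^ 2 * k ^ 2 + 2 * a * b * k ^ 2 - a ^ 2 * k) ∧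
      ∑ i, (a * p i + b * q i) ^ 2 = (a ^ 2 + b ^ 2) * k := by
    intro a b
    have e1 : ∀ i, p i * (a * p i + b * q i) = a * p i := by
      intro i; have := hdisj i
      by_cases a : i ∈ P <;> by_cases c : i ∈ Q <;> simp_all [p, q]
    have e2 : ∀ i, q i * (a * p i + b * q i) = b * q i := by
      intro i; have := hdisj i
      by_cases a : i ∈ P <;> by_cases c : i ∈ Q <;> simp_all [p, q]
    have sp : ∑ i, p i = k := by simp [p, hP]
    have sq' : ∑ i, q i = k := by simp [q, hQ]
    have e3 : ∀ i, (a * p i + b * q i) ^ 2 = a ^ 2 * p i + b ^ 2 * q i := by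
      intro i
      calc _ = a * (p i * (a * p i + b * q i)) + b * (q i * (a * p i + b * q i)) := by ring
        _ = _ := by rw [e1, e2]; ring
    have e5 : ∀ i, p i * (a * p i + b * q i) ^ 2 = a ^ 2 * p i := by
      intro i
      linear_combination (a * p i + b * q i + a) * e1 i
    constructor
    · have e4 : ∀ i j, adjMat H i j * (a * p i + b * q i) * (a * p j + b * q j)
          = (a * p i) * (a * p j) + (a * p i) * (b * q j) + (b * q i) * (a * p j)
            - if i = j then a ^ 2 * p i else 0 := by
        intro i j
        calc _ = (p i * (a * p i + b * q i)) * (p j * (a * p j + b * q j))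
              + (p i * (a * p i + b * q i)) * (q j * (a * p j + b * q j))
              + (q i * (a * p i + b * q i)) * (p j * (a * p j + b * q j))
              - if i = j then p i * (a * p i + b * q i) ^ 2 else 0 := by
              rw [hA]
              split_ifs with hij
              · subst hij; ring
              · ring
          _ = _ := by rw [e1 i, e1 j, e2 i, e2 j, e5 i]
      simp_rw [e4]
      simp only [Finset.sum_sub_distrib, Finset.sum_add_distrib, ← Finset.mul_sum,
        ← Finset.sum_mul, sp, sq', Finset.sum_ite_eq, Finset.mem_univ, if_true]
      ring
    · simp_rw [e3]
      rw [Finset.sum_add_distrib, ← Finset.mul_sum, ← Finset.mul_sum, sp, sq']; ring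
  refine ⟨H, ?_⟩
  have m1 := quad_le_lamMax H (fun i => 2 * p i + 1 * q i)
  have m2 := lamMin_le_quad H (fun i => 1 * p i + (-2) * q i)
  rw [(hquad 2 1).1, (hquad 2 1).2] at m1
  rw [(hquad 1 (-2)).1, (hquad 1 (-2)).2] at m2
  have hk0 : (0 : ℝ) < k := by have : 0 < k := by omega
                               exact_mod_cast this
  have hkn : (n : ℝ) ≤ 2 * k + 1 := by have : n ≤ 2 * k + 1 := by omega
                                       exact_mod_cast this
  have m1' : (8 * (k : ℝ) - 4) / 5 ≤ lamMax H := by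
    by_contra hc; push Not at hc; nlinarith
  have m2' : lamMin H ≤ (-3 * (k : ℝ) - 1) / 5 := by
    by_contra hc; push Not at hc; nlinarith
  unfold spread
  linarith

/-- scalar perturbation estimate -/
lemma scalar_est (n l l' a t : ℝ) (hn : 800 ≤ n) (hl : |l| ≤ n) (ha : |a| ≤ 400 / n)
    (ht : |t| ≤ 400 / n) (h : l * (1 + 2 * a) - 2 * t ≤ l' * (1 + a)) :
    l * a - 400000 / n ≤ l' - l := by
  have hn0 : 0 < n := by linarith
  set e := 400 / n with he
  have hen : e * n = 400 := by rw [he]; field_simp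
  have he2 : e ≤ 1 / 2 := by rw [he, div_le_iff₀ hn0]; linarith
  have h4 : 400000 / n = 1000 * e := by rw [he]; ring
  rw [h4]
  have he0 : 0 < e := by positivity
  have ha1 := abs_le.1 ha
  have ht1 := abs_le.1 ht
  have hP : |l * a - 2 * t| ≤ 401 := by
    have h1 : |l * a| ≤ 400 := by
      rw [abs_mul]
      calc |l| * |a| ≤ n * e := mul_le_mul hl ha (abs_nonneg _) hn0.le
        _ = 400 := by linarith
    have := abs_le.1 h1
    rw [abs_le]; constructor <;> linarith
  have hPa : |(l * a - 2 * t) * a| ≤ 401 * e := by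
    rw [abs_mul]; exact mul_le_mul hP ha (abs_nonneg _) (by norm_num)
  have hPa1 := abs_le.1 hPa
  have hkey : l * a - 2 * t ≤ (l' - l) * (1 + a) := by linarith
  by_contra hc
  push Not at hc
  have h1a : 1 / 2 ≤ 1 + a := by linarith
  have : (l' - l) * (1 + a) < (l * a - 1000 * e) * (1 + a) :=
    mul_lt_mul_of_pos_right hc (by linarith)
  have h5 : 2 * t * a ≤ e := by
    have : |t * a| ≤ e * (1 / 2) := by
      rw [abs_mul]; exact mul_le_mul ht (ha.trans he2) (abs_nonneg _) he0.le
    have := (abs_le.1 this).2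
    linarith
  have h5' : -e ≤ 2 * t * a := by
    have : |t * a| ≤ e * (1 / 2) := by
      rw [abs_mul]; exact mul_le_mul ht (ha.trans he2) (abs_nonneg _) he0.le
    have := (abs_le.1 this).1
    linarith
  nlinarith

lemma one_sided {n : ℕ} (hn : 800 ≤ n) (G : SimpleGraph (Fin n))
    (hG : ∀ H : SimpleGraph (Fin n), spread H ≤ spread G)
    (x z : Fin n → ℝ) (hx : ∑ u, x u ^ 2 = 1) (hz : ∑ u, z u ^ 2 = 1)
    (ex : (adjMat G).mulVec x = lamMax G • x) (ez : (adjMat G).mulVec z = lamMin G • z)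
    (u v : Fin n) :
    (lamMax G * x u ^ 2 - lamMin G * z u ^ 2) - (lamMax G * x v ^ 2 - lamMin G * z v ^ 2)
      ≤ 800000 / n := by
  have hnR : (800 : ℝ) ≤ n := by exact_mod_cast hn
  have hn0 : (0 : ℝ) < n := by linarith
  obtain ⟨H, hH⟩ := exists_big (n := n) (by omega)
  have hs := hH.trans (hG H)
  have b1 := abs_eig_le_n G x _ hx ex
  have b2 := abs_eig_le_n G z _ hz ez
  have b3 := abs_le.1 (eig_abs_le_lamMax G z _ hz ez)
  have b1' := abs_le.1 b1
  unfold spread at hs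
  have c1 : (n : ℝ) / 20 ≤ lamMax G := by linarith
  have c2 : (n : ℝ) / 20 ≤ -lamMin G := by linarith
  have key : ∀ (y : Fin n → ℝ) (l : ℝ), (n : ℝ) / 20 ≤ l → (∀ i, l ^ 2 * y i ^ 2 ≤ n) →
      ∀ i, y i ^ 2 ≤ 400 / n := by
    intro y l hl hy i
    have h1 : ((n : ℝ) / 20) ^ 2 ≤ l ^ 2 := pow_le_pow_left₀ (by positivity) hl 2
    have h2 := (mul_le_mul_of_nonneg_right h1 (sq_nonneg (y i))).trans (hy i)
    rw [le_div_iff₀ hn0]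
    by_contra hc
    push Not at hc
    nlinarith
  have kx := key x _ c1 (entry_bound G x _ hx ex)
  have kz := key z _ c2 (fun i => by rw [neg_sq]; exact entry_bound G z _ hz ez i)
  have key2 : ∀ (y : Fin n → ℝ), (∀ i, y i ^ 2 ≤ 400 / (n : ℝ)) →
      |y u ^ 2 - y v ^ 2| ≤ 400 / n ∧ |adjMat G u v * y u * y v| ≤ 400 / n := by
    intro y hy
    have h1 := hy u
    have h2 := hy v
    have h3 := sq_nonneg (y u)
    have h4 := sq_nonneg (y v)
    constructor
    · rw [abs_le]; constructor <;> linarith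
    · rw [mul_assoc, abs_mul, abs_of_nonneg (adjMat_nonneg G u v)]
      refine (mul_le_of_le_one_left (abs_nonneg _) (adjMat_le_one G u v)).trans ?_
      rw [abs_le]
      constructor <;> nlinarith [sq_nonneg (y u - y v), sq_nonneg (y u + y v)]
  obtain ⟨ax, tx⟩ := key2 x kx
  obtain ⟨az, tz⟩ := key2 z kz
  set G' := G.comap (cl u v)
  have r1 := quad_le_lamMax G' (fun i => x (cl u v i))
  have r2 := lamMin_le_quad G' (fun i => z (cl u v i))
  rw [clone_quad G x _ u v hx ex, clone_norm x u v hx] at r1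
  rw [clone_quad G z _ u v hz ez, clone_norm z u v hz] at r2
  have s1 := scalar_est n _ _ _ _ hnR b1 ax tx r1
  have s2 := scalar_est n (-lamMin G) (-lamMin G') (z u ^ 2 - z v ^ 2)
    (-(adjMat G u v * z u * z v)) hnR (by rwa [abs_neg]) az (by rwa [abs_neg]) (by linarith)
  have s3 := hG G'
  unfold spread at s3
  have : (800000 : ℝ) / n = 400000 / n + 400000 / n := by ring
  rw [this]
  linarith

/-- For a spread-extremal graph, the quantities `λ₁ x_u² − λₙ z_u²` are all nearly
equal, up to `C/n`. -/
theorem spread_extremal_ellipse :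
    ∃ C : ℝ, 0 < C ∧ ∃ N : ℕ, ∀ n : ℕ, N ≤ n →
      ∀ G : SimpleGraph (Fin n), (∀ H : SimpleGraph (Fin n), spread H ≤ spread G) →
      ∀ x z : Fin n → ℝ, (∑ u, x u ^ 2 = 1) → (∑ u, z u ^ 2 = 1) →
        (adjMat G).mulVec x = lamMax G • x →
        (adjMat G).mulVec z = lamMin G • z →
        ∀ u v : Fin n,
          |(lamMax G * x u ^ 2 - lamMin G * z u ^ 2) -
            (lamMax G * x v ^ 2 - lamMin G * z v ^ 2)| < C / n := by
  refine ⟨1000000, by norm_num, 800, fun n hn G hG x z hx hz ex ez u v => ?_⟩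
  have hn0 : (0 : ℝ) < n := by
    have : 0 < n := by omega
    exact_mod_cast this
  have h1 := one_sided hn G hG x z hx hz ex ez u v
  have h2 := one_sided hn G hG x z hx hz ex ez v u
  have h3 : (800000 : ℝ) / n < 1000000 / n := by gcongr; norm_num
  rw [abs_lt]
  constructor <;> linarith
end
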